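/- Fix an integer k ≥ 1 and A > 0. Let g_1, …, g_k be functions each of which is one of: the Möbius function μ, the indicator function of the primes, the constant function 1, or the logarithm function. Let P(s) = Σ_{n_1⋯n_k ∼ N} g_1(n_1)⋯g_k(n_k)·(n_1⋯n_k)^{−s}. Then for N sufficiently large, |P(1+it)| ≤ exp(−(log N)^{1/10}) whenever exp((log N)^{1/3}) ≤ |t| ≤ N^{A·log log N}. -/

import Mathlib

open scoped Classical

/-- The Dirichlet polynomial
`P(1+it) = Σ_{n₁⋯n_k ∼ N} g₁(n₁)⋯g_k(n_k) (n₁⋯n_k)^{-1-it}`. -/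
noncomputable def tuplePoly (k : ℕ) (g : Fin k → ℕ → ℝ) (N : ℝ) (t : ℝ) : ℂ :=
  ∑ n ∈ Fintype.piFinset fun _ : Fin k => Finset.Icc 1 ⌊2 * N⌋₊,
    if N ≤ ∏ i, (n i : ℝ) ∧ (∏ i, (n i : ℝ)) < 2 * N then
      (∏ i, (g i (n i) : ℂ)) * ((∏ i, n i : ℕ) : ℂ) ^ (-(1 + (t : ℂ) * Complex.I))
    else 0

section LinnikCongruence
open Finset

/-- Equal power sums up to the number of variables force equal elementary symmetric functions. -/
theorem esymm_eq_of_psum_eq {R : Type*} [CommRing R] {k : ℕ} (u v : Fin k → R)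
    (hunit : ∀ n : ℕ, 1 ≤ n → n ≤ k → IsUnit (n : R))
    (h : ∀ j : Fin k, ∑ i, u i ^ ((j : ℕ) + 1) = ∑ i, v i ^ ((j : ℕ) + 1)) (n : ℕ) (hn : n ≤ k) :
    MvPolynomial.aeval u (MvPolynomial.esymm (Fin k) ℤ n)
      = MvPolynomial.aeval v (MvPolynomial.esymm (Fin k) ℤ n) := by
  induction n using Nat.strong_induction_on with
  | _ n ih =>
    rcases Nat.eq_zero_or_pos n with rfl | hpos
    · simp
    · have hu := congrArg (MvPolynomial.aeval u) (MvPolynomial.mul_esymm_eq_sum (Fin k) ℤ n)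
      have hv := congrArg (MvPolynomial.aeval v) (MvPolynomial.mul_esymm_eq_sum (Fin k) ℤ n)
      simp only [map_mul, map_natCast, map_pow, map_neg, map_one, map_sum] at hu hv
      apply (hunit n hpos hn).mul_left_cancel
      rw [hu, hv]
      congr 1
      apply Finset.sum_congr rfl
      rintro ⟨a, b⟩ hab
      simp only [mem_filter, HasAntidiagonal.mem_antidiagonal] at hab
      obtain ⟨hab, ha⟩ := hab
      simp only
      rw [ih a ha (by omega)]
      congr 1
      have := h ⟨b - 1, by omega⟩
      have hb : b - 1 + 1 = b := by omega
      simp only [hb] at this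
      simpa [MvPolynomial.psum] using this

theorem prod_sub_eq_zero_of_psum_eq {R : Type*} [CommRing R] {k : ℕ} (u v : Fin k → R)
    (hunit : ∀ n : ℕ, 1 ≤ n → n ≤ k → IsUnit (n : R))
    (h : ∀ j : Fin k, ∑ i, u i ^ ((j : ℕ) + 1) = ∑ i, v i ^ ((j : ℕ) + 1)) (i : Fin k) :
    ∏ j, (u i - v j) = 0 := by
  have key : ∏ j, (Polynomial.X - Polynomial.C (u j)) = ∏ j, (Polynomial.X - Polynomial.C (v j)) := by
    have e : ∀ w : Fin k → R, ∏ j, (Polynomial.X - Polynomial.C (w j)) =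
        (((univ : Finset (Fin k)).val.map w).map fun t => Polynomial.X - Polynomial.C t).prod := by
      intro w
      rw [Multiset.map_map]; rfl
    rw [e, e, Multiset.prod_X_sub_X_eq_sum_esymm, Multiset.prod_X_sub_X_eq_sum_esymm]
    simp only [Multiset.card_map, Finset.card_val, Finset.card_univ, Fintype.card_fin]
    apply Finset.sum_congr rfl
    intro j hj
    have hj' : j ≤ k := by simpa [Nat.lt_succ_iff] using hj
    have := esymm_eq_of_psum_eq u v hunit h j hj'
    rw [MvPolynomial.aeval_esymm_eq_multiset_esymm, MvPolynomial.aeval_esymm_eq_multiset_esymm]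
      at this
    rw [this]
  have := congrArg (Polynomial.eval (u i)) key
  simp only [Polynomial.eval_prod, Polynomial.eval_sub, Polynomial.eval_X, Polynomial.eval_C] at this
  rw [← this]
  exact Finset.prod_eq_zero (mem_univ i) (sub_self _)

/-- Residue vectors modulo `p ^ k` which lie over given residues modulo the powers `p ^ (j + 1)`. -/
theorem card_powerSum_fiber_le {k p X : ℕ} (hp : p.Prime) (hk : k < p) (hX : X ≤ p ^ k) (c : ℤ)
    (b : Fin k → ZMod (p ^ k)) :
    #{y : Fin k → Fin X | (Function.Injective fun i => ((y i : ℕ) : ZMod p)) ∧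
      (fun j : Fin k => ((∑ i, (((y i : ℕ) : ℤ) - c) ^ ((j : ℕ) + 1) : ℤ) : ZMod (p ^ k))) = b}
      ≤ k ^ k := by
  set S := ({y : Fin k → Fin X | (Function.Injective fun i => ((y i : ℕ) : ZMod p)) ∧
      (fun j : Fin k => ((∑ i, (((y i : ℕ) : ℤ) - c) ^ ((j : ℕ) + 1) : ℤ) : ZMod (p ^ k))) = b} :
      Finset (Fin k → Fin X)) with hS
  rcases S.eq_empty_or_nonempty with h0 | ⟨y0, hy0⟩
  · rw [h0]; simp
  have hsub : S ⊆ (univ : Finset (Fin k → Fin k)).image (fun σ i => y0 (σ i)) := by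
    intro y hy
    simp only [hS, mem_filter, mem_univ, true_and] at hy hy0
    have hps : ∀ j : Fin k, ∑ i, ((((y i : ℕ) : ℤ) - c : ℤ) : ZMod (p ^ k)) ^ ((j : ℕ) + 1)
        = ∑ i, ((((y0 i : ℕ) : ℤ) - c : ℤ) : ZMod (p ^ k)) ^ ((j : ℕ) + 1) := by
      intro j
      have := congrFun (hy.2.trans hy0.2.symm) j
      simpa using this
    have hunit : ∀ n : ℕ, 1 ≤ n → n ≤ k → IsUnit (n : ZMod (p ^ k)) := by
      intro n h1 h2
      rw [ZMod.isUnit_iff_coprime]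
      apply Nat.Coprime.pow_right
      rw [Nat.coprime_comm, hp.coprime_iff_not_dvd]
      intro hd
      have := Nat.le_of_dvd (by omega) hd
      omega
    have hex : ∀ i, ∃ j, y i = y0 j := by
      intro i
      have hz := prod_sub_eq_zero_of_psum_eq _ _ hunit hps i
      have hz' : ((p ^ k : ℕ) : ℤ) ∣ ∏ j, (((y i : ℕ) : ℤ) - ((y0 j : ℕ) : ℤ)) := by
        rw [← ZMod.intCast_zmod_eq_zero_iff_dvd _ _] 
        rw [← hz]
        push_cast
        apply Finset.prod_congr rfl
        intro j _
        ring
      push_cast at hz'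
      have hpi : Prime (p : ℤ) := Nat.prime_iff_prime_int.mp hp
      have hk0 : 0 < k := lt_of_le_of_lt (Nat.zero_le _) i.2
      have hdiv : (p : ℤ) ∣ ∏ j, (((y i : ℕ) : ℤ) - ((y0 j : ℕ) : ℤ)) :=
        (dvd_pow_self _ hk0.ne').trans hz'
      obtain ⟨j, -, hj⟩ := (hpi.dvd_finsetProd_iff _).mp hdiv
      refine ⟨j, ?_⟩
      have hcop : IsCoprime ((p : ℤ) ^ k) (∏ l ∈ univ.erase j, (((y i : ℕ) : ℤ) - ((y0 l : ℕ) : ℤ))) := by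
        apply IsCoprime.pow_left
        apply IsCoprime.prod_right
        intro l hl
        rw [(Prime.coprime_iff_not_dvd hpi)]
        intro hd
        have h2 : (p : ℤ) ∣ ((y0 l : ℕ) : ℤ) - ((y0 j : ℕ) : ℤ) := by
          have := dvd_sub hj hd
          simpa using this
        have h3 : ((y0 l : ℕ) : ZMod p) = ((y0 j : ℕ) : ZMod p) := by
          have := (ZMod.intCast_zmod_eq_zero_iff_dvd _ p).mpr h2
          push_cast at this
          exact sub_eq_zero.mp this
        exact (Finset.ne_of_mem_erase hl) (hy0.1 h3)
      rw [← Finset.mul_prod_erase univ _ (mem_univ j)] at hz'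
      have hd := hcop.dvd_of_dvd_mul_right hz'
      have hlt : |((y i : ℕ) : ℤ) - ((y0 j : ℕ) : ℤ)| < (p : ℤ) ^ k := by
        have h1 : ((y i : ℕ) : ℤ) < X := by exact_mod_cast (y i).2
        have h2 : ((y0 j : ℕ) : ℤ) < X := by exact_mod_cast (y0 j).2
        have h3 : (X : ℤ) ≤ (p : ℤ) ^ k := by exact_mod_cast hX
        rw [abs_lt]; constructor <;> omega
      have := Int.eq_zero_of_abs_lt_dvd hd hlt
      apply Fin.ext
      omega
    choose σ hσ using hex
    simp only [mem_image, mem_univ, true_and]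
    exact ⟨σ, funext fun i => (hσ i).symm⟩
  calc #S ≤ _ := card_le_card hsub
    _ ≤ _ := card_image_le
    _ = k ^ k := by simp

/-- **Linnik's lemma**: the number of solutions of a system of congruences
`∑ (y i - c) ^ j ≡ lam j mod p ^ j` with variables that are distinct modulo `p`. -/
theorem card_powerSum_congruence_le {k p X : ℕ} (hp : p.Prime) (hk : k < p) (hX : X ≤ p ^ k)
    (c : ℤ) (lam : Fin k → ℤ) :
    #{y : Fin k → Fin X | (Function.Injective fun i => ((y i : ℕ) : ZMod p)) ∧
      ∀ j : Fin k, (p : ℤ) ^ ((j : ℕ) + 1) ∣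
        ∑ i, (((y i : ℕ) : ℤ) - c) ^ ((j : ℕ) + 1) - lam j}
      ≤ k ^ k * p ^ (k * (k - 1) / 2) := by
  have hp0 : 0 < p := hp.pos
  set Φ : (Fin k → Fin X) → (Fin k → ZMod (p ^ k)) := fun y j =>
    ((∑ i, (((y i : ℕ) : ℤ) - c) ^ ((j : ℕ) + 1) : ℤ) : ZMod (p ^ k)) with hΦ
  set T : Finset (Fin k → ZMod (p ^ k)) :=
    (Fintype.piFinset fun j : Fin k => range (p ^ (k - 1 - (j : ℕ)))).image
      (fun b j => ((lam j + (p : ℤ) ^ ((j : ℕ) + 1) * (b j : ℤ) : ℤ) : ZMod (p ^ k))) with hT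
  have hTc : #T ≤ p ^ (k * (k - 1) / 2) := by
    refine card_image_le.trans ?_
    rw [Fintype.card_piFinset]
    simp only [card_range]
    rw [Finset.prod_pow_eq_pow_sum]
    apply le_of_eq
    congr 1
    rw [Fin.sum_univ_eq_sum_range (fun j => k - 1 - j), Finset.sum_range_reflect (fun j => j),
      Finset.sum_range_id]
  refine (card_le_mul_card_image_of_maps_to (f := Φ) (t := T) ?_ (k ^ k) ?_).trans
    (Nat.mul_le_mul_left _ hTc)
  · intro y hy
    simp only [mem_filter, mem_univ, true_and] at hy
    have : ∀ j : Fin k, ∃ b : ℕ, b < p ^ (k - 1 - (j : ℕ)) ∧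
        Φ y j = ((lam j + (p : ℤ) ^ ((j : ℕ) + 1) * (b : ℤ) : ℤ) : ZMod (p ^ k)) := by
      intro j
      obtain ⟨q, hq⟩ := hy.2 j
      have hm : (0 : ℤ) < (p : ℤ) ^ (k - 1 - (j : ℕ)) := by positivity
      refine ⟨(q % (p : ℤ) ^ (k - 1 - (j : ℕ))).toNat, ?_, ?_⟩
      · have h1 := Int.emod_lt_of_pos q hm
        have h2 := Int.emod_nonneg q hm.ne'
        zify
        rw [Int.toNat_of_nonneg h2]
        exact h1
      · rw [Int.toNat_of_nonneg (Int.emod_nonneg q hm.ne')]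
        simp only [hΦ]
        rw [← sub_eq_zero, ← Int.cast_sub, ZMod.intCast_zmod_eq_zero_iff_dvd]
        refine ⟨q / (p : ℤ) ^ (k - 1 - (j : ℕ)), ?_⟩
        have h1 := Int.emod_add_mul_ediv q ((p : ℤ) ^ (k - 1 - (j : ℕ)))
        have h2 : (p : ℤ) ^ k = (p : ℤ) ^ ((j : ℕ) + 1) * (p : ℤ) ^ (k - 1 - (j : ℕ)) := by
          rw [← pow_add]; congr 1; have := j.2; omega
        push_cast
        rw [h2]
        linear_combination hq - (p : ℤ) ^ ((j : ℕ) + 1) * h1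
    choose b hb1 hb2 using this
    simp only [hT, mem_image, Fintype.mem_piFinset, mem_range]
    exact ⟨b, hb1, funext fun j => (hb2 j).symm⟩
  · intro b _
    refine le_trans (card_le_card ?_) (card_powerSum_fiber_le hp hk hX c b)
    intro y hy
    simp only [mem_filter, mem_univ, true_and] at hy ⊢
    exact ⟨hy.1.1, hy.2⟩

end LinnikCongruence

section VinogradovCount
open Finset ComplexConjugate

/-- The point `(x, x ^ 2, …, x ^ k)` of the moment curve. -/
def powVec (k : ℕ) (x : ℤ) : Fin k → ℤ := fun j => x ^ ((j : ℕ) + 1)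

/-- The number of solutions of Vinogradov's system of degree `k`, with variables indexed by `ι` on
both sides, and all variables in `{0, …, X - 1}`. -/
noncomputable def vinogradovCount (k : ℕ) (ι : Type) [Fintype ι] [DecidableEq ι] (X : ℕ) : ℕ :=
  #{w : (ι → Fin X) × (ι → Fin X) |
    ∑ i, powVec k ((w.1 i : ℕ) : ℤ) = ∑ i, powVec k ((w.2 i : ℕ) : ℤ)}

/-- A finite family of unitary characters that detects zero on a prescribed finite set. -/
structure DetectingFamily {k : ℕ} (D : Finset (Fin k → ℤ)) (Ω : Type) [Fintype Ω]
    (χ : Ω → AddChar (Fin k → ℤ) ℂ) : Prop where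
  norm_eq : ∀ ω v, ‖χ ω v‖ = 1
  sum_eq : ∀ v ∈ D, ∑ ω, χ ω v = if v = 0 then (Fintype.card Ω : ℂ) else 0
  card_pos : 0 < Fintype.card Ω

theorem exists_detectingFamily {k : ℕ} (D : Finset (Fin k → ℤ)) :
    ∃ (Ω : Type) (_ : Fintype Ω) (χ : Ω → AddChar (Fin k → ℤ) ℂ), DetectingFamily D Ω χ := by
  obtain ⟨Q, hQ⟩ : ∃ Q : ℕ, ∀ v ∈ D, ∀ j, |v j| < Q := by
    refine ⟨∑ v ∈ D, ∑ j, (|v j|).toNat + 1, fun v hv j => ?_⟩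
    have h1 : (|v j|).toNat ≤ ∑ v ∈ D, ∑ j, (|v j|).toNat :=
      (Finset.single_le_sum (f := fun j => (|v j|).toNat) (fun _ _ => Nat.zero_le _)
        (mem_univ j)).trans
      (Finset.single_le_sum (f := fun v => ∑ j, (|v j|).toNat) (fun _ _ => Nat.zero_le _) hv)
    have h2 := Int.toNat_of_nonneg (abs_nonneg (v j))
    omega
  have hQ1 : NeZero (Q + 1) := ⟨by omega⟩
  let G := Fin k → ZMod (Q + 1)
  let red : (Fin k → ℤ) →+ G := (RingHom.pi fun j => (Int.castRingHom (ZMod (Q + 1))).comp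
    (Pi.evalRingHom _ j)).toAddMonoidHom
  refine ⟨AddChar G ℂ, inferInstance, fun ψ => ψ.compAddMonoidHom red, ⟨?_, ?_, Fintype.card_pos⟩⟩
  · intro ψ v
    simp
  · intro v hv
    have hz : red v = 0 ↔ v = 0 := by
      constructor
      · intro h
        funext j
        have h1 : ((v j : ℤ) : ZMod (Q + 1)) = 0 := congrFun h j
        rw [ZMod.intCast_zmod_eq_zero_iff_dvd] at h1
        refine Int.eq_zero_of_abs_lt_dvd h1 ?_
        have := hQ v hv j
        push_cast; omega
      · rintro rfl; simp
    have := AddChar.sum_apply_eq_ite (red v)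
    simp only [AddChar.compAddMonoidHom_apply]
    rw [this]
    simp only [hz]
    split_ifs
    · have := AddChar.card_eq (α := G); rw [← this]
    · rfl

namespace DetectingFamily

variable {k : ℕ} {D : Finset (Fin k → ℤ)} {Ω : Type} [Fintype Ω]
  {χ : Ω → AddChar (Fin k → ℤ) ℂ}

theorem map_neg (h : DetectingFamily D Ω χ) (ω : Ω) (v : Fin k → ℤ) :
    χ ω (-v) = conj (χ ω v) := by
  rw [AddChar.map_neg_eq_inv, Complex.inv_eq_conj (h.norm_eq ω v)]

theorem mono {D' : Finset (Fin k → ℤ)} (h : DetectingFamily D Ω χ) (hD : D' ⊆ D) :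
    DetectingFamily D' Ω χ := ⟨h.norm_eq, fun v hv => h.sum_eq v (hD hv), h.card_pos⟩

/-- Counting solutions of `v a = v' b + u` by characters. -/
theorem card_mul_card_eq {I I' : Type} (h : DetectingFamily D Ω χ) (S : Finset I) (T : Finset I')
    (v : I → Fin k → ℤ) (v' : I' → Fin k → ℤ) (u : Fin k → ℤ)
    (hD : ∀ a ∈ S, ∀ b ∈ T, v a - v' b - u ∈ D) :
    (Fintype.card Ω : ℂ) * #{w ∈ S ×ˢ T | v w.1 = v' w.2 + u} =
      ∑ ω, (∑ a ∈ S, χ ω (v a)) * conj (∑ b ∈ T, χ ω (v' b)) * χ ω (-u) := by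
  have h1 : ∀ ω, (∑ a ∈ S, χ ω (v a)) * conj (∑ b ∈ T, χ ω (v' b)) * χ ω (-u) =
      ∑ w ∈ S ×ˢ T, χ ω (v w.1 - v' w.2 - u) := by
    intro ω
    rw [map_sum, Finset.sum_mul_sum, Finset.sum_product, Finset.sum_mul]
    refine Finset.sum_congr rfl fun a _ => ?_
    rw [Finset.sum_mul]
    refine Finset.sum_congr rfl fun b _ => ?_
    rw [sub_eq_add_neg, sub_eq_add_neg, AddChar.map_add_eq_mul, AddChar.map_add_eq_mul, ← h.map_neg]
  simp only [h1]
  rw [Finset.sum_comm]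
  rw [Finset.sum_congr rfl fun w hw => h.sum_eq _ (hD w.1 (mem_product.mp hw).1 w.2
    (mem_product.mp hw).2)]
  rw [← Finset.sum_filter, Finset.sum_const, nsmul_eq_mul, mul_comm]
  have : ∀ w : I × I', v w.1 - v' w.2 - u = 0 ↔ v w.1 = v' w.2 + u := by
    intro w
    rw [sub_sub, sub_eq_zero]
  simp only [this]

theorem card_mul_card_le {I I' : Type} (h : DetectingFamily D Ω χ) (S : Finset I) (T : Finset I')
    (v : I → Fin k → ℤ) (v' : I' → Fin k → ℤ) (u : Fin k → ℤ)
    (hD : ∀ a ∈ S, ∀ b ∈ T, v a - v' b - u ∈ D) :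
    (Fintype.card Ω : ℝ) * #{w ∈ S ×ˢ T | v w.1 = v' w.2 + u} ≤
      ∑ ω, ‖∑ a ∈ S, χ ω (v a)‖ * ‖∑ b ∈ T, χ ω (v' b)‖ := by
  have h1 := h.card_mul_card_eq S T v v' u hD
  have h2 : (Fintype.card Ω : ℝ) * #{w ∈ S ×ˢ T | v w.1 = v' w.2 + u} =
      ‖(Fintype.card Ω : ℂ) * #{w ∈ S ×ˢ T | v w.1 = v' w.2 + u}‖ := by
    rw [norm_mul, Complex.norm_natCast, Complex.norm_natCast]
  rw [h2, h1]
  refine (norm_sum_le _ _).trans (Finset.sum_le_sum fun ω _ => ?_)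
  rw [norm_mul, norm_mul, h.norm_eq, mul_one, RCLike.norm_conj]

theorem card_mul_card_diag {I : Type} (h : DetectingFamily D Ω χ) (S : Finset I)
    (v : I → Fin k → ℤ) (hD : ∀ a ∈ S, ∀ b ∈ S, v a - v b ∈ D) :
    (Fintype.card Ω : ℝ) * #{w ∈ S ×ˢ S | v w.1 = v w.2} =
      ∑ ω, ‖∑ a ∈ S, χ ω (v a)‖ ^ 2 := by
  have h1 := h.card_mul_card_eq S S v v 0 (by simpa using hD)
  simp only [add_zero, neg_zero, AddChar.map_zero_eq_one, mul_one] at h1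
  have : ((Fintype.card Ω : ℝ) * #{w ∈ S ×ˢ S | v w.1 = v w.2} : ℂ) =
      ((∑ ω, ‖∑ a ∈ S, χ ω (v a)‖ ^ 2 : ℝ) : ℂ) := by
    push_cast
    rw [h1]
    exact Finset.sum_congr rfl fun ω _ => Complex.mul_conj' _
  exact_mod_cast this

end DetectingFamily

theorem exists_detectingFamily₂ {k : ℕ} (D D' : Finset (Fin k → ℤ)) :
    ∃ (Ω : Type) (_ : Fintype Ω) (χ : Ω → AddChar (Fin k → ℤ) ℂ),
      DetectingFamily D Ω χ ∧ DetectingFamily D' Ω χ := by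
  obtain ⟨Ω, i, χ, h⟩ := exists_detectingFamily (D ∪ D')
  exact ⟨Ω, i, χ, h.mono subset_union_left, h.mono subset_union_right⟩

/-- The number of solutions of a shifted homogeneous equation is at most the number of solutions
of the unshifted one. -/
theorem card_shift_le {k : ℕ} {I : Type} (S : Finset I) (v : I → Fin k → ℤ) (u : Fin k → ℤ) :
    #{w ∈ S ×ˢ S | v w.1 = v w.2 + u} ≤ #{w ∈ S ×ˢ S | v w.1 = v w.2} := by
  obtain ⟨Ω, _, χ, h⟩ := exists_detectingFamily
    ((S ×ˢ S).image (fun w => v w.1 - v w.2) ∪ (S ×ˢ S).image (fun w => v w.1 - v w.2 - u))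
  have h1 := h.card_mul_card_le S S v v u (fun a ha b hb => mem_union_right _
    (mem_image.mpr ⟨(a, b), mem_product.mpr ⟨ha, hb⟩, rfl⟩))
  have h2 := h.card_mul_card_diag S v (fun a ha b hb => mem_union_left _
    (mem_image.mpr ⟨(a, b), mem_product.mpr ⟨ha, hb⟩, rfl⟩))
  have h3 : (0 : ℝ) < Fintype.card Ω := by exact_mod_cast h.card_pos
  simp only [← pow_two] at h1
  rw [← h2] at h1
  exact_mod_cast le_of_mul_le_mul_left h1 h3

theorem AddChar.sum_piFinset_eq_prod {k : ℕ} {ι α : Type} [Fintype ι] [DecidableEq ι] (ψ : AddChar (Fin k → ℤ) ℂ)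
    (t : ι → Finset α) (v : α → Fin k → ℤ) :
    ∑ x ∈ Fintype.piFinset t, ψ (∑ i, v (x i)) = ∏ i, ∑ x ∈ t i, ψ (v x) := by
  rw [Finset.prod_univ_sum]
  refine Finset.sum_congr rfl fun x _ => ?_
  exact map_prod ψ.toMonoidHom (fun i => Multiplicative.ofAdd (v (x i))) univ

theorem AddChar.sum_pi_eq_pow {k : ℕ} {ι α : Type} [Fintype ι] [DecidableEq ι] [Fintype α]
    (ψ : AddChar (Fin k → ℤ) ℂ) (v : α → Fin k → ℤ) :
    ∑ x : ι → α, ψ (∑ i, v (x i)) = (∑ x, ψ (v x)) ^ Fintype.card ι := by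
  have := AddChar.sum_piFinset_eq_prod ψ (fun _ : ι => (univ : Finset α)) v
  rw [Fintype.piFinset_univ] at this
  rw [this, Finset.prod_const, Finset.card_univ]

/-- A finite set containing all differences of values of a vector valued function. -/
noncomputable def diffSet {k : ℕ} (I : Type) [Fintype I] (v : I → Fin k → ℤ) :
    Finset (Fin k → ℤ) :=
  univ.image fun w : I × I => v w.1 - v w.2

theorem mem_diffSet {k : ℕ} {I : Type} [Fintype I] (v : I → Fin k → ℤ) (a b : I) :
    v a - v b ∈ diffSet I v := mem_image.mpr ⟨(a, b), mem_univ _, rfl⟩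

theorem vinogradovCount_eq {k : ℕ} {ι : Type} [Fintype ι] [DecidableEq ι] {X : ℕ} {D : Finset (Fin k → ℤ)}
    {Ω : Type} [Fintype Ω] {χ : Ω → AddChar (Fin k → ℤ) ℂ} (h : DetectingFamily D Ω χ)
    (hD : diffSet (ι → Fin X) (fun x => ∑ i, powVec k ((x i : ℕ) : ℤ)) ⊆ D) :
    (Fintype.card Ω : ℝ) * vinogradovCount k ι X =
      ∑ ω, ‖∑ x : Fin X, χ ω (powVec k ((x : ℕ) : ℤ))‖ ^ (2 * Fintype.card ι) := by
  have := h.card_mul_card_diag (univ : Finset (ι → Fin X))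
    (fun x => ∑ i, powVec k ((x i : ℕ) : ℤ)) (fun a _ b _ => hD (mem_diffSet _ a b))
  rw [univ_product_univ] at this
  rw [vinogradovCount, this]
  refine Finset.sum_congr rfl fun ω _ => ?_
  rw [AddChar.sum_pi_eq_pow (χ ω) (fun x : Fin X => powVec k ((x : ℕ) : ℤ)), norm_pow, ← pow_mul,
    mul_comm]

theorem vinogradovCount_congr {k : ℕ} {ι κ : Type} [Fintype ι] [DecidableEq ι] [Fintype κ] [DecidableEq κ] {X : ℕ}
    (h : Fintype.card ι = Fintype.card κ) : vinogradovCount k ι X = vinogradovCount k κ X := by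
  obtain ⟨Ω, _, χ, hΩ, hΩ'⟩ := exists_detectingFamily₂
    (diffSet (ι → Fin X) (fun x => ∑ i, powVec k ((x i : ℕ) : ℤ)))
    (diffSet (κ → Fin X) (fun x => ∑ i, powVec k ((x i : ℕ) : ℤ)))
  have h1 := vinogradovCount_eq hΩ Subset.rfl
  have h2 := vinogradovCount_eq hΩ' Subset.rfl
  rw [h, ← h2] at h1
  have h3 : (Fintype.card Ω : ℝ) ≠ 0 := by exact_mod_cast hΩ.card_pos.ne'
  exact_mod_cast mul_left_cancel₀ h3 h1

theorem vinogradovCount_le_of_card_eq {k r : ℕ} {ι κ : Type} [Fintype ι] [DecidableEq ι] [Fintype κ] [DecidableEq κ] {X : ℕ}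
    (h : Fintype.card ι = Fintype.card κ + r) :
    (vinogradovCount k ι X : ℝ) ≤ (X : ℝ) ^ (2 * r) * vinogradovCount k κ X := by
  obtain ⟨Ω, _, χ, hΩ, hΩ'⟩ := exists_detectingFamily₂
    (diffSet (ι → Fin X) (fun x => ∑ i, powVec k ((x i : ℕ) : ℤ)))
    (diffSet (κ → Fin X) (fun x => ∑ i, powVec k ((x i : ℕ) : ℤ)))
  have h1 := vinogradovCount_eq hΩ Subset.rfl
  have h2 := vinogradovCount_eq hΩ' Subset.rfl
  have h3 : (0 : ℝ) < Fintype.card Ω := by exact_mod_cast hΩ.card_pos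
  refine le_of_mul_le_mul_left ?_ h3
  rw [mul_left_comm, h1, h2, Finset.mul_sum]
  refine Finset.sum_le_sum fun ω _ => ?_
  rw [h, mul_add, pow_add, mul_comm]
  gcongr
  refine (norm_sum_le _ _).trans ?_
  simp [hΩ.norm_eq]

/-- Adding variables costs at most the trivial factor. -/
theorem vinogradovCount_add_le (k s r X : ℕ) :
    (vinogradovCount k (Fin (s + r)) X : ℝ) ≤ (X : ℝ) ^ (2 * r) * vinogradovCount k (Fin s) X :=
  vinogradovCount_le_of_card_eq (by simp)

theorem vinogradovCount_le_trivial (k s X : ℕ) :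
    (vinogradovCount k (Fin s) X : ℝ) ≤ (X : ℝ) ^ (2 * s) := by
  have := vinogradovCount_add_le k 0 s X
  have h0 : (vinogradovCount k (Fin 0) X : ℝ) ≤ 1 := by
    rw [vinogradovCount]
    simp
  rw [zero_add] at this
  refine this.trans ?_
  exact mul_le_of_le_one_right (by positivity) h0

end VinogradovCount

section LinnikStep
open Finset ComplexConjugate

theorem sum_powVec_sub_eq {k : ℕ} {ι κ : Type} [Fintype ι] [Fintype κ]
    (hc : Fintype.card ι = Fintype.card κ) {a : ι → ℤ} {b : κ → ℤ}
    (h : ∑ i, powVec k (a i) = ∑ i, powVec k (b i)) (c : ℤ) :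
    ∑ i, powVec k (a i - c) = ∑ i, powVec k (b i - c) := by
  have h1 : ∀ n ≤ k, ∑ i, a i ^ n = ∑ i, b i ^ n := by
    intro n hn
    rcases n with _ | n
    · simp [hc]
    · have := congrFun h ⟨n, hn⟩
      simpa [powVec] using this
  funext j
  simp only [Finset.sum_apply, powVec, sub_eq_add_neg, add_pow]
  rw [Finset.sum_comm, Finset.sum_comm (s := (univ : Finset κ))]
  refine Finset.sum_congr rfl fun n hn => ?_
  rw [← Finset.sum_mul, ← Finset.sum_mul, ← Finset.sum_mul, ← Finset.sum_mul, h1 n]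
  have := mem_range.mp hn
  omega

/-- The elements of `{0, …, X - 1}` in a given residue class. -/
def residueSet (p X : ℕ) (c : ZMod p) : Finset (Fin X) := {x | ((x : ℕ) : ZMod p) = c}

theorem mem_residueSet {p X : ℕ} {c : ZMod p} {x : Fin X} :
    x ∈ residueSet p X c ↔ ((x : ℕ) : ZMod p) = c := by simp [residueSet]

theorem eq_of_mem_residueSet {p X : ℕ} [NeZero p] {c : ZMod p} {x : Fin X}
    (h : x ∈ residueSet p X c) : (x : ℕ) = c.val + p * ((x : ℕ) / p) := by
  rw [mem_residueSet] at h
  rw [← h, ZMod.val_natCast, Nat.mod_add_div]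

/-- Solutions confined to one residue class modulo `p`. -/
theorem card_residue_le {k p X : ℕ} [NeZero p] {ι : Type} [Fintype ι] [DecidableEq ι] (c : ZMod p) :
    #{w ∈ (Fintype.piFinset fun _ : ι => residueSet p X c) ×ˢ
        (Fintype.piFinset fun _ : ι => residueSet p X c) |
      ∑ i, powVec k ((w.1 i : ℕ) : ℤ) = ∑ i, powVec k ((w.2 i : ℕ) : ℤ)} ≤
      vinogradovCount k ι (X / p + 1) := by
  have hp : 0 < p := Nat.pos_of_ne_zero (NeZero.ne p)
  let q : Fin X → Fin (X / p + 1) := fun x => ⟨(x : ℕ) / p,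
    Nat.lt_succ_of_le (Nat.div_le_div_right x.2.le)⟩
  have hq : ∀ x ∈ residueSet p X c, ((x : ℕ) : ℤ) - c.val = p * ((q x : ℕ) : ℤ) := by
    intro x hx
    have := eq_of_mem_residueSet hx
    simp only [q]
    zify at this
    push_cast
    linarith
  have hp0 : (p : ℤ) ≠ 0 := by exact_mod_cast hp.ne'
  rw [vinogradovCount]
  refine Finset.card_le_card_of_injOn (fun w => (fun i => q (w.1 i), fun i => q (w.2 i))) ?_ ?_
  · intro w hw
    simp only [coe_filter, mem_product, Fintype.mem_piFinset, Set.mem_ofPred_eq] at hw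
    obtain ⟨⟨h1, h2⟩, h3⟩ := hw
    simp only [coe_filter, mem_univ, true_and, Set.mem_ofPred_eq]
    have h4 := sum_powVec_sub_eq rfl h3 (c.val : ℤ)
    funext j
    have h5 := congrFun h4 j
    simp only [Finset.sum_apply, powVec] at h5 ⊢
    simp only [fun i => hq _ (h1 i), fun i => hq _ (h2 i), mul_pow, ← Finset.mul_sum] at h5
    exact mul_left_cancel₀ (pow_ne_zero _ hp0) h5
  · have hinj : ∀ x ∈ residueSet p X c, ∀ y ∈ residueSet p X c, q x = q y → x = y := by
      intro x hx y hy h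
      have h1 := hq x hx
      have h2 := hq y hy
      rw [h] at h1
      ext
      zify
      linarith
    rintro ⟨x, y⟩ hw ⟨x', y'⟩ hw' h
    simp only [coe_filter, mem_product, Fintype.mem_piFinset, Set.mem_ofPred_eq] at hw hw'
    simp only [Prod.mk.injEq] at h
    refine Prod.ext (funext fun i => ?_) (funext fun i => ?_)
    · exact hinj _ (hw.1.1 i) _ (hw'.1.1 i) (congrFun h.1 i)
    · exact hinj _ (hw.1.2 i) _ (hw'.1.2 i) (congrFun h.2 i)

theorem mul_pow_le_add {D A Q : ℝ} (hD : 0 ≤ D) (hA : 0 ≤ A) (hQ : 0 < Q) (n : ℕ) :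
    D * A ^ n ≤ A ^ (n + 1) / Q + Q ^ n * D ^ (n + 1) := by
  rcases le_total (Q * D) A with h | h
  · have h1 : D ≤ A / Q := by rw [le_div_iff₀ hQ]; linarith
    have h2 : D * A ^ n ≤ A / Q * A ^ n := by gcongr
    have h3 : A / Q * A ^ n = A ^ (n + 1) / Q := by ring
    have h4 : 0 ≤ Q ^ n * D ^ (n + 1) := by positivity
    linarith
  · have h2 : D * A ^ n ≤ D * (Q * D) ^ n := by gcongr
    have h3 : D * (Q * D) ^ n = Q ^ n * D ^ (n + 1) := by ring
    have h4 : 0 ≤ A ^ (n + 1) / Q := by positivity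
    linarith

end LinnikStep

section LinnikStep
open Finset ComplexConjugate

variable {k p X : ℕ} {D : Finset (Fin k → ℤ)} {Ω : Type} [Fintype Ω]
  {χ : Ω → AddChar (Fin k → ℤ) ℂ} {ι : Type} [Fintype ι] [DecidableEq ι]

theorem sum_norm_residue_pow_le [NeZero p] (h : DetectingFamily D Ω χ)
    (hD : diffSet (ι → Fin X) (fun x => ∑ i, powVec k ((x i : ℕ) : ℤ)) ⊆ D) (c : ZMod p) :
    ∑ ω, ‖∑ x ∈ residueSet p X c, χ ω (powVec k ((x : ℕ) : ℤ))‖ ^ (2 * Fintype.card ι) ≤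
      Fintype.card Ω * vinogradovCount k ι (X / p + 1) := by
  have := h.card_mul_card_diag (Fintype.piFinset fun _ : ι => residueSet p X c)
    (fun x => ∑ i, powVec k ((x i : ℕ) : ℤ)) (fun a _ b _ => hD (mem_diffSet _ a b))
  calc _ = ∑ ω, ‖∑ x ∈ Fintype.piFinset fun _ : ι => residueSet p X c,
        χ ω (∑ i, powVec k ((x i : ℕ) : ℤ))‖ ^ 2 := by
        refine Finset.sum_congr rfl fun ω _ => ?_
        rw [AddChar.sum_piFinset_eq_prod (χ ω) (fun _ : ι => residueSet p X c)
          (fun x : Fin X => powVec k ((x : ℕ) : ℤ)), Finset.prod_const, card_univ, norm_pow,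
          ← pow_mul, mul_comm]
    _ ≤ _ := by
        rw [← this]
        gcongr
        exact card_residue_le c

theorem norm_sum_collision_le [NeZero p] {i j : ι} (hij : i ≠ j) {n : ℕ}
    (hn : Fintype.card ι = n + 2) (ψ : AddChar (Fin k → ℤ) ℂ) :
    ‖∑ x : ι → Fin X with ((x i : ℕ) : ZMod p) = ((x j : ℕ) : ZMod p),
      ψ (∑ i, powVec k ((x i : ℕ) : ℤ))‖ ≤
    (∑ c : ZMod p, ‖∑ x ∈ residueSet p X c, ψ (powVec k ((x : ℕ) : ℤ))‖ ^ 2) *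
      ‖∑ x : Fin X, ψ (powVec k ((x : ℕ) : ℤ))‖ ^ n := by
  let t : ZMod p → ι → Finset (Fin X) := fun c l => if l ∈ ({i, j} : Finset ι) then
    residueSet p X c else univ
  have h1 : (∑ x : ι → Fin X with ((x i : ℕ) : ZMod p) = ((x j : ℕ) : ZMod p),
      ψ (∑ i, powVec k ((x i : ℕ) : ℤ))) =
      ∑ c : ZMod p, ∑ x ∈ Fintype.piFinset (t c), ψ (∑ i, powVec k ((x i : ℕ) : ℤ)) := by
    rw [← Finset.sum_fiberwise (s := {x : ι → Fin X | ((x i : ℕ) : ZMod p) = ((x j : ℕ) : ZMod p)})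
      (g := fun x => ((x i : ℕ) : ZMod p))]
    refine Finset.sum_congr rfl fun c _ => Finset.sum_congr ?_ fun _ _ => rfl
    ext x
    simp only [mem_filter, mem_univ, true_and, Fintype.mem_piFinset, t]
    constructor
    · rintro ⟨h1, h2⟩ l
      split_ifs with hl
      · rw [mem_insert, mem_singleton] at hl
        rcases hl with rfl | rfl
        · exact mem_residueSet.mpr h2
        · exact mem_residueSet.mpr (h1 ▸ h2)
      · exact mem_univ _
    · intro h
      have hi := h i
      have hj := h j
      rw [if_pos (by simp), mem_residueSet] at hi hj
      exact ⟨hi.trans hj.symm, hi⟩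
  rw [h1, Finset.sum_mul]
  refine (norm_sum_le _ _).trans (Finset.sum_le_sum fun c _ => ?_)
  rw [AddChar.sum_piFinset_eq_prod ψ (t c) (fun x : Fin X => powVec k ((x : ℕ) : ℤ))]
  have h2 : ∀ l, ∑ x ∈ t c l, ψ (powVec k ((x : ℕ) : ℤ)) = if l ∈ ({i, j} : Finset ι) then
      ∑ x ∈ residueSet p X c, ψ (powVec k ((x : ℕ) : ℤ)) else
      ∑ x : Fin X, ψ (powVec k ((x : ℕ) : ℤ)) := by
    intro l
    simp only [t]
    split_ifs <;> rfl
  simp only [h2]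
  rw [Finset.prod_ite, Finset.prod_const, Finset.prod_const, norm_mul, norm_pow, norm_pow]
  have h3 : #{l : ι | l ∈ ({i, j} : Finset ι)} = 2 := by
    rw [Finset.filter_mem_eq_inter, Finset.univ_inter, card_pair hij]
  have h4 : #{l : ι | l ∉ ({i, j} : Finset ι)} = n := by
    have := Finset.card_filter_add_card_filter_not (s := (univ : Finset ι))
      (fun l => l ∈ ({i, j} : Finset ι))
    rw [card_univ] at this
    omega
  rw [h3, h4]

theorem card_mul_card_collision_le [NeZero p] (h : DetectingFamily D Ω χ)
    (hD : diffSet (ι → Fin X) (fun x => ∑ i, powVec k ((x i : ℕ) : ℤ)) ⊆ D) {n : ℕ}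
    (hn : Fintype.card ι = n + 2) {i j : ι} (hij : i ≠ j) {Q : ℝ} (hQ : 0 < Q) :
    (#{w ∈ ({x : ι → Fin X | ((x i : ℕ) : ZMod p) = ((x j : ℕ) : ZMod p)} : Finset _) ×ˢ
        (univ : Finset (ι → Fin X)) |
      ∑ i, powVec k ((w.1 i : ℕ) : ℤ) = ∑ i, powVec k ((w.2 i : ℕ) : ℤ)} : ℝ) ≤
      vinogradovCount k ι X / Q +
        Q ^ (n + 1) * (p ^ (n + 2) * vinogradovCount k ι (X / p + 1)) := by
  have h3 : (0 : ℝ) < Fintype.card Ω := by exact_mod_cast h.card_pos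
  refine le_of_mul_le_mul_left ?_ h3
  have h1 := h.card_mul_card_le
    ({x : ι → Fin X | ((x i : ℕ) : ZMod p) = ((x j : ℕ) : ZMod p)} : Finset _) (univ : Finset (ι → Fin X))
    (fun x => ∑ i, powVec k ((x i : ℕ) : ℤ)) (fun x => ∑ i, powVec k ((x i : ℕ) : ℤ)) 0
    (fun a _ b _ => by simpa using hD (mem_diffSet _ a b))
  simp only [add_zero] at h1
  refine h1.trans ?_
  have hJ := vinogradovCount_eq h hD
  have hX := fun c : ZMod p => sum_norm_residue_pow_le (p := p) h hD c
  calc _ ≤ ∑ ω, ((‖∑ x : Fin X, χ ω (powVec k ((x : ℕ) : ℤ))‖ ^ (2 * Fintype.card ι)) / Q +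
        Q ^ (n + 1) * (p ^ (n + 1) * ∑ c : ZMod p,
          ‖∑ x ∈ residueSet p X c, χ ω (powVec k ((x : ℕ) : ℤ))‖ ^ (2 * Fintype.card ι))) := by
        refine Finset.sum_le_sum fun ω _ => ?_
        set f := ‖∑ x : Fin X, χ ω (powVec k ((x : ℕ) : ℤ))‖
        set D := ∑ c : ZMod p, ‖∑ x ∈ residueSet p X c, χ ω (powVec k ((x : ℕ) : ℤ))‖ ^ 2 with hDdef
        have hu : ‖∑ x : ι → Fin X, χ ω (∑ i, powVec k ((x i : ℕ) : ℤ))‖ = f ^ (n + 2) := by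
          rw [AddChar.sum_pi_eq_pow (χ ω) (fun x : Fin X => powVec k ((x : ℕ) : ℤ)), norm_pow, hn]
        rw [hu]
        have h5 := norm_sum_collision_le (p := p) (X := X) hij hn (χ ω)
        have h6 : D * f ^ n * f ^ (n + 2) = D * (f ^ 2) ^ (n + 1) := by ring
        have h7 := mul_pow_le_add (D := D) (A := f ^ 2) (by positivity) (by positivity) hQ (n + 1)
        have h8 : D ^ (n + 1 + 1) ≤ p ^ (n + 1) * ∑ c : ZMod p,
            ‖∑ x ∈ residueSet p X c, χ ω (powVec k ((x : ℕ) : ℤ))‖ ^ (2 * Fintype.card ι) := by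
          have h10 := pow_sum_div_card_le_sum_pow (s := (univ : Finset (ZMod p))) (n := n + 1)
            (f := fun c => ‖∑ x ∈ residueSet p X c, χ ω (powVec k ((x : ℕ) : ℤ))‖ ^ 2)
            (fun c _ => by positivity)
          have hp : (0 : ℝ) < p := by exact_mod_cast Nat.pos_of_ne_zero (NeZero.ne p)
          rw [card_univ, ZMod.card, div_le_iff₀ (by positivity), mul_comm] at h10
          refine h10.trans (le_of_eq ?_)
          simp only [← pow_mul, hn]
        calc _ ≤ (D * f ^ n) * f ^ (n + 2) := by gcongr
          _ ≤ _ := by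
            rw [h6]
            refine h7.trans ?_
            rw [← pow_mul, hn]
            gcongr
            rwa [hn] at h8
    _ = (Fintype.card Ω * vinogradovCount k ι X) / Q + Q ^ (n + 1) * (p ^ (n + 1) * ∑ c : ZMod p,
          ∑ ω, ‖∑ x ∈ residueSet p X c, χ ω (powVec k ((x : ℕ) : ℤ))‖ ^ (2 * Fintype.card ι)) := by
        rw [Finset.sum_add_distrib, ← Finset.sum_div, ← hJ, ← Finset.mul_sum, ← Finset.mul_sum,
          Finset.sum_comm]
    _ ≤ (Fintype.card Ω * vinogradovCount k ι X) / Q + Q ^ (n + 1) * (p ^ (n + 1) * ∑ c : ZMod p,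
          (Fintype.card Ω * vinogradovCount k ι (X / p + 1) : ℝ)) := by
        gcongr with c
        exact hX c
    _ = _ := by
        rw [Finset.sum_const, card_univ, ZMod.card, nsmul_eq_mul]
        ring

end LinnikStep

section LinnikStep
open Finset ComplexConjugate

variable {k p X s : ℕ} {D : Finset (Fin k → ℤ)} {Ω : Type} [Fintype Ω]
  {χ : Ω → AddChar (Fin k → ℤ) ℂ}

/-- Tuples incongruent modulo `p`. -/
noncomputable def injTuples (p k X : ℕ) : Finset (Fin k → Fin X) :=
  {u | Function.Injective fun i => ((u i : ℕ) : ZMod p)}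

/-- Tuples whose first `k` entries are incongruent modulo `p`, and the others belong to `T`. -/
noncomputable def incongruentTuples (p k s X : ℕ) (T : Finset (Fin X)) :
    Finset (Fin k ⊕ Fin s → Fin X) :=
  {x | (Function.Injective fun i : Fin k => ((x (Sum.inl i) : ℕ) : ZMod p)) ∧
    ∀ i, x (Sum.inr i) ∈ T}

theorem sum_incongruentTuples (ψ : AddChar (Fin k → ℤ) ℂ) (T : Finset (Fin X)) :
    ∑ x ∈ incongruentTuples p k s X T, ψ (∑ i, powVec k ((x i : ℕ) : ℤ)) =
      (∑ u ∈ injTuples p k X, ψ (∑ i, powVec k ((u i : ℕ) : ℤ))) * (∑ x ∈ T, ψ (powVec k ((x : ℕ) : ℤ))) ^ s := by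
  have h1 := AddChar.sum_piFinset_eq_prod ψ (fun _ : Fin s => T)
    (fun x : Fin X => powVec k ((x : ℕ) : ℤ))
  rw [Finset.prod_const, card_univ, Fintype.card_fin] at h1
  rw [← h1, Finset.sum_mul_sum, ← Finset.sum_product']
  refine Finset.sum_equiv (Equiv.sumArrowEquivProdArrow _ _ _) ?_ ?_
  · intro x
    simp [incongruentTuples, injTuples, Equiv.sumArrowEquivProdArrow]
  · intro x _
    rw [Fintype.sum_sum_type, AddChar.map_add_eq_mul]
    rfl

theorem card_add_eq_add_le {U Z : Type} (A : Finset U) (B : Finset Z) (a : U → Fin k → ℤ)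
    (b : Z → Fin k → ℤ) (P : Finset (U × U))
    (hP : ∀ u ∈ A, ∀ u' ∈ A, ∀ z ∈ B, ∀ z' ∈ B, a u + b z = a u' + b z' → (u', u) ∈ P) :
    #{w ∈ (A ×ˢ B) ×ˢ (A ×ˢ B) | a w.1.1 + b w.1.2 = a w.2.1 + b w.2.2} ≤
      #P * #{w ∈ B ×ˢ B | b w.1 = b w.2} := by
  rw [mul_comm]
  refine Finset.card_le_mul_card_image_of_maps_to (f := fun w => (w.2.1, w.1.1)) ?_ _ ?_
  · intro w hw
    simp only [mem_filter, mem_product] at hw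
    exact hP _ hw.1.1.1 _ hw.1.2.1 _ hw.1.1.2 _ hw.1.2.2 hw.2
  · rintro ⟨u', u⟩ -
    refine le_trans ?_ (card_shift_le B b (a u' - a u))
    refine Finset.card_le_card_of_injOn (fun w => (w.1.2, w.2.2)) ?_ ?_
    · intro w hw
      simp only [mem_filter, mem_product, coe_filter, Set.mem_ofPred_eq, Prod.mk.injEq] at hw ⊢
      obtain ⟨⟨⟨⟨h1, h2⟩, h3, h4⟩, h5⟩, h6, h7⟩ := hw
      refine ⟨⟨h2, h4⟩, ?_⟩
      subst h6 h7
      rw [add_sub, eq_sub_iff_add_eq, add_comm, h5, add_comm]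
    · rintro ⟨⟨_, _⟩, ⟨_, _⟩⟩ hw ⟨⟨_, _⟩, ⟨_, _⟩⟩ hw' h
      simp only [mem_filter, coe_filter, Set.mem_ofPred_eq, Prod.mk.injEq] at hw hw' h ⊢
      obtain ⟨-, h6, h7⟩ := hw
      obtain ⟨-, h6', h7'⟩ := hw'
      exact ⟨⟨h7.trans h7'.symm, h.1⟩, h6.trans h6'.symm, h.2⟩

/-- Pairs of tuples incongruent modulo `p` whose shifted power sums agree modulo powers of `p`. -/
noncomputable def congruencePairs (p k X : ℕ) (c : ℤ) :
    Finset ((Fin k → Fin X) × (Fin k → Fin X)) :=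
  {u | (Function.Injective fun i => ((u.2 i : ℕ) : ZMod p)) ∧ ∀ j : Fin k,
      (p : ℤ) ^ ((j : ℕ) + 1) ∣ ∑ i, (((u.2 i : ℕ) : ℤ) - c) ^ ((j : ℕ) + 1) -
        ∑ i, (((u.1 i : ℕ) : ℤ) - c) ^ ((j : ℕ) + 1)}

theorem card_congruencePairs_le [Fact p.Prime] (hk : k < p) (hX : X ≤ p ^ k) (c : ℤ) :
    #(congruencePairs p k X c) ≤ X ^ k * (k ^ k * p ^ (k * (k - 1) / 2)) := by
  have hp : p.Prime := Fact.out
  have : #(congruencePairs p k X c) =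
      ∑ u : Fin k → Fin X, #{y ∈ congruencePairs p k X c | y.1 = u} :=
    Finset.card_eq_sum_card_fiberwise (fun _ _ => mem_coe.mpr (mem_univ _))
  rw [this]
  have h2 : ∀ u ∈ (univ : Finset (Fin k → Fin X)), #{y ∈ congruencePairs p k X c | y.1 = u} ≤
      k ^ k * p ^ (k * (k - 1) / 2) := by
    intro u _
    refine le_trans ?_ (card_powerSum_congruence_le hp hk hX c
      (fun j => ∑ i, (((u i : ℕ) : ℤ) - c) ^ ((j : ℕ) + 1)))
    refine Finset.card_le_card_of_injOn Prod.snd ?_ ?_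
    · intro y hy
      simp only [congruencePairs, coe_filter, mem_filter, mem_univ, true_and,
        Set.mem_ofPred_eq] at hy ⊢
      rw [← hy.2]
      exact hy.1
    · intro y hy y' hy' h
      simp only [coe_filter, Set.mem_ofPred_eq] at hy hy'
      exact Prod.ext (hy.2.trans hy'.2.symm) h
  refine (Finset.sum_le_card_nsmul _ _ _ h2).trans ?_
  simp

theorem card_incongruent_le [Fact p.Prime] (hk : k < p) (hX : X ≤ p ^ k) (c : ZMod p) :
    #{w ∈ (injTuples p k X ×ˢ Fintype.piFinset fun _ : Fin s => residueSet p X c) ×ˢ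
        (injTuples p k X ×ˢ Fintype.piFinset fun _ : Fin s => residueSet p X c) |
      ∑ i, powVec k ((w.1.1 i : ℕ) : ℤ) + ∑ i, powVec k ((w.1.2 i : ℕ) : ℤ) =
      ∑ i, powVec k ((w.2.1 i : ℕ) : ℤ) + ∑ i, powVec k ((w.2.2 i : ℕ) : ℤ)} ≤
      X ^ k * (k ^ k * p ^ (k * (k - 1) / 2)) * vinogradovCount k (Fin s) (X / p + 1) := by
  refine (card_add_eq_add_le (injTuples p k X) (Fintype.piFinset fun _ : Fin s => residueSet p X c)
    (fun u => ∑ i, powVec k ((u i : ℕ) : ℤ)) (fun u => ∑ i, powVec k ((u i : ℕ) : ℤ))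
    (congruencePairs p k X c.val) ?_).trans
    (Nat.mul_le_mul (card_congruencePairs_le hk hX _) (card_residue_le c))
  intro u hu u' _ z hz z' hz' h5
  rw [Fintype.mem_piFinset] at hz hz'
  rw [injTuples, mem_filter] at hu
  rw [congruencePairs, mem_filter]
  refine ⟨mem_univ _, hu.2, fun j => ?_⟩
  have h5' : ∑ i : Fin k ⊕ Fin s, powVec k (Sum.elim (fun i => ((u i : ℕ) : ℤ))
      (fun i => ((z i : ℕ) : ℤ)) i) = ∑ i : Fin k ⊕ Fin s, powVec k (Sum.elim
      (fun i => ((u' i : ℕ) : ℤ)) (fun i => ((z' i : ℕ) : ℤ)) i) := by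
    simpa [Fintype.sum_sum_type] using h5
  have h6 := congrFun (sum_powVec_sub_eq rfl h5' (c.val : ℤ)) j
  simp only [Fintype.sum_sum_type, Finset.sum_apply, powVec, Sum.elim_inl, Sum.elim_inr] at h6
  have h7 : ∀ x ∈ residueSet p X c, (p : ℤ) ^ ((j : ℕ) + 1) ∣
      (((x : ℕ) : ℤ) - c.val) ^ ((j : ℕ) + 1) := by
    intro x hx
    have h8 : (p : ℤ) ∣ ((x : ℕ) : ℤ) - c.val := by
      refine ⟨(((x : ℕ) / p : ℕ) : ℤ), ?_⟩
      have := eq_of_mem_residueSet hx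
      zify at this
      push_cast
      linarith
    exact pow_dvd_pow_of_dvd h8 _
  have h8 := Finset.dvd_sum (s := univ) fun i _ => h7 _ (hz i)
  have h9 := Finset.dvd_sum (s := univ) fun i _ => h7 _ (hz' i)
  have h10 := dvd_sub h9 h8
  rw [← sub_eq_sub_iff_add_eq_add.mpr (h6.trans (add_comm _ _))] at h10
  exact h10

theorem sum_injTuples (ψ : AddChar (Fin k → ℤ) ℂ) (T : Finset (Fin X)) :
    ∑ w ∈ injTuples p k X ×ˢ Fintype.piFinset fun _ : Fin s => T,
      ψ (∑ i, powVec k ((w.1 i : ℕ) : ℤ) + ∑ i, powVec k ((w.2 i : ℕ) : ℤ)) =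
      (∑ u ∈ injTuples p k X, ψ (∑ i, powVec k ((u i : ℕ) : ℤ))) *
        (∑ x ∈ T, ψ (powVec k ((x : ℕ) : ℤ))) ^ s := by
  have h1 := AddChar.sum_piFinset_eq_prod ψ (fun _ : Fin s => T)
    (fun x : Fin X => powVec k ((x : ℕ) : ℤ))
  rw [Finset.prod_const, card_univ, Fintype.card_fin] at h1
  rw [← h1, Finset.sum_mul_sum, ← Finset.sum_product']
  simp only [AddChar.map_add_eq_mul]

theorem card_incongruent_univ_le [Fact p.Prime] (hs : s ≠ 0) (hk : k < p) (hX : X ≤ p ^ k) :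
    (#{w ∈ incongruentTuples p k s X univ ×ˢ incongruentTuples p k s X univ |
      ∑ i, powVec k ((w.1 i : ℕ) : ℤ) = ∑ i, powVec k ((w.2 i : ℕ) : ℤ)} : ℝ) ≤
      p ^ (2 * s) * (X ^ k * (k ^ k * p ^ (k * (k - 1) / 2)) *
        vinogradovCount k (Fin s) (X / p + 1)) := by
  obtain ⟨Ω, _, χ, hΩ⟩ := exists_detectingFamily
    (diffSet (Fin k ⊕ Fin s → Fin X) (fun x => ∑ i, powVec k ((x i : ℕ) : ℤ)) ∪
      diffSet ((Fin k → Fin X) × (Fin s → Fin X))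
        (fun w => ∑ i, powVec k ((w.1 i : ℕ) : ℤ) + ∑ i, powVec k ((w.2 i : ℕ) : ℤ)))
  have h3 : (0 : ℝ) < Fintype.card Ω := by exact_mod_cast hΩ.card_pos
  refine le_of_mul_le_mul_left ?_ h3
  have hT := fun T : Finset (Fin X) => hΩ.card_mul_card_diag
    (injTuples p k X ×ˢ Fintype.piFinset fun _ : Fin s => T)
    (fun w => ∑ i, powVec k ((w.1 i : ℕ) : ℤ) + ∑ i, powVec k ((w.2 i : ℕ) : ℤ))
    (fun a _ b _ => mem_union_right _ (mem_diffSet _ a b))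
  have hT' := hΩ.card_mul_card_diag (incongruentTuples p k s X univ)
    (fun x => ∑ i, powVec k ((x i : ℕ) : ℤ)) (fun a _ b _ => mem_union_left _ (mem_diffSet _ a b))
  simp only [sum_incongruentTuples, sum_injTuples, norm_mul, norm_pow, mul_pow] at hT hT'
  rw [hT']
  obtain ⟨n, hn⟩ : ∃ n, 2 * s = n + 1 := ⟨2 * s - 1, by omega⟩
  calc _ ≤ ∑ ω, ∑ c : ZMod p, (p : ℝ) ^ n *
        (‖∑ u ∈ injTuples p k X, χ ω (∑ i, powVec k ((u i : ℕ) : ℤ))‖ ^ 2 *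
        (‖∑ x ∈ residueSet p X c, χ ω (powVec k ((x : ℕ) : ℤ))‖ ^ s) ^ 2) := by
        refine Finset.sum_le_sum fun ω _ => ?_
        have h1 : ‖∑ x : Fin X, χ ω (powVec k ((x : ℕ) : ℤ))‖ ≤
            ∑ c : ZMod p, ‖∑ x ∈ residueSet p X c, χ ω (powVec k ((x : ℕ) : ℤ))‖ := by
          rw [← Finset.sum_fiberwise (s := (univ : Finset (Fin X)))
            (g := fun x => ((x : ℕ) : ZMod p))]
          exact norm_sum_le _ _
        have h2 := pow_sum_div_card_le_sum_pow (s := (univ : Finset (ZMod p))) (n := n)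
            (f := fun c => ‖∑ x ∈ residueSet p X c, χ ω (powVec k ((x : ℕ) : ℤ))‖)
            (fun c _ => by positivity)
        have hp : (0 : ℝ) < p := by exact_mod_cast Nat.pos_of_ne_zero (NeZero.ne p)
        rw [card_univ, ZMod.card, div_le_iff₀ (by positivity), mul_comm] at h2
        simp only [← pow_mul, mul_comm s 2, hn]
        rw [← Finset.mul_sum, ← Finset.mul_sum]
        rw [mul_left_comm]
        gcongr
        refine le_trans ?_ h2
        gcongr
    _ ≤ ∑ c : ZMod p, (p : ℝ) ^ n * (Fintype.card Ω * (X ^ k * (k ^ k * p ^ (k * (k - 1) / 2)) *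
        vinogradovCount k (Fin s) (X / p + 1))) := by
        rw [Finset.sum_comm]
        refine Finset.sum_le_sum fun c _ => ?_
        rw [← Finset.mul_sum, ← hT]
        gcongr
        exact_mod_cast card_incongruent_le (s := s) hk hX c
    _ = _ := by
        rw [Finset.sum_const, card_univ, ZMod.card, nsmul_eq_mul, hn]
        ring

end LinnikStep

section LinnikStep
open Finset ComplexConjugate

variable {k p X s : ℕ} {D : Finset (Fin k → ℤ)} {Ω : Type} [Fintype Ω]
  {χ : Ω → AddChar (Fin k → ℤ) ℂ}

/-- One step of Linnik's `p`-adic iteration. -/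
theorem vinogradovCount_step [Fact p.Prime] (hk1 : 2 ≤ k) (hs : s ≠ 0) (hk : k < p)
    (hX : X ≤ p ^ k) :
    (vinogradovCount k (Fin (s + k)) X : ℝ) ≤
      2 * (p ^ (2 * s) * (X ^ k * (k ^ k * p ^ (k * (k - 1) / 2)) *
        vinogradovCount k (Fin s) (X / p + 1))) +
      (4 * k ^ 2) ^ (s + k) * (p ^ (s + k) * ((X / p + 1 : ℕ) ^ (2 * k) *
        vinogradovCount k (Fin s) (X / p + 1))) := by
  have hcard : Fintype.card (Fin (s + k)) = Fintype.card (Fin k ⊕ Fin s) := by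
    simp [add_comm]
  obtain ⟨n, hn⟩ : ∃ n, s + k = n + 2 := ⟨s + k - 2, by omega⟩
  have hn' : Fintype.card (Fin k ⊕ Fin s) = n + 2 := by rw [← hcard, Fintype.card_fin, hn]
  obtain ⟨Ω, _, χ, hΩ⟩ := exists_detectingFamily
    (diffSet (Fin k ⊕ Fin s → Fin X) (fun x => ∑ i, powVec k ((x i : ℕ) : ℤ)))
  have hk0 : (0 : ℝ) < k := by exact_mod_cast (by omega : 0 < k)
  set C : Fin k → Fin k → Finset ((Fin k ⊕ Fin s → Fin X) × (Fin k ⊕ Fin s → Fin X)) := fun i j =>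
    {w ∈ ({x : Fin k ⊕ Fin s → Fin X |
      ((x (Sum.inl i) : ℕ) : ZMod p) = ((x (Sum.inl j) : ℕ) : ZMod p)} : Finset _) ×ˢ univ |
      ∑ i, powVec k ((w.1 i : ℕ) : ℤ) = ∑ i, powVec k ((w.2 i : ℕ) : ℤ)} with hC
  set J := vinogradovCount k (Fin k ⊕ Fin s) X with hJ
  set J' := vinogradovCount k (Fin k ⊕ Fin s) (X / p + 1) with hJ'
  have hCle : ∀ i j, i ≠ j → (#(C i j) : ℝ) ≤ J / (4 * k ^ 2) +
      (4 * k ^ 2) ^ (n + 1) * (p ^ (n + 2) * J') := fun i j hij =>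
    card_mul_card_collision_le hΩ Subset.rfl hn' (Sum.inl_injective.ne hij) (by positivity)
  set B : Finset ((Fin k ⊕ Fin s → Fin X) × (Fin k ⊕ Fin s → Fin X)) :=
    (univ.filter fun q : Fin k × Fin k => q.1 ≠ q.2).biUnion fun q => C q.1 q.2 with hB
  have hBle : (#B : ℝ) ≤ k ^ 2 * (J / (4 * k ^ 2) +
      (4 * k ^ 2) ^ (n + 1) * (p ^ (n + 2) * J')) := by
    calc (#B : ℝ) ≤ ∑ q : Fin k × Fin k with q.1 ≠ q.2, (#(C q.1 q.2) : ℝ) := by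
          exact_mod_cast Finset.card_biUnion_le
      _ ≤ ∑ q : Fin k × Fin k with q.1 ≠ q.2, (J / (4 * k ^ 2) +
            (4 * k ^ 2) ^ (n + 1) * (p ^ (n + 2) * J') : ℝ) :=
          Finset.sum_le_sum fun q hq => hCle _ _ (mem_filter.mp hq).2
      _ ≤ ∑ q : Fin k × Fin k, (J / (4 * k ^ 2) +
            (4 * k ^ 2) ^ (n + 1) * (p ^ (n + 2) * J') : ℝ) :=
          Finset.sum_le_sum_of_subset_of_nonneg (filter_subset _ _)
            fun _ _ _ => by positivity
      _ = _ := by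
          rw [Finset.sum_const, card_univ, nsmul_eq_mul]
          congr 1
          simp [pow_two]
  have hmain : (J : ℝ) ≤ #{w ∈ incongruentTuples p k s X univ ×ˢ incongruentTuples p k s X univ |
      ∑ i, powVec k ((w.1 i : ℕ) : ℤ) = ∑ i, powVec k ((w.2 i : ℕ) : ℤ)} + (#B + #B) := by
    have hsub : ({w : (Fin k ⊕ Fin s → Fin X) × (Fin k ⊕ Fin s → Fin X) |
        ∑ i, powVec k ((w.1 i : ℕ) : ℤ) = ∑ i, powVec k ((w.2 i : ℕ) : ℤ)} : Finset _) ⊆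
        {w ∈ incongruentTuples p k s X univ ×ˢ incongruentTuples p k s X univ |
          ∑ i, powVec k ((w.1 i : ℕ) : ℤ) = ∑ i, powVec k ((w.2 i : ℕ) : ℤ)} ∪
        (B ∪ B.image Prod.swap) := by
      have key : ∀ w : (Fin k ⊕ Fin s → Fin X) × (Fin k ⊕ Fin s → Fin X),
          ∑ i, powVec k ((w.1 i : ℕ) : ℤ) = ∑ i, powVec k ((w.2 i : ℕ) : ℤ) →
          w.1 ∉ incongruentTuples p k s X univ → w ∈ B := by
        intro w hw h1
        simp only [incongruentTuples, mem_filter, mem_univ, true_and, implies_true, and_true,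
          Function.Injective] at h1
        push Not at h1
        obtain ⟨i, j, hij, hne⟩ := h1
        exact mem_biUnion.mpr ⟨(i, j), mem_filter.mpr ⟨mem_univ _, hne⟩, mem_filter.mpr
          ⟨mem_product.mpr ⟨mem_filter.mpr ⟨mem_univ _, hij⟩, mem_univ _⟩, hw⟩⟩
      intro w hw
      have hw := (mem_filter.mp hw).2
      by_cases h1 : w.1 ∈ incongruentTuples p k s X univ
      · by_cases h2 : w.2 ∈ incongruentTuples p k s X univ
        · exact mem_union_left _ (mem_filter.mpr ⟨mem_product.mpr ⟨h1, h2⟩, hw⟩)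
        · refine mem_union_right _ (mem_union_right _ (mem_image.mpr
            ⟨w.swap, key w.swap hw.symm h2, Prod.swap_swap w⟩))
      · exact mem_union_right _ (mem_union_left _ (key w hw h1))
    have h1 := (Finset.card_le_card hsub).trans (Finset.card_union_le _ _)
    have h2 := Finset.card_union_le B (B.image Prod.swap)
    have h3 : #(B.image Prod.swap) ≤ #B := Finset.card_image_le
    rw [hJ, vinogradovCount]
    exact_mod_cast h1.trans (Nat.add_le_add_left (h2.trans (Nat.add_le_add_left h3 _)) _)
  have hdd := card_incongruent_univ_le (p := p) (k := k) (X := X) hs hk hX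
  have hJe : vinogradovCount k (Fin (s + k)) X = J := vinogradovCount_congr hcard
  have hJ'e : vinogradovCount k (Fin (s + k)) (X / p + 1) = J' := vinogradovCount_congr hcard
  have hJ'le := vinogradovCount_add_le k s k (X / p + 1)
  rw [hJ'e] at hJ'le
  rw [hJe]
  have e1 : (k : ℝ) ^ 2 * (J / (4 * k ^ 2) + (4 * k ^ 2) ^ (n + 1) * (p ^ (n + 2) * J')) =
      J / 4 + (4 * k ^ 2) ^ (n + 2) * (p ^ (n + 2) * J') / 4 := by
    have e0 : (k : ℝ) ^ 2 * (J / (4 * k ^ 2)) = J / 4 := by field_simp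
    rw [mul_add, e0]
    ring
  rw [e1] at hBle
  have e2 : ((4 : ℝ) * k ^ 2) ^ (s + k) * (p ^ (s + k) * J') ≤ (4 * k ^ 2) ^ (s + k) * (p ^ (s + k) *
      ((X / p + 1 : ℕ) ^ (2 * k) * vinogradovCount k (Fin s) (X / p + 1))) := by gcongr
  rw [hn] at e2 ⊢
  linarith

end LinnikStep

section LinnikIteration
open Finset

theorem exists_prime_root (k X : ℕ) (hX : 1 ≤ X) (hk : k ≠ 0) (hXk : k ^ k ≤ X) :
    ∃ p : ℕ, p.Prime ∧ k < p ∧ X ≤ p ^ k ∧ (p : ℝ) ≤ 4 * (X : ℝ) ^ (1 / (k : ℝ)) ∧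
      ((X / p + 1 : ℕ) : ℝ) ≤ 2 * ((X : ℝ) ^ (1 / (k : ℝ))) ^ (k - 1) := by
  set r := (X : ℝ) ^ (1 / (k : ℝ)) with hr
  have hX1 : (1 : ℝ) ≤ X := by exact_mod_cast hX
  have hr1 : 1 ≤ r := Real.one_le_rpow hX1 (by positivity)
  have hrk : r ^ k = X := by
    rw [hr, one_div, Real.rpow_inv_natCast_pow (by positivity) hk]
  have hkr : (k : ℝ) ≤ r := by
    refine le_of_pow_le_pow_left₀ hk (by positivity) ?_
    rw [hrk]
    exact_mod_cast hXk
  obtain ⟨p, hp, h1, h2⟩ := Nat.exists_prime_lt_and_le_two_mul ⌈r⌉₊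
    (Nat.ceil_pos.mpr (by linarith)).ne'
  have h3 : r < p := (Nat.le_ceil r).trans_lt (by exact_mod_cast h1)
  have h4 : (⌈r⌉₊ : ℝ) < r + 1 := Nat.ceil_lt_add_one (by positivity)
  have h5 : (p : ℝ) ≤ 2 * ⌈r⌉₊ := by exact_mod_cast h2
  refine ⟨p, hp, ?_, ?_, by linarith, ?_⟩
  · exact_mod_cast hkr.trans_lt h3
  · have : (X : ℝ) ≤ (p : ℝ) ^ k := by
      rw [← hrk]
      gcongr
    exact_mod_cast this
  · have h6 : ((X / p : ℕ) : ℝ) ≤ X / p := Nat.cast_div_le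
    have h7 : (X : ℝ) / p ≤ r ^ (k - 1) := by
      rw [div_le_iff₀ (by linarith), ← hrk]
      obtain ⟨n, rfl⟩ := Nat.exists_eq_succ_of_ne_zero hk
      simp only [Nat.succ_eq_add_one, Nat.add_sub_cancel, pow_succ]
      gcongr
    have h8 : 1 ≤ r ^ (k - 1) := one_le_pow₀ hr1
    push_cast
    linarith

theorem vinogradovCount_step_rpow {k s : ℕ} (hk : 4 ≤ k) (hs : k ^ 2 ≤ s) {C δ : ℝ} (hC : 1 ≤ C)
    (hδ : 0 ≤ δ) (hδK : δ ≤ k * (k + 1) / 2)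
    (h : ∀ X : ℕ, 1 ≤ X → (vinogradovCount k (Fin s) X : ℝ) ≤
      C * (X : ℝ) ^ (2 * s - k * (k + 1) / 2 + δ)) {X : ℕ} (hX : 1 ≤ X) (hXk : k ^ k ≤ X) :
    (vinogradovCount k (Fin (s + k)) X : ℝ) ≤
      C * (k : ℝ) ^ (11 * (s + k)) *
        (X : ℝ) ^ (2 * (s + k : ℕ) - k * (k + 1) / 2 + δ * (1 - 1 / k)) := by
  obtain ⟨p, hp, hkp, hXp, hpr, hX'⟩ := exists_prime_root k X hX (by omega) hXk
  have : Fact p.Prime := ⟨hp⟩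
  set r := (X : ℝ) ^ (1 / (k : ℝ)) with hr
  have hX1 : (1 : ℝ) ≤ X := by exact_mod_cast hX
  have hr1 : 1 ≤ r := Real.one_le_rpow hX1 (by positivity)
  have hr0 : 0 < r := by linarith
  have hrk : r ^ k = X := by
    rw [hr, one_div, Real.rpow_inv_natCast_pow (by positivity) (by omega)]
  have hk4 : (4 : ℝ) ≤ k := by exact_mod_cast hk
  have hk0 : (0 : ℝ) < k := by linarith
  have hs' : (k : ℝ) ^ 2 ≤ s := by exact_mod_cast hs
  have hstep := vinogradovCount_step (k := k) (p := p) (X := X) (s := s) (by omega)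
    (by nlinarith) hkp hXp
  set X' := X / p + 1 with hX'def
  set e : ℝ := 2 * s - k * (k + 1) / 2 + δ with he
  have he0 : 0 ≤ e := by rw [he]; nlinarith
  have hJ : (vinogradovCount k (Fin s) X' : ℝ) ≤ C * ((2 : ℝ) ^ (2 * s) * r ^ ((k - 1) * e)) := by
    refine (h X' (Nat.le_add_left _ _)).trans ?_
    gcongr
    calc (X' : ℝ) ^ e ≤ (2 * r ^ (k - 1)) ^ e := by gcongr
      _ = 2 ^ e * r ^ ((k - 1) * e) := by
        rw [Real.mul_rpow (by norm_num) (by positivity), ← Real.rpow_natCast r (k - 1),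
          ← Real.rpow_mul hr0.le, Nat.cast_sub (by omega)]
        norm_num
      _ ≤ _ := by
        gcongr
        rw [← Real.rpow_natCast]
        refine Real.rpow_le_rpow_of_exponent_le (by norm_num) ?_
        push_cast
        linarith
  have hK : ((k * (k - 1) / 2 : ℕ) : ℝ) = k * (k - 1) / 2 := by
    have h2 : 2 ∣ k * (k - 1) := (Nat.even_mul_pred_self k).two_dvd
    rw [Nat.cast_div h2 (by norm_num), Nat.cast_mul, Nat.cast_sub (by omega)]
    norm_num
  set K2 := k * (k - 1) / 2 with hK2
  have hE : (X : ℝ) ^ (2 * (s + k : ℕ) - k * (k + 1) / 2 + δ * (1 - 1 / k)) =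
      r ^ (k * (2 * (s + k : ℕ) - k * (k + 1) / 2) + δ * (k - 1)) := by
    rw [hr, ← Real.rpow_mul (by positivity)]
    congr 1
    field_simp
  rw [hE]
  set E : ℝ := k * (2 * (s + k : ℕ) - k * (k + 1) / 2) + δ * (k - 1) with hEdef
  have hK2le : K2 ≤ k ^ 2 := by
    rw [hK2]
    refine (Nat.div_le_self _ _).trans ?_
    rw [pow_two]
    exact Nat.mul_le_mul_left _ (by omega)
  have b1 : (2 : ℝ) * (p ^ (2 * s) * (X ^ k * (k ^ k * p ^ K2) * vinogradovCount k (Fin s) X')) ≤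
      C * (k : ℝ) ^ (11 * (s + k) - 1) * r ^ E := by
    calc (2 : ℝ) * (p ^ (2 * s) * (X ^ k * (k ^ k * p ^ K2) * vinogradovCount k (Fin s) X'))
        ≤ 2 * ((4 * r) ^ (2 * s) * ((r ^ k) ^ k * (k ^ k * (4 * r) ^ K2) *
          (C * ((2 : ℝ) ^ (2 * s) * r ^ ((k - 1) * e))))) := by
          rw [hrk]
          gcongr
      _ = C * (2 * 4 ^ (2 * s) * k ^ k * 4 ^ K2 * 2 ^ (2 * s)) *
          (r ^ (2 * s) * r ^ (k * k) * r ^ K2 * r ^ ((k - 1) * e)) := by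
          rw [mul_pow, mul_pow, ← pow_mul]
          ring
      _ = C * (2 * 4 ^ (2 * s) * k ^ k * 4 ^ K2 * 2 ^ (2 * s)) * r ^ E := by
          congr 1
          rw [← Real.rpow_natCast, ← Real.rpow_natCast, ← Real.rpow_natCast, ← Real.rpow_add hr0,
            ← Real.rpow_add hr0, ← Real.rpow_add hr0]
          congr 1
          push_cast
          rw [hK, he, hEdef]
          push_cast
          ring
      _ ≤ C * (k : ℝ) ^ (11 * (s + k) - 1) * r ^ E := by
          gcongr
          calc (2 : ℝ) * 4 ^ (2 * s) * k ^ k * 4 ^ K2 * 2 ^ (2 * s) ≤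
              k ^ 1 * k ^ (2 * s) * k ^ k * k ^ K2 * k ^ (2 * s) := by
                gcongr
                · rw [pow_one]; linarith
                · linarith
            _ = k ^ (1 + 2 * s + k + K2 + 2 * s) := by ring
            _ ≤ _ := pow_le_pow_right₀ (by linarith) (by omega)
  have b2 : ((4 : ℝ) * k ^ 2) ^ (s + k) * (p ^ (s + k) * ((X' : ℕ) ^ (2 * k) *
        vinogradovCount k (Fin s) X')) ≤ C * (k : ℝ) ^ (11 * (s + k) - 1) * r ^ E := by
    calc ((4 : ℝ) * k ^ 2) ^ (s + k) * (p ^ (s + k) * ((X' : ℕ) ^ (2 * k) *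
          vinogradovCount k (Fin s) X')) ≤
          ((4 : ℝ) * k ^ 2) ^ (s + k) * ((4 * r) ^ (s + k) * ((2 * r ^ (k - 1)) ^ (2 * k) *
          (C * ((2 : ℝ) ^ (2 * s) * r ^ ((k - 1) * e))))) := by gcongr
      _ = C * ((4 * k ^ 2) ^ (s + k) * 4 ^ (s + k) * 2 ^ (2 * k) * 2 ^ (2 * s)) *
          (r ^ (s + k) * r ^ ((k - 1) * (2 * k)) * r ^ ((k - 1) * e)) := by
          rw [mul_pow _ r, mul_pow 2, ← pow_mul]
          ring
      _ ≤ C * ((4 * k ^ 2) ^ (s + k) * 4 ^ (s + k) * 2 ^ (2 * k) * 2 ^ (2 * s)) * r ^ E := by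
          gcongr
          rw [← Real.rpow_natCast, ← Real.rpow_natCast, ← Real.rpow_add hr0, ← Real.rpow_add hr0]
          refine Real.rpow_le_rpow_of_exponent_le hr1 ?_
          rw [Nat.cast_mul, Nat.cast_sub (by omega), he, hEdef]
          push_cast
          nlinarith
      _ ≤ C * (k : ℝ) ^ (11 * (s + k) - 1) * r ^ E := by
          gcongr
          calc ((4 : ℝ) * k ^ 2) ^ (s + k) * 4 ^ (s + k) * 2 ^ (2 * k) * 2 ^ (2 * s) ≤
              ((k : ℝ) * k ^ 2) ^ (s + k) * k ^ (s + k) * k ^ (2 * k) * k ^ (2 * s) := by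
                gcongr
                · linarith
                · linarith
            _ = (k : ℝ) ^ (3 * (s + k) + (s + k) + 2 * k + 2 * s) := by ring
            _ ≤ _ := pow_le_pow_right₀ (by linarith) (by omega)
  refine hstep.trans ?_
  calc _ ≤ C * (k : ℝ) ^ (11 * (s + k) - 1) * r ^ E + C * (k : ℝ) ^ (11 * (s + k) - 1) * r ^ E := by
        linarith
    _ = C * ((k : ℝ) ^ (11 * (s + k) - 1) * 2) * r ^ E := by ring
    _ ≤ C * ((k : ℝ) ^ (11 * (s + k) - 1) * k) * r ^ E := by
        gcongr
        linarith
    _ = _ := by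
        rw [← pow_succ]
        congr 4
        omega

theorem vinogradovCount_le_iterate {k : ℕ} (hk : 4 ≤ k) (l : ℕ) (X : ℕ) (hX : 1 ≤ X) :
    (vinogradovCount k (Fin (k ^ 2 + k * l)) X : ℝ) ≤
      (k : ℝ) ^ (11 * (k ^ 2 + k * l) * l + k ^ 3) *
        (X : ℝ) ^ (2 * (k ^ 2 + k * l : ℕ) - k * (k + 1) / 2 +
          (k * (k + 1) / 2) * (1 - 1 / (k : ℝ)) ^ l : ℝ) := by
  have hk4 : (4 : ℝ) ≤ k := by exact_mod_cast hk
  have hk0 : (0 : ℝ) < k := by linarith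
  have hq0 : 0 ≤ 1 - 1 / (k : ℝ) := by
    rw [sub_nonneg, div_le_one hk0]; linarith
  have hq1 : 1 - 1 / (k : ℝ) ≤ 1 := by
    have : 0 ≤ 1 / (k : ℝ) := by positivity
    linarith
  have hδ0 : ∀ l : ℕ, 0 ≤ (k * (k + 1) / 2 : ℝ) * (1 - 1 / (k : ℝ)) ^ l := fun l => by positivity
  have hδ1 : ∀ l : ℕ, (k * (k + 1) / 2 : ℝ) * (1 - 1 / (k : ℝ)) ^ l ≤ k * (k + 1) / 2 :=
    fun l => mul_le_of_le_one_right (by positivity) (pow_le_one₀ hq0 hq1)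
  induction l generalizing X with
  | zero =>
    refine (vinogradovCount_le_trivial _ _ _).trans ?_
    rw [pow_zero, mul_one, sub_add_cancel]
    rw [← Real.rpow_natCast (X : ℝ)]
    push_cast
    exact le_mul_of_one_le_left (by positivity) (one_le_pow₀ (by linarith))
  | succ l ih =>
    have hsl : k ^ 2 + k * (l + 1) = k ^ 2 + k * l + k := by ring
    rw [hsl]
    have hX1 : (1 : ℝ) ≤ X := by exact_mod_cast hX
    by_cases hXk : k ^ k ≤ X
    · refine (vinogradovCount_step_rpow hk (by omega) (one_le_pow₀ (by linarith)) (hδ0 l) (hδ1 l) ih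
        hX hXk).trans ?_
      rw [← pow_add, pow_succ (1 - 1 / (k : ℝ)), mul_assoc (k * (k + 1) / 2 : ℝ)]
      refine mul_le_mul_of_nonneg_right ?_ (by positivity)
      refine pow_le_pow_right₀ (by linarith) ?_
      have : 11 * (k ^ 2 + k * l) * l ≤ 11 * (k ^ 2 + k * l + k) * l := by
        refine Nat.mul_le_mul_right _ ?_
        omega
      have e : 11 * (k ^ 2 + k * l + k) * (l + 1) = 11 * (k ^ 2 + k * l + k) * l +
        11 * (k ^ 2 + k * l + k) := by ring
      omega
    · push Not at hXk
      refine (vinogradovCount_le_trivial _ _ _).trans ?_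
      have hXk' : (X : ℝ) ≤ (k : ℝ) ^ k := by exact_mod_cast hXk.le
      have e1 : (X : ℝ) ^ (2 * (k ^ 2 + k * l + k)) = (X : ℝ) ^ (k * (k + 1) / 2 : ℝ) *
          (X : ℝ) ^ (2 * (k ^ 2 + k * l + k : ℕ) - k * (k + 1) / 2 : ℝ) := by
        rw [← Real.rpow_add (by linarith), ← Real.rpow_natCast]
        congr 1
        push_cast
        ring
      rw [e1]
      have e2 : (X : ℝ) ^ (k * (k + 1) / 2 : ℝ) ≤ (k : ℝ) ^ (k ^ 3) := by
        calc (X : ℝ) ^ (k * (k + 1) / 2 : ℝ) ≤ ((k : ℝ) ^ k) ^ (k * (k + 1) / 2 : ℝ) := by gcongr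
          _ = (k : ℝ) ^ (k * (k * (k + 1) / 2) : ℝ) := by
            rw [← Real.rpow_natCast, ← Real.rpow_mul (by positivity)]
          _ ≤ (k : ℝ) ^ ((k ^ 3 : ℕ) : ℝ) := by
            refine Real.rpow_le_rpow_of_exponent_le (by linarith) ?_
            push_cast
            have := mul_nonneg (mul_nonneg hk0.le hk0.le) (by linarith : (0 : ℝ) ≤ k - 1)
            nlinarith
          _ = _ := Real.rpow_natCast _ _
      have e3 : (k : ℝ) ^ (k ^ 3) ≤ (k : ℝ) ^ (11 * (k ^ 2 + k * l + k) * (l + 1) + k ^ 3) :=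
        pow_le_pow_right₀ (by linarith) (by omega)
      have e4 := hδ0 (l + 1)
      have e5 : (X : ℝ) ^ (2 * (k ^ 2 + k * l + k : ℕ) - k * (k + 1) / 2 : ℝ) ≤
          (X : ℝ) ^ (2 * (k ^ 2 + k * l + k : ℕ) - k * (k + 1) / 2 +
          (k * (k + 1) / 2) * (1 - 1 / (k : ℝ)) ^ (l + 1) : ℝ) :=
        Real.rpow_le_rpow_of_exponent_le hX1 (by linarith)
      exact mul_le_mul (e2.trans e3) e5 (by positivity) (by positivity)

/-- **A weak form of Vinogradov's mean value theorem.** -/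
theorem vinogradov_mean_value {k s : ℕ} (hk : 4 ≤ k) (hs : s = k ^ 2 + 2 * k ^ 3) (X : ℕ)
    (hX : 1 ≤ X) :
    (vinogradovCount k (Fin s) X : ℝ) ≤
      (k : ℝ) ^ (23 * k ^ 2 * s) * (X : ℝ) ^ (2 * s - k * (k + 1) / 2 + 1 / 10 : ℝ) := by
  have hk4 : (4 : ℝ) ≤ k := by exact_mod_cast hk
  have hk0 : (0 : ℝ) < k := by linarith
  have hX1 : (1 : ℝ) ≤ X := by exact_mod_cast hX
  have hs' : s = k ^ 2 + k * (2 * k ^ 2) := by rw [hs]; ring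
  have h := vinogradovCount_le_iterate hk (2 * k ^ 2) X hX
  rw [← hs'] at h
  refine h.trans ?_
  have hδ : (k * (k + 1) / 2 : ℝ) * (1 - 1 / (k : ℝ)) ^ (2 * k ^ 2) ≤ 1 / 10 := by
    have h1 : (1 - 1 / (k : ℝ)) ≤ Real.exp (-(1 / k)) := by
      have := Real.add_one_le_exp (-(1 / (k : ℝ)))
      linarith
    have hq0 : 0 ≤ 1 - 1 / (k : ℝ) := by
      rw [sub_nonneg, div_le_one hk0]; linarith
    have h2 : (1 - 1 / (k : ℝ)) ^ (2 * k ^ 2) ≤ Real.exp (-(2 * k)) := by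
      refine (pow_le_pow_left₀ hq0 h1 _).trans (le_of_eq ?_)
      rw [← Real.exp_nat_mul]
      congr 1
      push_cast
      field_simp
    have h3 : (2 * k : ℝ) ^ 4 / 24 ≤ Real.exp (2 * k) := by
      have := Real.pow_div_factorial_le_exp (2 * k : ℝ) (by positivity) 4
      norm_num [Nat.factorial] at this ⊢
      exact this
    have h4 : (k * (k + 1) / 2 : ℝ) ≤ 1 / 10 * ((2 * k : ℝ) ^ 4 / 24) := by
      nlinarith [mul_nonneg hk0.le (sub_nonneg.mpr hk4), pow_pos hk0 3,
        mul_le_mul_of_nonneg_left hk4 (pow_pos hk0 3).le]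
    calc (k * (k + 1) / 2 : ℝ) * (1 - 1 / (k : ℝ)) ^ (2 * k ^ 2)
        ≤ (1 / 10 * Real.exp (2 * k)) * Real.exp (-(2 * k)) := by
          refine mul_le_mul (h4.trans ?_) h2 (by positivity) (by positivity)
          gcongr
      _ = 1 / 10 := by rw [mul_assoc, ← Real.exp_add]; simp
  gcongr
  · linarith
  · have : k ^ 3 ≤ k ^ 2 * s := by
      rw [hs]
      nlinarith [pow_pos (show 0 < k by omega) 3, pow_pos (show 0 < k by omega) 2]
    nlinarith

end LinnikIteration

section DoubleSum
open Finset ComplexConjugate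

/-- The unitary character `v ↦ exp (i ∑ c_j v_j)` of `ℤ ^ k`. -/
noncomputable def expChar {k : ℕ} (c : Fin k → ℝ) : AddChar (Fin k → ℤ) ℂ where
  toFun v := Complex.exp ((∑ j, c j * v j : ℝ) * Complex.I)
  map_zero_eq_one' := by simp
  map_add_eq_mul' v w := by
    rw [← Complex.exp_add, ← add_mul, ← Complex.ofReal_add, ← Finset.sum_add_distrib]
    simp [mul_add]

theorem expChar_apply {k : ℕ} (c : Fin k → ℝ) (v : Fin k → ℤ) :
    expChar c v = Complex.exp ((∑ j, c j * v j : ℝ) * Complex.I) := rfl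

theorem norm_expChar {k : ℕ} (c : Fin k → ℝ) (v : Fin k → ℤ) : ‖expChar c v‖ = 1 := by
  rw [expChar_apply, Complex.norm_exp_ofReal_mul_I]

/-- The difference of power sums attached to a pair of tuples. -/
noncomputable def powerSumDiff (k s Y : ℕ) (q : (Fin s → Fin Y) × (Fin s → Fin Y)) : Fin k → ℤ :=
  ∑ i, powVec k ((q.1 i : ℕ) : ℤ) - ∑ i, powVec k ((q.2 i : ℕ) : ℤ)

theorem norm_sum_pow_eq_sum_powerSumDiff {k s Y : ℕ} (ψ : AddChar (Fin k → ℤ) ℂ)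
    (hψ : ∀ v, ‖ψ v‖ = 1) :
    ((‖∑ y : Fin Y, ψ (powVec k ((y : ℕ) : ℤ))‖ ^ (2 * s) : ℝ) : ℂ) =
      ∑ q, ψ (powerSumDiff k s Y q) := by
  have h1 := AddChar.sum_pi_eq_pow (ι := Fin s) ψ (fun y : Fin Y => powVec k ((y : ℕ) : ℤ))
  rw [Fintype.card_fin] at h1
  rw [mul_comm, pow_mul, ← norm_pow, ← h1]
  push_cast
  rw [← Complex.mul_conj', map_sum, Finset.sum_mul_sum, Fintype.sum_prod_type]
  refine Finset.sum_congr rfl fun x _ => Finset.sum_congr rfl fun y _ => ?_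
  rw [powerSumDiff, sub_eq_add_neg, AddChar.map_add_eq_mul, AddChar.map_neg_eq_inv,
    Complex.inv_eq_conj (hψ _)]

/-- The box in which `powerSumDiff` takes its values. -/
noncomputable def powerSumBox (k s Y : ℕ) : Finset (Fin k → ℤ) :=
  Fintype.piFinset fun j => Icc (-((s * Y ^ ((j : ℕ) + 1) : ℕ) : ℤ)) ((s * Y ^ ((j : ℕ) + 1) : ℕ) : ℤ)

theorem powerSumDiff_mem {k s Y : ℕ} (q : (Fin s → Fin Y) × (Fin s → Fin Y)) :
    powerSumDiff k s Y q ∈ powerSumBox k s Y := by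
  rw [powerSumBox, Fintype.mem_piFinset]
  intro j
  have h : ∀ y : Fin s → Fin Y, 0 ≤ ∑ i, ((y i : ℕ) : ℤ) ^ ((j : ℕ) + 1) ∧
      ∑ i, ((y i : ℕ) : ℤ) ^ ((j : ℕ) + 1) ≤ ((s * Y ^ ((j : ℕ) + 1) : ℕ) : ℤ) := by
    intro y
    refine ⟨Finset.sum_nonneg fun i _ => by positivity, ?_⟩
    refine (Finset.sum_le_card_nsmul univ _ ((Y : ℤ) ^ ((j : ℕ) + 1)) fun i _ => ?_).trans ?_
    · have : ((y i : ℕ) : ℤ) ≤ Y := by exact_mod_cast (y i).2.le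
      gcongr
    · simp
  have h1 := h q.1
  have h2 := h q.2
  rw [mem_Icc, powerSumDiff, Pi.sub_apply, Finset.sum_apply, Finset.sum_apply]
  simp only [powVec]
  omega

theorem sum_powerSumDiff_le {k s Y : ℕ} (g : (Fin k → ℤ) → ℝ) (hg : ∀ v, 0 ≤ g v) :
    ∑ q, g (powerSumDiff k s Y q) ≤
      vinogradovCount k (Fin s) Y * ∑ v ∈ powerSumBox k s Y, g v := by
  rw [← Finset.sum_fiberwise_of_maps_to (s := univ) (t := powerSumBox k s Y)
    (g := powerSumDiff k s Y) (fun q _ => powerSumDiff_mem q), Finset.mul_sum]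
  refine Finset.sum_le_sum fun v _ => ?_
  rw [Finset.sum_congr rfl fun q hq => by rw [(mem_filter.mp hq).2], Finset.sum_const, nsmul_eq_mul]
  refine mul_le_mul_of_nonneg_right ?_ (hg v)
  have h := card_shift_le (univ : Finset (Fin s → Fin Y))
    (fun x => ∑ i, powVec k ((x i : ℕ) : ℤ)) v
  rw [univ_product_univ] at h
  rw [vinogradovCount]
  refine Nat.cast_le.mpr (le_trans (Finset.card_le_card fun q hq => ?_) h)
  rw [mem_filter] at hq ⊢
  refine ⟨mem_univ _, ?_⟩
  rw [← hq.2, powerSumDiff, add_sub_cancel]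

theorem pow_sum_le_card_pow_mul {ι : Type} [Fintype ι] (f : ι → ℝ) (hf : ∀ i, 0 ≤ f i) (n : ℕ) :
    (∑ i, f i) ^ (n + 1) ≤ (Fintype.card ι : ℝ) ^ n * ∑ i, f i ^ (n + 1) := by
  rcases isEmpty_or_nonempty ι with h | h
  · simp
  have h1 := pow_sum_div_card_le_sum_pow (s := (univ : Finset ι)) (fun i _ => hf i) n
  have h2 : (0 : ℝ) < Fintype.card ι := by exact_mod_cast Fintype.card_pos
  rwa [card_univ, div_le_iff₀ (by positivity), mul_comm] at h1

/-- The bilinear form sums `∑_μ |∑_λ exp (i θ λ μ)|` over `|λ|, |μ| ≤ H`. -/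
noncomputable def bilinearSum (θ : ℝ) (H : ℕ) : ℝ :=
  ∑ m ∈ Icc (-(H : ℤ)) H, ‖∑ l ∈ Icc (-(H : ℤ)) H, Complex.exp ((θ * l * m : ℝ) * Complex.I)‖

theorem double_sum_le {k s Y : ℕ} (hs : s ≠ 0) (θ : Fin k → ℝ) :
    ‖∑ x : Fin Y, ∑ y : Fin Y, Complex.exp
      ((∑ j, θ j * (((x : ℕ) : ℝ) ^ ((j : ℕ) + 1) * ((y : ℕ) : ℝ) ^ ((j : ℕ) + 1)) : ℝ) *
        Complex.I)‖ ^ (2 * s * (2 * s)) ≤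
    (Y : ℝ) ^ (2 * (2 * s * (2 * s - 1))) * (vinogradovCount k (Fin s) Y : ℝ) ^ 2 *
      ∏ j, bilinearSum (θ j) (s * Y ^ ((j : ℕ) + 1)) := by
  obtain ⟨n, hn⟩ : ∃ n, 2 * s = n + 1 := ⟨2 * s - 1, by omega⟩
  set J : ℝ := ((vinogradovCount k (Fin s) Y : ℕ) : ℝ) with hJ
  let c : Fin Y → Fin k → ℝ := fun x j => θ j * ((x : ℕ) : ℝ) ^ ((j : ℕ) + 1)
  let d : (Fin k → ℤ) → Fin k → ℝ := fun v j => θ j * v j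
  have e1 : ∀ x y : Fin Y, Complex.exp
      ((∑ j, θ j * (((x : ℕ) : ℝ) ^ ((j : ℕ) + 1) * ((y : ℕ) : ℝ) ^ ((j : ℕ) + 1)) : ℝ) *
        Complex.I) = expChar (c x) (powVec k ((y : ℕ) : ℤ)) := by
    intro x y
    rw [expChar_apply]
    simp [c, powVec, mul_assoc]
  have e2 : ∀ (x : Fin Y) (v : Fin k → ℤ), expChar (c x) v =
      expChar (d v) (powVec k ((x : ℕ) : ℤ)) := by
    intro x v
    rw [expChar_apply, expChar_apply]
    simp [c, d, powVec, mul_assoc, mul_comm, mul_left_comm]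
  simp only [e1]
  have hcardP : Fintype.card ((Fin s → Fin Y) × (Fin s → Fin Y)) = Y ^ (2 * s) := by
    simp [two_mul, pow_add]
  have step1 : ‖∑ x : Fin Y, ∑ y : Fin Y, expChar (c x) (powVec k ((y : ℕ) : ℤ))‖ ^ (2 * s) ≤
      (Y : ℝ) ^ n * ∑ q, ‖∑ x : Fin Y, expChar (d (powerSumDiff k s Y q))
        (powVec k ((x : ℕ) : ℤ))‖ := by
    calc _ ≤ (∑ x : Fin Y, ‖∑ y : Fin Y, expChar (c x) (powVec k ((y : ℕ) : ℤ))‖) ^ (2 * s) := by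
          gcongr
          exact norm_sum_le _ _
      _ ≤ (Y : ℝ) ^ n * ∑ x : Fin Y,
          ‖∑ y : Fin Y, expChar (c x) (powVec k ((y : ℕ) : ℤ))‖ ^ (2 * s) := by
          have := pow_sum_le_card_pow_mul
            (fun x : Fin Y => ‖∑ y : Fin Y, expChar (c x) (powVec k ((y : ℕ) : ℤ))‖)
            (fun _ => norm_nonneg _) n
          rwa [Fintype.card_fin, ← hn] at this
      _ ≤ _ := by
          gcongr
          have h : ((∑ x : Fin Y,
              ‖∑ y : Fin Y, expChar (c x) (powVec k ((y : ℕ) : ℤ))‖ ^ (2 * s) : ℝ) : ℂ) =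
              ∑ q, ∑ x : Fin Y, expChar (d (powerSumDiff k s Y q)) (powVec k ((x : ℕ) : ℤ)) := by
            rw [Complex.ofReal_sum, Finset.sum_comm]
            refine Finset.sum_congr rfl fun x _ => ?_
            rw [norm_sum_pow_eq_sum_powerSumDiff _ (norm_expChar _)]
            simp only [e2]
          have h2 := congrArg norm h
          rw [Complex.norm_of_nonneg (by positivity)] at h2
          rw [h2]
          exact norm_sum_le _ _
  have step2 : (∑ q, ‖∑ x : Fin Y, expChar (d (powerSumDiff k s Y q))
        (powVec k ((x : ℕ) : ℤ))‖) ^ (2 * s) ≤ ((Y : ℝ) ^ (2 * s)) ^ n * (J *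
        ∑ v ∈ powerSumBox k s Y, ‖∑ x : Fin Y, expChar (d v) (powVec k ((x : ℕ) : ℤ))‖ ^ (2 * s)) := by
    have := pow_sum_le_card_pow_mul (fun q : (Fin s → Fin Y) × (Fin s → Fin Y) =>
      ‖∑ x : Fin Y, expChar (d (powerSumDiff k s Y q)) (powVec k ((x : ℕ) : ℤ))‖)
      (fun _ => norm_nonneg _) n
    rw [hcardP, ← hn, Nat.cast_pow] at this
    refine this.trans ?_
    gcongr
    exact sum_powerSumDiff_le
      (fun v => ‖∑ x : Fin Y, expChar (d v) (powVec k ((x : ℕ) : ℤ))‖ ^ (2 * s))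
      (fun _ => by positivity)
  have step3 : ∑ v ∈ powerSumBox k s Y,
      ‖∑ x : Fin Y, expChar (d v) (powVec k ((x : ℕ) : ℤ))‖ ^ (2 * s) ≤
      J * ∏ j, bilinearSum (θ j) (s * Y ^ ((j : ℕ) + 1)) := by
    have e3 : ∀ u v : Fin k → ℤ, expChar (d v) u =
        ∏ j, Complex.exp ((θ j * v j * u j : ℝ) * Complex.I) := by
      intro u v
      rw [expChar_apply, ← Complex.exp_sum, Complex.ofReal_sum, Finset.sum_mul]
    have h : ((∑ v ∈ powerSumBox k s Y,
        ‖∑ x : Fin Y, expChar (d v) (powVec k ((x : ℕ) : ℤ))‖ ^ (2 * s) : ℝ) : ℂ) =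
        ∑ q, ∏ j : Fin k, ∑ l ∈ Icc (-((s * Y ^ ((j : ℕ) + 1) : ℕ) : ℤ))
          ((s * Y ^ ((j : ℕ) + 1) : ℕ) : ℤ),
          Complex.exp ((θ j * l * (powerSumDiff k s Y q j) : ℝ) * Complex.I) := by
      rw [Complex.ofReal_sum, Finset.sum_congr rfl fun v _ =>
        norm_sum_pow_eq_sum_powerSumDiff _ (norm_expChar _), Finset.sum_comm]
      refine Finset.sum_congr rfl fun q _ => ?_
      rw [Finset.prod_univ_sum, powerSumBox]
      simp only [e3]
    have h2 := congrArg norm h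
    rw [Complex.norm_of_nonneg (by positivity)] at h2
    rw [h2]
    refine (norm_sum_le _ _).trans ?_
    simp only [norm_prod]
    refine (sum_powerSumDiff_le (fun u => ∏ j : Fin k,
      ‖∑ l ∈ Icc (-((s * Y ^ ((j : ℕ) + 1) : ℕ) : ℤ)) ((s * Y ^ ((j : ℕ) + 1) : ℕ) : ℤ),
          Complex.exp ((θ j * l * (u j) : ℝ) * Complex.I)‖)
      (fun _ => by positivity)).trans (le_of_eq ?_)
    congr 1
    simp only [bilinearSum]
    rw [Finset.prod_univ_sum, powerSumBox]
  rw [pow_mul]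
  calc _ ≤ ((Y : ℝ) ^ n * ∑ q, ‖∑ x : Fin Y, expChar (d (powerSumDiff k s Y q))
        (powVec k ((x : ℕ) : ℤ))‖) ^ (2 * s) := by gcongr
    _ ≤ ((Y : ℝ) ^ n) ^ (2 * s) * (((Y : ℝ) ^ (2 * s)) ^ n * (J *
        (J * ∏ j, bilinearSum (θ j) (s * Y ^ ((j : ℕ) + 1))))) := by
        rw [mul_pow]
        gcongr
        refine step2.trans ?_
        gcongr
    _ = _ := by
        rw [← pow_mul, ← pow_mul, show 2 * s - 1 = n by omega, mul_comm n]
        ring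

end DoubleSum

section BilinearSum
open Finset

theorem sum_Icc_neg_le (f : ℤ → ℝ) (g : ℕ → ℝ) (H : ℕ)
    (h : ∀ m : ℕ, m < H → f (m + 1) + f (-(m + 1)) ≤ g m) :
    ∑ m ∈ Icc (-(H : ℤ)) H, f m ≤ f 0 + ∑ m ∈ range H, g m := by
  induction H with
  | zero => simp
  | succ H ih =>
    have h1 : Icc (-((H + 1 : ℕ) : ℤ)) ((H + 1 : ℕ) : ℤ) =
        insert ((H : ℤ) + 1) (insert (-((H : ℤ) + 1)) (Icc (-(H : ℤ)) H)) := by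
      ext x
      simp only [mem_Icc, mem_insert]
      push_cast
      omega
    rw [h1, Finset.sum_insert (by simp; omega), Finset.sum_insert (by simp),
      Finset.sum_range_succ]
    have := ih fun m hm => h m (by omega)
    have := h H (by omega)
    linarith

theorem norm_sum_Icc_exp_le (α : ℝ) (hα : α ≠ 0) (hα' : |α| ≤ Real.pi) (H : ℕ) :
    ‖∑ l ∈ Icc (-(H : ℤ)) H, Complex.exp ((α * l : ℝ) * Complex.I)‖ ≤ Real.pi / |α| := by
  have hgeo : (Complex.exp (Complex.I * α) - 1) *
      ∑ l ∈ Icc (-(H : ℤ)) H, Complex.exp ((α * l : ℝ) * Complex.I) =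
      Complex.exp ((α * (H + 1) : ℝ) * Complex.I) - Complex.exp ((α * (-H) : ℝ) * Complex.I) := by
    induction H with
    | zero => simp [mul_comm]
    | succ H ih =>
      have h1 : Icc (-((H + 1 : ℕ) : ℤ)) ((H + 1 : ℕ) : ℤ) =
          insert ((H : ℤ) + 1) (insert (-((H : ℤ) + 1)) (Icc (-(H : ℤ)) H)) := by
        ext x
        simp only [mem_Icc, mem_insert]
        push_cast
        omega
      rw [h1, Finset.sum_insert (by simp; omega), Finset.sum_insert (by simp), mul_add, mul_add, ih,
        sub_mul, sub_mul, ← Complex.exp_add, ← Complex.exp_add]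
      push_cast
      ring_nf
  have h1 : 2 * |α| / Real.pi ≤ ‖Complex.exp (Complex.I * α) - 1‖ := by
    rw [Complex.norm_exp_I_mul_ofReal_sub_one]
    have h2 : |α / 2| ≤ Real.pi / 2 := by
      rw [abs_div, abs_two]
      linarith
    have := Real.mul_abs_le_abs_sin h2
    rw [Real.norm_eq_abs, abs_mul, abs_two]
    rw [abs_div, abs_two] at this
    calc _ = 2 * (2 / Real.pi * (|α| / 2)) := by ring
      _ ≤ _ := by linarith
  have hpos : 0 < |α| := abs_pos.mpr hα
  have hpi := Real.pi_pos
  have h3 := congrArg norm hgeo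
  rw [norm_mul] at h3
  have h4 : ‖Complex.exp ((α * (H + 1) : ℝ) * Complex.I) -
      Complex.exp ((α * (-H) : ℝ) * Complex.I)‖ ≤ 2 := by
    refine (norm_sub_le _ _).trans ?_
    rw [Complex.norm_exp_ofReal_mul_I, Complex.norm_exp_ofReal_mul_I]
    norm_num
  have h5 : 2 * |α| / Real.pi * ‖∑ l ∈ Icc (-(H : ℤ)) H, Complex.exp ((α * l : ℝ) * Complex.I)‖ ≤
      2 := by
    refine le_trans ?_ (h3.le.trans h4)
    gcongr
  rw [le_div_iff₀ hpos]
  rw [div_mul_eq_mul_div, div_le_iff₀ hpi] at h5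
  linarith

theorem bilinearSum_nonneg (θ : ℝ) (H : ℕ) : 0 ≤ bilinearSum θ H := by
  unfold bilinearSum
  positivity

theorem norm_sum_Icc_exp_le_trivial (α : ℝ) (H : ℕ) :
    ‖∑ l ∈ Icc (-(H : ℤ)) H, Complex.exp ((α * l : ℝ) * Complex.I)‖ ≤ 2 * H + 1 := by
  refine (norm_sum_le _ _).trans ?_
  simp only [Complex.norm_exp_ofReal_mul_I]
  rw [Finset.sum_const, Int.card_Icc, nsmul_eq_mul, mul_one]
  have : ((H : ℤ) + 1 - -(H : ℤ)).toNat = 2 * H + 1 := by omega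
  rw [this]
  push_cast
  rfl

theorem bilinearSum_eq (θ : ℝ) (H : ℕ) : bilinearSum θ H = ∑ m ∈ Icc (-(H : ℤ)) H,
    ‖∑ l ∈ Icc (-(H : ℤ)) H, Complex.exp ((θ * m * l : ℝ) * Complex.I)‖ := by
  simp only [bilinearSum, mul_right_comm]

theorem bilinearSum_le_trivial (θ : ℝ) {H : ℕ} (hH : 1 ≤ H) :
    bilinearSum θ H ≤ 9 * (H : ℝ) ^ 2 := by
  rw [bilinearSum_eq]
  have hH' : (1 : ℝ) ≤ H := by exact_mod_cast hH
  refine (Finset.sum_le_card_nsmul _ _ _ fun m _ => norm_sum_Icc_exp_le_trivial _ _).trans ?_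
  rw [Int.card_Icc, nsmul_eq_mul]
  have : ((H : ℤ) + 1 - -(H : ℤ)).toNat = 2 * H + 1 := by omega
  rw [this]
  push_cast
  nlinarith

theorem bilinearSum_le {θ : ℝ} {H : ℕ} (hH : 1 ≤ H) (hθ : θ ≠ 0) (hθH : |θ| * H ≤ Real.pi) :
    bilinearSum θ H ≤ 3 * H + 2 * Real.pi * (1 + Real.log H) / |θ| := by
  rw [bilinearSum_eq]
  have hH' : (1 : ℝ) ≤ H := by exact_mod_cast hH
  have hθ0 : 0 < |θ| := abs_pos.mpr hθ
  have key : ∀ n : ℤ, n ≠ 0 → |(n : ℝ)| ≤ H →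
      ‖∑ l ∈ Icc (-(H : ℤ)) H, Complex.exp ((θ * n * l : ℝ) * Complex.I)‖ ≤
      Real.pi / (|θ| * |(n : ℝ)|) := by
    intro n hn hnH
    rw [← abs_mul]
    refine norm_sum_Icc_exp_le _ (mul_ne_zero hθ (by exact_mod_cast hn)) ?_ H
    rw [abs_mul]
    refine le_trans ?_ hθH
    gcongr
  refine (sum_Icc_neg_le _ (fun m => 2 * Real.pi / |θ| * ((m : ℝ) + 1)⁻¹) H ?_).trans ?_
  · intro m hm
    have hm' : (m : ℝ) + 1 ≤ H := by exact_mod_cast hm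
    have hm0 : |((m : ℝ) + 1)| = m + 1 := abs_of_pos (by positivity)
    have h1 := key ((m : ℤ) + 1) (by omega) (by push_cast; rwa [hm0])
    have h2 := key (-((m : ℤ) + 1)) (by omega) (by push_cast; rw [abs_neg, hm0]; exact hm')
    have e : 2 * Real.pi / |θ| * ((m : ℝ) + 1)⁻¹ = Real.pi / (|θ| * (m + 1)) +
        Real.pi / (|θ| * (m + 1)) := by
      field_simp
      ring
    rw [e]
    refine add_le_add (h1.trans (le_of_eq ?_)) (h2.trans (le_of_eq ?_))
    · push_cast
      rw [hm0]
    · push_cast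
      rw [abs_neg, hm0]
  · refine add_le_add ((norm_sum_Icc_exp_le_trivial _ _).trans (by linarith)) ?_
    rw [← Finset.mul_sum]
    have h := harmonic_le_one_add_log H
    rw [harmonic] at h
    push_cast at h
    calc _ ≤ 2 * Real.pi / |θ| * (1 + Real.log H) := by
          have := Real.pi_pos
          gcongr
      _ = _ := by ring

end BilinearSum

section ShiftedSums
open Finset

/-- `n ^ (-i t)` written through its phase. -/
noncomputable def phase (t : ℝ) (x : ℝ) : ℂ := Complex.exp ((-(t * Real.log x) : ℝ) * Complex.I)

theorem norm_phase (t x : ℝ) : ‖phase t x‖ = 1 := Complex.norm_exp_ofReal_mul_I _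

theorem norm_sum_sub_sum_shift_le (f : ℕ → ℂ) (hf : ∀ n, ‖f n‖ ≤ 1) (M M' h : ℕ) (hM : M ≤ M') :
    ‖∑ n ∈ Ico M M', f n - ∑ n ∈ Ico M M', f (n + h)‖ ≤ 2 * h := by
  induction h with
  | zero => simp
  | succ h ih =>
    have h1 : ∑ n ∈ Ico M M', f (n + h) - ∑ n ∈ Ico M M', f (n + (h + 1)) =
        f (M + h) - f (M' + h) := by
      have := Finset.sum_Ico_sub (fun n => f (n + h)) hM
      rw [Finset.sum_sub_distrib] at this
      have e : ∀ n, n + (h + 1) = n + 1 + h := by intro n; ring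
      simp only [e]
      linear_combination -this
    calc _ = ‖(∑ n ∈ Ico M M', f n - ∑ n ∈ Ico M M', f (n + h)) +
        (f (M + h) - f (M' + h))‖ := by rw [← h1]; congr 1; ring
      _ ≤ 2 * h + (1 + 1) := (norm_add_le _ _).trans (add_le_add ih
          ((norm_sub_le _ _).trans (add_le_add (hf _) (hf _))))
      _ = _ := by push_cast; ring

theorem norm_sum_le_of_shifts (f : ℕ → ℂ) (hf : ∀ n, ‖f n‖ ≤ 1) {M M' Y : ℕ} (hM : M ≤ M') :
    (Y : ℝ) ^ 2 * ‖∑ n ∈ Ico M M', f n‖ ≤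
      ∑ n ∈ Ico M M', ‖∑ x : Fin Y, ∑ y : Fin Y, f (n + x * y)‖ + 2 * (Y : ℝ) ^ 4 := by
  have h1 : ∑ x : Fin Y, ∑ y : Fin Y, ∑ n ∈ Ico M M', f n =
      ∑ x : Fin Y, ∑ y : Fin Y,
        (∑ n ∈ Ico M M', f n - ∑ n ∈ Ico M M', f (n + (x : ℕ) * (y : ℕ))) +
      ∑ n ∈ Ico M M', ∑ x : Fin Y, ∑ y : Fin Y, f (n + (x : ℕ) * (y : ℕ)) := by
    have h2 : ∑ n ∈ Ico M M', ∑ x : Fin Y, ∑ y : Fin Y, f (n + (x : ℕ) * (y : ℕ)) =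
        ∑ x : Fin Y, ∑ y : Fin Y, ∑ n ∈ Ico M M', f (n + (x : ℕ) * (y : ℕ)) := by
      rw [Finset.sum_comm]
      exact Finset.sum_congr rfl fun x _ => Finset.sum_comm
    rw [h2]
    simp only [← Finset.sum_add_distrib, sub_add_cancel]
  have h3 := congrArg norm h1
  simp only [Finset.sum_const, Finset.card_univ, Fintype.card_fin, nsmul_eq_mul, norm_mul,
    Complex.norm_natCast] at h3
  rw [sq, mul_assoc, h3, add_comm (∑ n ∈ Ico M M', _)]
  refine (norm_add_le _ _).trans (add_le_add ?_ (norm_sum_le _ _))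
  calc _ ≤ ∑ x : Fin Y, ∑ y : Fin Y, 2 * (Y : ℝ) ^ 2 := by
        refine (norm_sum_le _ _).trans (Finset.sum_le_sum fun x _ => (norm_sum_le _ _).trans
          (Finset.sum_le_sum fun y _ => (norm_sum_sub_sum_shift_le f hf M M' _ hM).trans ?_))
        push_cast
        have hx : ((x : ℕ) : ℝ) ≤ Y := by exact_mod_cast x.2.le
        have hy : ((y : ℕ) : ℝ) ≤ Y := by exact_mod_cast y.2.le
        rw [sq]
        gcongr
    _ = _ := by
        simp only [Finset.sum_const, Finset.card_univ, Fintype.card_fin, nsmul_eq_mul]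
        ring

theorem norm_exp_mul_I_sub_le (a b : ℝ) :
    ‖Complex.exp (a * Complex.I) - Complex.exp (b * Complex.I)‖ ≤ |a - b| := by
  have : Complex.exp (a * Complex.I) - Complex.exp (b * Complex.I) =
      Complex.exp (b * Complex.I) * (Complex.exp (Complex.I * (a - b : ℝ)) - 1) := by
    rw [mul_sub, ← Complex.exp_add, mul_one]
    congr 2
    push_cast
    ring
  rw [this, norm_mul, Complex.norm_exp_ofReal_mul_I, one_mul]
  exact Real.norm_exp_I_mul_ofReal_sub_one_le

/-- The Taylor coefficients of `-t log (1 + v / n)`. -/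
noncomputable def logCoeff (k : ℕ) (t : ℝ) (n : ℕ) (j : Fin k) : ℝ :=
  t * (-1) ^ ((j : ℕ) + 1) / (((j : ℕ) + 1) * (n : ℝ) ^ ((j : ℕ) + 1))

theorem abs_log_taylor_le {k n : ℕ} (hn : 1 ≤ n) {t u v : ℝ} (ht : 0 ≤ t) (hv : 0 ≤ v)
    (hu : u ≤ 1 / 2) (hvu : v ≤ u * n) :
    |(-(t * Real.log (n + v))) - (-(t * Real.log n) +
      ∑ j : Fin k, logCoeff k t n j * v ^ ((j : ℕ) + 1))| ≤ t * (2 * u ^ (k + 1)) := by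
  have hn' : (0 : ℝ) < n := by exact_mod_cast hn
  have hw0 : 0 ≤ v / n := by positivity
  have hw : v / n ≤ u := by rwa [div_le_iff₀ hn']
  have habs : |(-(v / n))| = v / n := by rw [abs_neg, abs_of_nonneg hw0]
  have h1 := Real.abs_log_sub_add_sum_range_le (x := -(v / n)) (by rw [habs]; linarith) k
  rw [habs, sub_neg_eq_add] at h1
  have e1 : Real.log (n + v) = Real.log n + Real.log (1 + v / n) := by
    rw [← Real.log_mul (by positivity) (by positivity)]
    congr 1
    field_simp
  have e2 : ∑ j : Fin k, logCoeff k t n j * v ^ ((j : ℕ) + 1) =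
      t * ∑ i ∈ range k, (-(v / n)) ^ (i + 1) / (i + 1) := by
    rw [Finset.mul_sum, ← Fin.sum_univ_eq_sum_range
      (fun i => t * ((-(v / n)) ^ (i + 1) / ((i : ℝ) + 1)))]
    refine Finset.sum_congr rfl fun j _ => ?_
    rw [logCoeff, neg_eq_neg_one_mul (v / n), mul_pow, div_pow]
    field_simp
  rw [e1, e2]
  have e3 : -(t * (Real.log n + Real.log (1 + v / n))) - (-(t * Real.log n) +
      t * ∑ i ∈ range k, (-(v / n)) ^ (i + 1) / (i + 1)) =
      -(t * (∑ i ∈ range k, (-(v / n)) ^ (i + 1) / (i + 1) + Real.log (1 + v / n))) := by ring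
  rw [e3, abs_neg, abs_mul, abs_of_nonneg ht]
  refine mul_le_mul_of_nonneg_left (h1.trans ?_) ht
  rw [div_le_iff₀ (by linarith)]
  have h2 : (v / n) ^ (k + 1) ≤ u ^ (k + 1) := by gcongr
  have h3 : (0 : ℝ) ≤ u ^ (k + 1) := by
    have : 0 ≤ u := hw0.trans hw
    positivity
  nlinarith

theorem norm_sum_phase_le {k n Y : ℕ} (hn : 1 ≤ n) {t u : ℝ} (ht : 0 ≤ t) (hu : u ≤ 1 / 2)
    (hY : (Y : ℝ) ^ 2 ≤ u * n) :
    ‖∑ x : Fin Y, ∑ y : Fin Y, phase t ((n + (x : ℕ) * (y : ℕ) : ℕ) : ℝ)‖ ≤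
      ‖∑ x : Fin Y, ∑ y : Fin Y, Complex.exp ((∑ j, logCoeff k t n j *
        (((x : ℕ) : ℝ) ^ ((j : ℕ) + 1) * ((y : ℕ) : ℝ) ^ ((j : ℕ) + 1)) : ℝ) * Complex.I)‖ +
      (Y : ℝ) ^ 2 * (t * (2 * u ^ (k + 1))) := by
  set a : Fin Y → Fin Y → ℝ := fun x y => ∑ j, logCoeff k t n j *
        (((x : ℕ) : ℝ) ^ ((j : ℕ) + 1) * ((y : ℕ) : ℝ) ^ ((j : ℕ) + 1)) with ha
  have h1 : ∑ x : Fin Y, ∑ y : Fin Y, phase t ((n + (x : ℕ) * (y : ℕ) : ℕ) : ℝ) =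
      phase t n * ∑ x : Fin Y, ∑ y : Fin Y, Complex.exp ((a x y : ℝ) * Complex.I) +
      ∑ x : Fin Y, ∑ y : Fin Y, (phase t ((n + (x : ℕ) * (y : ℕ) : ℕ) : ℝ) -
        Complex.exp ((-(t * Real.log n) + a x y : ℝ) * Complex.I)) := by
    rw [Finset.mul_sum, ← Finset.sum_add_distrib]
    refine Finset.sum_congr rfl fun x _ => ?_
    rw [Finset.mul_sum, ← Finset.sum_add_distrib]
    refine Finset.sum_congr rfl fun y _ => ?_
    rw [phase, phase, ← sub_eq_iff_eq_add, sub_sub_cancel, ← Complex.exp_add]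
    push_cast
    ring_nf
  rw [h1]
  refine (norm_add_le _ _).trans (add_le_add (by rw [norm_mul, norm_phase, one_mul]) ?_)
  calc _ ≤ ∑ x : Fin Y, ∑ y : Fin Y, t * (2 * u ^ (k + 1)) := by
        refine (norm_sum_le _ _).trans (Finset.sum_le_sum fun x _ => (norm_sum_le _ _).trans
          (Finset.sum_le_sum fun y _ => ?_))
        refine (norm_exp_mul_I_sub_le _ _).trans ?_
        have hx : ((x : ℕ) : ℝ) ≤ Y := by exact_mod_cast x.2.le
        have hy : ((y : ℕ) : ℝ) ≤ Y := by exact_mod_cast y.2.le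
        have := abs_log_taylor_le (k := k) hn ht (v := ((x : ℕ) : ℝ) * ((y : ℕ) : ℝ))
          (by positivity) hu (le_trans (by rw [sq]; gcongr) hY)
        simp only [mul_pow] at this
        push_cast
        exact this
    _ = _ := by
        simp only [Finset.sum_const, Finset.card_univ, Fintype.card_fin, nsmul_eq_mul]
        ring

theorem prod_le_mul_prod_of_le {ι : Type} [Fintype ι] [DecidableEq ι] (f g : ι → ℝ)
    (hf : ∀ i, 0 ≤ f i) (hfg : ∀ i, f i ≤ g i) (i₀ : ι) {δ : ℝ} (h : f i₀ ≤ δ * g i₀) :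
    ∏ i, f i ≤ δ * ∏ i, g i := by
  rw [← Finset.mul_prod_erase univ f (mem_univ i₀), ← Finset.mul_prod_erase univ g (mem_univ i₀),
    ← mul_assoc]
  have h1 := Finset.prod_le_prod (s := univ.erase i₀) (fun i _ => hf i) (fun i _ => hfg i)
  exact mul_le_mul h h1 (Finset.prod_nonneg fun i _ => hf i) ((hf i₀).trans h)

theorem double_sum_pow_le {k s Y : ℕ} (hk : 4 ≤ k) (hs : s = k ^ 2 + 2 * k ^ 3) (hY : 1 ≤ Y)
    (θ : Fin k → ℝ) (j₀ : Fin k) {δ : ℝ}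
    (hδ : bilinearSum (θ j₀) (s * Y ^ ((j₀ : ℕ) + 1)) ≤
      δ * (9 * ((s * Y ^ ((j₀ : ℕ) + 1) : ℕ) : ℝ) ^ 2)) :
    ‖∑ x : Fin Y, ∑ y : Fin Y, Complex.exp
      ((∑ j, θ j * (((x : ℕ) : ℝ) ^ ((j : ℕ) + 1) * ((y : ℕ) : ℝ) ^ ((j : ℕ) + 1)) : ℝ) *
        Complex.I)‖ ^ (2 * s * (2 * s)) ≤
    ((Y : ℝ) ^ 2) ^ (2 * s * (2 * s)) *
      ((k : ℝ) ^ (46 * k ^ 2 * s) * (9 * (s : ℝ) ^ 2) ^ k * ((Y : ℝ) ^ (1 / 5 : ℝ) * δ)) := by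
  have hs0 : 1 ≤ s := by rw [hs]; have : 0 < k ^ 2 := by positivity
                         omega
  have hY0 : (0 : ℝ) < Y := by exact_mod_cast hY
  have hH : ∀ j : Fin k, 1 ≤ s * Y ^ ((j : ℕ) + 1) := fun j =>
    Nat.mul_pos hs0 (pow_pos hY _)
  have h1 := double_sum_le (k := k) (s := s) (Y := Y) (by omega) θ
  have h2 := prod_le_mul_prod_of_le (fun j : Fin k => bilinearSum (θ j) (s * Y ^ ((j : ℕ) + 1)))
    (fun j : Fin k => 9 * ((s * Y ^ ((j : ℕ) + 1) : ℕ) : ℝ) ^ 2) (fun j => bilinearSum_nonneg _ _)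
    (fun j => bilinearSum_le_trivial _ (hH j)) j₀ hδ
  have h3 := vinogradov_mean_value hk hs Y hY
  refine h1.trans ?_
  have h4 : ((vinogradovCount k (Fin s) Y : ℕ) : ℝ) ^ 2 ≤
      ((k:ℝ)^(23*k^2*s) * (Y:ℝ)^(2*s - k*(k+1)/2 + 1/10 : ℝ)) ^ 2 := by gcongr
  refine (mul_le_mul (mul_le_mul_of_nonneg_left h4 (by positivity)) h2
    (Finset.prod_nonneg fun i _ => bilinearSum_nonneg _ _) (by positivity)).trans (le_of_eq ?_)
  have h5 : ∏ j : Fin k, (9 * ((s * Y ^ ((j : ℕ) + 1) : ℕ) : ℝ) ^ 2) =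
      (9 * (s : ℝ) ^ 2) ^ k * (Y : ℝ) ^ (k * (k + 1) : ℝ) := by
    have h6 : ∑ j : Fin k, ((j : ℕ) + 1) * 2 = k * (k + 1) := by
      rw [Fin.sum_univ_eq_sum_range (fun i => (i + 1) * 2)]
      clear * -
      induction k with
      | zero => simp
      | succ k ih => rw [Finset.sum_range_succ, ih]; ring
    have h7 : ∀ j : Fin k, 9 * ((s * Y ^ ((j : ℕ) + 1) : ℕ) : ℝ) ^ 2 =
        9 * (s : ℝ) ^ 2 * (Y : ℝ) ^ (((j : ℕ) + 1) * 2) := by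
      intro j
      push_cast
      ring
    rw [Finset.prod_congr rfl fun j _ => h7 j, Finset.prod_mul_distrib, Finset.prod_const,
      Finset.prod_pow_eq_pow_sum, h6, card_univ, Fintype.card_fin, ← Real.rpow_natCast _ (_ * _)]
    push_cast
    rfl
  rw [h5]
  have h7 : (Y : ℝ) ^ (2 * (2 * s * (2 * s - 1))) * ((Y:ℝ)^(2*s - k*(k+1)/2 + 1/10 : ℝ)) ^ 2 *
      (Y : ℝ) ^ (k * (k + 1) : ℝ) = ((Y : ℝ) ^ 2) ^ (2 * s * (2 * s)) * (Y : ℝ) ^ (1 / 5 : ℝ) := by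
    rw [← Real.rpow_natCast, ← Real.rpow_natCast (_ ^ _) 2, ← Real.rpow_mul hY0.le, ← pow_mul,
      ← Real.rpow_natCast _ (2 * _), ← Real.rpow_add hY0, ← Real.rpow_add hY0, ← Real.rpow_add hY0]
    congr 1
    have : ((2 * s - 1 : ℕ) : ℝ) = 2 * s - 1 := by
      rw [Nat.cast_sub (by omega)]; push_cast; ring
    push_cast [this]
    ring
  calc _ = ((Y : ℝ) ^ (2 * (2 * s * (2 * s - 1))) * ((Y:ℝ)^(2*s - k*(k+1)/2 + 1/10 : ℝ)) ^ 2 *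
      (Y : ℝ) ^ (k * (k + 1) : ℝ)) * ((k:ℝ)^(23*k^2*s)) ^ 2 * (9 * (s : ℝ) ^ 2) ^ k * δ := by ring
    _ = _ := by
      rw [h7, ← pow_mul (k : ℝ), show 23 * k ^ 2 * s * 2 = 46 * k ^ 2 * s by ring]
      ring

end ShiftedSums

section ZetaSumBound
open Finset

theorem abs_logCoeff {k n : ℕ} {t : ℝ} (ht : 0 ≤ t) (j : Fin k) :
    |logCoeff k t n j| = t / (((j : ℕ) + 1) * (n : ℝ) ^ ((j : ℕ) + 1)) := by
  rw [logCoeff, abs_div, abs_mul, abs_pow, abs_neg, abs_one, one_pow, mul_one, abs_of_nonneg ht,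
    abs_of_nonneg (by positivity)]

theorem main_term_le {L q θ H : ℝ} (hLbig : 10 ^ 20 ≤ L) (hq : 10 ^ 17 * q ≤ L)
    (hθpos : 0 < |θ|) (hHlow : Real.exp (3 / 4 * L - q) ≤ H) (hlogH : 1 + Real.log H ≤ 3 * L)
    (hH2θ : Real.exp (L / 8 - 4 * q) ≤ H ^ 2 * |θ|) :
    3 * H + 2 * Real.pi * (1 + Real.log H) / |θ| ≤ Real.exp (-(19 / 160 * L)) * (9 * H ^ 2) := by
  have hHpos : 0 < H := (Real.exp_pos _).trans_le hHlow
  have hexp : ∀ x : ℝ, 0 ≤ x → x ^ 2 / 2 ≤ Real.exp x := fun x hx => by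
    have := Real.quadratic_le_exp_of_nonneg hx
    linarith
  have hpi := Real.pi_lt_four
  have hpi0 := Real.pi_pos
  have hA : 3 * H ≤ Real.exp (-(19 / 160 * L)) * (4 * H ^ 2) := by
    have : 1 ≤ Real.exp (-(19 / 160 * L)) * H := by
      calc 1 ≤ Real.exp (-(19 / 160 * L) + (3 / 4 * L - q)) := Real.one_le_exp (by nlinarith)
        _ ≤ _ := by
          rw [Real.exp_add]
          gcongr
    nlinarith
  have hB : 2 * Real.pi * (1 + Real.log H) / |θ| ≤ Real.exp (-(19 / 160 * L)) * (4 * H ^ 2) := by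
    rw [div_le_iff₀ hθpos]
    have hlog0 : 0 ≤ 1 + Real.log H := by
      have := (Real.le_log_iff_exp_le hHpos).mpr hHlow
      nlinarith
    calc _ ≤ 2 * 4 * (3 * L) := by gcongr
      _ = 24 * L := by ring
      _ ≤ (L / 320) ^ 2 / 2 := by nlinarith
      _ ≤ Real.exp (L / 320) := hexp _ (by positivity)
      _ ≤ Real.exp (-(19 / 160 * L) + (L / 8 - 4 * q)) := by
        gcongr
        nlinarith
      _ ≤ Real.exp (-(19 / 160 * L)) * (H ^ 2 * |θ|) := by
        rw [Real.exp_add]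
        gcongr
      _ ≤ _ := by
        have := Real.exp_pos (-(19 / 160 * L))
        have : 0 ≤ Real.exp (-(19 / 160 * L)) * (H ^ 2 * |θ|) := by positivity
        nlinarith
  nlinarith [Real.exp_pos (-(19 / 160 * L)), sq_nonneg H,
    mul_nonneg (Real.exp_pos (-(19 / 160 * L))).le (sq_nonneg H)]

set_option maxHeartbeats 1600000 in
theorem bilinearSum_logCoeff_le {W ℓ : ℝ} (hW : 10 ^ 9 ≤ W) (hℓ : W ^ 7 ≤ ℓ)
    (hℓ' : ℓ ≤ 3 / 2 * W ^ 8) {k s Y n : ℕ} (hk : 4 * W ≤ k)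
    (hs : 1 ≤ s) (hs' : (s : ℝ) ≤ 375 * W ^ 3) (hY : (Y : ℝ) ≤ Real.exp (3 / 8 * ℓ))
    (hY' : Real.exp (3 / 8 * ℓ) ≤ 2 * Y) (hn : Real.exp ℓ ≤ n) (hn' : n ≤ 2 * Real.exp ℓ) :
    ∃ j : Fin k, bilinearSum (logCoeff k (Real.exp (W ^ 8)) n j) (s * Y ^ ((j : ℕ) + 1)) ≤
      Real.exp (-(19 / 160 * W ^ 8)) * (9 * ((s * Y ^ ((j : ℕ) + 1) : ℕ) : ℝ) ^ 2) := by
  have hW0 : 0 < W := by linarith [show (0 : ℝ) < 10 ^ 9 by norm_num]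
  have hℓ0 : 0 < ℓ := lt_of_lt_of_le (by positivity) hℓ
  set L := W ^ 8 with hL
  have hL0 : 0 < L := by positivity
  have hLℓ : L ≤ W * ℓ := by rw [hL]; nlinarith
  obtain ⟨q, hq1, hq2⟩ : ∃ q : ℕ, 2 * L ≤ q * ℓ ∧ (q : ℝ) * ℓ ≤ 2 * L + ℓ := by
    refine ⟨⌈2 * L / ℓ⌉₊, ?_, ?_⟩
    · rw [← div_le_iff₀ hℓ0]
      exact Nat.le_ceil _
    · have := (Nat.ceil_lt_add_one (a := 2 * L / ℓ) (by positivity)).le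
      calc _ ≤ (2 * L / ℓ + 1) * ℓ := by gcongr
        _ = _ := by field_simp
  have hq0 : 1 ≤ q := by
    rcases Nat.eq_zero_or_pos q with h | h
    · rw [h] at hq1
      simp only [Nat.cast_zero, zero_mul] at hq1
      linarith
    · exact h
  have hqW : (q : ℝ) ≤ 2 * W + 1 := by
    refine le_of_mul_le_mul_right ?_ hℓ0
    nlinarith
  have hqk : q ≤ k := by
    have : (q : ℝ) ≤ k := by linarith
    exact_mod_cast this
  have hY0 : 1 ≤ Y := by
    rcases Nat.eq_zero_or_pos Y with h | h
    · rw [h] at hY'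
      have := Real.exp_pos (3 / 8 * ℓ)
      simp only [Nat.cast_zero, mul_zero] at hY'
      linarith
    · exact h
  refine ⟨⟨q - 1, by omega⟩, ?_⟩
  have hqq : ((⟨q - 1, by omega⟩ : Fin k) : ℕ) + 1 = q := by simp; omega
  have hθ := abs_logCoeff (n := n) (Real.exp_pos L).le (⟨q - 1, by omega⟩ : Fin k)
  have hqr : ((((⟨q - 1, by omega⟩ : Fin k) : ℕ) : ℝ) + 1) = q := by exact_mod_cast hqq
  rw [hqq, hqr] at hθ
  rw [hqq]
  generalize logCoeff k (Real.exp L) n ⟨q - 1, by omega⟩ = θ at hθ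
  have hq0' : (1 : ℝ) ≤ q := by exact_mod_cast hq0
  have hs1 : (1 : ℝ) ≤ s := by exact_mod_cast hs
  have hY1 : (1 : ℝ) ≤ Y := by exact_mod_cast hY0
  have hn0 : (0 : ℝ) < n := (Real.exp_pos _).trans_le hn
  have hH1 : 1 ≤ s * Y ^ q := Nat.mul_pos hs (pow_pos hY0 _)
  -- size of `L` against the lower order quantities
  have hWL : W * 10 ^ 18 ≤ L := by
    have h1 : (1 : ℝ) ≤ W := by linarith [show (1 : ℝ) ≤ 10 ^ 9 by norm_num]
    have : (10 ^ 9 : ℝ) ^ 2 ≤ W ^ 2 := by gcongr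
    have h5 : 1 ≤ W ^ 5 := one_le_pow₀ h1
    calc W * 10 ^ 18 = W * (10 ^ 9) ^ 2 * 1 := by norm_num
      _ ≤ W * W ^ 2 * W ^ 5 := by gcongr
      _ = L := by rw [hL]; ring
  have hs2 : (s : ℝ) ≤ L := by
    have h1 : (1 : ℝ) ≤ W := by linarith [show (1 : ℝ) ≤ 10 ^ 9 by norm_num]
    have h5 : 1 ≤ W ^ 4 := one_le_pow₀ h1
    calc (s : ℝ) ≤ 375 * W ^ 3 * 1 := by linarith
      _ ≤ W * W ^ 3 * W ^ 4 := by
        gcongr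
        linarith [show (375 : ℝ) ≤ 10 ^ 9 by norm_num]
      _ = L := by rw [hL]; ring
  have hexp : ∀ x : ℝ, 0 ≤ x → x ^ 2 / 2 ≤ Real.exp x := fun x hx => by
    have := Real.quadratic_le_exp_of_nonneg hx
    linarith
  have hLbig : (10 : ℝ) ^ 20 ≤ L := by
    have : (10 : ℝ) ^ 9 * 10 ^ 18 ≤ W * 10 ^ 18 := by gcongr
    have : (10 : ℝ) ^ 20 ≤ 10 ^ 9 * 10 ^ 18 := by norm_num
    linarith
  have hYq : (Y : ℝ) ^ q ≤ Real.exp (3 / 8 * ℓ * q) := by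
    calc _ ≤ (Real.exp (3 / 8 * ℓ)) ^ q := by gcongr
      _ = _ := by rw [← Real.exp_nat_mul]; ring_nf
  have htwo : ∀ m : ℕ, (2 : ℝ) ^ m ≤ Real.exp m := by
    intro m
    calc (2 : ℝ) ^ m ≤ (Real.exp 1) ^ m := by
          gcongr
          linarith [Real.add_one_le_exp 1]
      _ = _ := by rw [← Real.exp_nat_mul]; ring_nf
  have hYq' : Real.exp (3 / 8 * ℓ * q - q) ≤ (Y : ℝ) ^ q := by
    have h1 : (Real.exp (3 / 8 * ℓ)) ^ q ≤ (2 * (Y : ℝ)) ^ q := by gcongr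
    rw [← Real.exp_nat_mul, mul_pow] at h1
    rw [Real.exp_sub, div_le_iff₀ (Real.exp_pos _)]
    calc _ = Real.exp (q * (3 / 8 * ℓ)) := by ring_nf
      _ ≤ 2 ^ q * (Y : ℝ) ^ q := h1
      _ ≤ Real.exp q * (Y : ℝ) ^ q := by gcongr; exact htwo q
      _ = _ := by ring
  have hnq : Real.exp (ℓ * q) ≤ (n : ℝ) ^ q := by
    calc _ = (Real.exp ℓ) ^ q := by rw [← Real.exp_nat_mul]; ring_nf
      _ ≤ _ := by gcongr
  have hnq' : (n : ℝ) ^ q ≤ Real.exp (ℓ * q + q) := by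
    calc _ ≤ (2 * Real.exp ℓ) ^ q := by gcongr
      _ = 2 ^ q * Real.exp (q * ℓ) := by rw [mul_pow, ← Real.exp_nat_mul]
      _ ≤ Real.exp q * Real.exp (q * ℓ) := by gcongr; exact htwo q
      _ = _ := by rw [← Real.exp_add]; ring_nf
  have hθpos : 0 < |θ| := by rw [hθ]; positivity
  have hHcast : ((s * Y ^ q : ℕ) : ℝ) = s * (Y : ℝ) ^ q := by push_cast; ring
  -- the phase is small on the whole box
  have hθH : |θ| * ((s * Y ^ q : ℕ) : ℝ) ≤ Real.pi := by
    rw [hHcast, hθ]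
    calc _ ≤ Real.exp L / (1 * Real.exp (ℓ * q)) * (s * Real.exp (3 / 8 * ℓ * q)) := by gcongr
      _ = s * Real.exp (L - ℓ * q + 3 / 8 * ℓ * q) := by
          rw [Real.exp_add, Real.exp_sub]
          ring
      _ ≤ L * Real.exp (-(L / 4)) := by
          gcongr
          nlinarith
      _ ≤ 3 := by
          rw [Real.exp_neg, ← div_eq_mul_inv, div_le_iff₀ (Real.exp_pos _)]
          have := hexp (L / 4) (by positivity)
          nlinarith
      _ ≤ _ := Real.pi_gt_three.le
  have hHlow : Real.exp (3 / 4 * L - q) ≤ ((s * Y ^ q : ℕ) : ℝ) := by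
    rw [hHcast]
    calc _ ≤ Real.exp (3 / 8 * ℓ * q - q) := Real.exp_le_exp.mpr (by nlinarith)
      _ ≤ _ := hYq'
      _ ≤ _ := le_mul_of_one_le_left (by positivity) hs1
  have hlogH : 1 + Real.log ((s * Y ^ q : ℕ) : ℝ) ≤ 3 * L := by
    rw [hHcast, Real.log_mul (by positivity) (by positivity)]
    have h1 : Real.log s ≤ s - 1 := Real.log_le_sub_one_of_pos (by linarith)
    have h2 : Real.log ((Y : ℝ) ^ q) ≤ 3 / 8 * ℓ * q := by
      rw [Real.log_le_iff_le_exp (by positivity)]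
      exact hYq
    nlinarith
  have hH2θ : Real.exp (L / 8 - 4 * q) ≤ ((s * Y ^ q : ℕ) : ℝ) ^ 2 * |θ| := by
    rw [hθ, hHcast]
    have h1 : (q : ℝ) ≤ Real.exp q := by linarith [Real.add_one_le_exp (q : ℝ)]
    calc _ ≤ Real.exp (2 * (3 / 8 * ℓ * q - q) + L - (q + (ℓ * q + q))) :=
          Real.exp_le_exp.mpr (by nlinarith)
      _ = (Real.exp (3 / 8 * ℓ * q - q)) ^ 2 *
          (Real.exp L / (Real.exp q * Real.exp (ℓ * q + q))) := by
          rw [Real.exp_sub, Real.exp_add, Real.exp_add (q : ℝ), ← Real.exp_nat_mul]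
          push_cast
          ring
      _ ≤ (1 * (Y : ℝ) ^ q) ^ 2 * (Real.exp L / (q * (n : ℝ) ^ q)) := by
          rw [one_mul]
          gcongr
      _ ≤ _ := by gcongr
  refine (bilinearSum_le hH1 (abs_pos.mp hθpos) hθH).trans ?_
  exact main_term_le hLbig (by linarith) hθpos hHlow hlogH hH2θ

end ZetaSumBound

section ZetaSumFinal
open Finset

theorem mean_value_constant_le {k s : ℕ} (hk : 4 ≤ k) (hs : s = k ^ 2 + 2 * k ^ 3) :
    (k : ℝ) ^ (46 * k ^ 2 * s) * (9 * (s : ℝ) ^ 2) ^ k ≤ (Real.exp 8) ^ (2 * s * (2 * s)) := by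
  have hexp : ∀ m : ℕ, (m : ℝ) ≤ Real.exp m := fun m => by linarith [Real.add_one_le_exp (m : ℝ)]
  have h1 : (k : ℝ) ^ (46 * k ^ 2 * s) ≤ Real.exp (23 * (s : ℝ) ^ 2) := by
    calc _ ≤ (Real.exp k) ^ (46 * k ^ 2 * s) := by gcongr; exact hexp k
      _ = Real.exp (((46 * k ^ 2 * s * k : ℕ) : ℝ)) := by
        rw [← Real.exp_nat_mul]
        push_cast
        ring_nf
      _ ≤ Real.exp (((23 * s ^ 2 : ℕ) : ℝ)) := by
        refine Real.exp_le_exp.mpr (Nat.cast_le.mpr ?_)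
        have : 2 * k ^ 3 ≤ s := by omega
        nlinarith
      _ = _ := by push_cast; ring_nf
  have h2 : (9 * (s : ℝ) ^ 2) ^ k ≤ Real.exp ((s : ℝ) ^ 2) := by
    calc _ = (((3 * s : ℕ) : ℝ)) ^ (2 * k) := by
          rw [pow_mul]
          push_cast
          ring
      _ ≤ (Real.exp ((3 * s : ℕ) : ℝ)) ^ (2 * k) := by gcongr; exact hexp _
      _ = Real.exp (((2 * k * (3 * s) : ℕ) : ℝ)) := by
        rw [← Real.exp_nat_mul]
        push_cast
        ring_nf
      _ ≤ Real.exp (((s ^ 2 : ℕ) : ℝ)) := by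
        refine Real.exp_le_exp.mpr (Nat.cast_le.mpr ?_)
        have : 6 * k ≤ s := by nlinarith
        nlinarith
      _ = _ := by push_cast; ring_nf
  calc _ ≤ Real.exp (23 * (s : ℝ) ^ 2) * Real.exp ((s : ℝ) ^ 2) := by gcongr
    _ = Real.exp (24 * (s : ℝ) ^ 2) := by rw [← Real.exp_add]; ring_nf
    _ ≤ Real.exp ((2 * s * (2 * s) : ℕ) * 8) := by
      refine Real.exp_le_exp.mpr ?_
      push_cast
      nlinarith [sq_nonneg (s : ℝ)]
    _ = _ := by rw [← Real.exp_nat_mul]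

theorem exists_params {W : ℝ} (hW : 10 ^ 9 ≤ W) : ∃ k s : ℕ, 4 ≤ k ∧ s = k ^ 2 + 2 * k ^ 3 ∧
    4 * W ≤ k ∧ (k : ℝ) ≤ 5 * W ∧ 1 ≤ s ∧ (s : ℝ) ≤ 375 * W ^ 3 := by
  have hW1 : (4 : ℝ) ≤ W := le_trans (by norm_num) hW
  have h1 := Nat.le_ceil (4 * W)
  have h2 := (Nat.ceil_lt_add_one (a := 4 * W) (by linarith)).le
  have h3 : 4 ≤ ⌈4 * W⌉₊ := by
    have : (4 : ℝ) ≤ ⌈4 * W⌉₊ := by linarith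
    exact_mod_cast this
  refine ⟨⌈4 * W⌉₊, _, h3, rfl, h1, by linarith, by nlinarith, ?_⟩
  generalize ⌈4 * W⌉₊ = k at *
  have hk : (k : ℝ) ≤ 5 * W := by linarith
  have hk1 : (4 : ℝ) ≤ k := by linarith
  push_cast
  calc (k : ℝ) ^ 2 + 2 * (k : ℝ) ^ 3 ≤ 3 * (k : ℝ) ^ 3 := by nlinarith [sq_nonneg (k : ℝ)]
    _ ≤ 3 * (5 * W) ^ 3 := by gcongr
    _ = _ := by ring

theorem inner_sum_le {W ℓ : ℝ} (hW : 10 ^ 9 ≤ W) (hℓ : W ^ 7 ≤ ℓ) (hℓ' : ℓ ≤ 3 / 2 * W ^ 8)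
    {Y n : ℕ} (hY : (Y : ℝ) ≤ Real.exp (3 / 8 * ℓ)) (hY' : Real.exp (3 / 8 * ℓ) ≤ 2 * Y)
    (hn : Real.exp ℓ ≤ n) (hn' : n ≤ 2 * Real.exp ℓ) :
    ‖∑ x : Fin Y, ∑ y : Fin Y, phase (Real.exp (W ^ 8)) ((n + (x : ℕ) * (y : ℕ) : ℕ) : ℝ)‖ ≤
      (Y : ℝ) ^ 2 * (Real.exp (-(3 * W)) + 2 * Real.exp (-(ℓ / 4))) := by
  obtain ⟨k, s, hk4, hs, hk, -, hs1, hs'⟩ := exists_params hW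
  have hW0 : 0 < W := by linarith [show (0 : ℝ) < 10 ^ 9 by norm_num]
  have hℓ0 : 0 < ℓ := lt_of_lt_of_le (by positivity) hℓ
  have hY0 : 1 ≤ Y := by
    rcases Nat.eq_zero_or_pos Y with h | h
    · rw [h] at hY'
      have := Real.exp_pos (3 / 8 * ℓ)
      simp only [Nat.cast_zero, mul_zero] at hY'
      linarith
    · exact h
  have hY1 : (1 : ℝ) ≤ Y := by exact_mod_cast hY0
  have hn1 : 1 ≤ n := by
    have : (0 : ℝ) < n := (Real.exp_pos _).trans_le hn
    exact_mod_cast this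
  obtain ⟨j, hj⟩ := bilinearSum_logCoeff_le hW hℓ hℓ' hk hs1 hs' hY hY' hn hn'
  have h1 := double_sum_pow_le hk4 hs hY0 _ j hj
  set U := ∑ x : Fin Y, ∑ y : Fin Y, Complex.exp ((∑ j, logCoeff k (Real.exp (W ^ 8)) n j *
        (((x : ℕ) : ℝ) ^ ((j : ℕ) + 1) * ((y : ℕ) : ℝ) ^ ((j : ℕ) + 1)) : ℝ) * Complex.I) with hU
  have hY5 : (Y : ℝ) ^ (1 / 5 : ℝ) * Real.exp (-(19 / 160 * W ^ 8)) ≤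
      Real.exp (-(W ^ 8 / 160)) := by
    calc _ ≤ (Real.exp (3 / 8 * ℓ)) ^ (1 / 5 : ℝ) * Real.exp (-(19 / 160 * W ^ 8)) := by gcongr
      _ = Real.exp (3 / 8 * ℓ * (1 / 5) + -(19 / 160 * W ^ 8)) := by
        rw [← Real.exp_mul, Real.exp_add]
      _ ≤ _ := Real.exp_le_exp.mpr (by linarith)
  have hsr : (1 : ℝ) ≤ s := by exact_mod_cast hs1
  have hNpos : 0 < 2 * s * (2 * s) := by positivity
  have hexpo : W ^ 8 / 160 ≥ ((2 * s * (2 * s) : ℕ) : ℝ) * (8 + 3 * W) := by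
    push_cast
    have h2 : (s : ℝ) ^ 2 ≤ (375 * W ^ 3) ^ 2 := by gcongr
    have h3 : 8 + 3 * W ≤ 4 * W := by linarith [show (8 : ℝ) ≤ 10 ^ 9 by norm_num]
    calc _ = 4 * (s : ℝ) ^ 2 * (8 + 3 * W) := by ring
      _ ≤ 4 * (375 * W ^ 3) ^ 2 * (4 * W) := by gcongr
      _ = 2250000 * W ^ 7 := by ring
      _ ≤ W / 160 * W ^ 7 := by
        gcongr
        linarith
      _ = _ := by ring
  have h2 : ‖U‖ ^ (2 * s * (2 * s)) ≤ ((Y : ℝ) ^ 2 * Real.exp (-(3 * W))) ^ (2 * s * (2 * s)) := by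
    calc _ ≤ _ := h1
      _ ≤ ((Y : ℝ) ^ 2) ^ (2 * s * (2 * s)) *
          ((Real.exp 8) ^ (2 * s * (2 * s)) * Real.exp (-(W ^ 8 / 160))) := by
        gcongr
        exact mean_value_constant_le hk4 hs
      _ ≤ ((Y : ℝ) ^ 2) ^ (2 * s * (2 * s)) * (Real.exp (-(3 * W))) ^ (2 * s * (2 * s)) := by
        rw [← Real.exp_nat_mul, ← Real.exp_nat_mul, ← Real.exp_add]
        gcongr
        nlinarith
      _ = _ := by rw [← mul_pow]
  have h3 : ‖U‖ ≤ (Y : ℝ) ^ 2 * Real.exp (-(3 * W)) :=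
    le_of_pow_le_pow_left₀ hNpos.ne' (by positivity) h2
  have hu : Real.exp (-(ℓ / 4)) ≤ 1 / 2 := by
    have h4 : 1 ≤ ℓ / 4 := by
      have h5 : (10 ^ 9 : ℝ) ^ 7 ≤ W ^ 7 := by gcongr
      have h6 : (4 : ℝ) ≤ (10 ^ 9) ^ 7 := by norm_num
      linarith
    rw [Real.exp_neg, one_div]
    exact inv_anti₀ (by norm_num) (by linarith [Real.add_one_le_exp (ℓ / 4)])
  have hY2 : (Y : ℝ) ^ 2 ≤ Real.exp (-(ℓ / 4)) * n := by
    calc (Y : ℝ) ^ 2 ≤ (Real.exp (3 / 8 * ℓ)) ^ 2 := by gcongr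
      _ = Real.exp (-(ℓ / 4)) * Real.exp ℓ := by
        rw [← Real.exp_nat_mul, ← Real.exp_add]
        push_cast
        ring_nf
      _ ≤ _ := by gcongr
  refine (norm_sum_phase_le (k := k) hn1 (Real.exp_pos (W ^ 8)).le hu hY2).trans ?_
  rw [mul_add]
  refine add_le_add h3 ?_
  refine mul_le_mul_of_nonneg_left ?_ (by positivity)
  rw [← Real.exp_nat_mul, mul_left_comm, ← Real.exp_add]
  refine mul_le_mul_of_nonneg_left (Real.exp_le_exp.mpr ?_) (by norm_num)
  push_cast
  have : W * ℓ ≤ k / 4 * ℓ := by gcongr; linarith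
  nlinarith

theorem norm_sum_phase_le_of_large {W : ℝ} (hW : 10 ^ 9 ≤ W) {M M' : ℕ} (hM : M ≤ M')
    (hM' : M' ≤ 2 * M) (h1 : W ^ 7 ≤ Real.log M) (h2 : Real.log M ≤ 3 / 2 * W ^ 8) :
    ‖∑ n ∈ Ico M M', phase (Real.exp (W ^ 8)) n‖ ≤ M * Real.exp (-(2 * W)) := by
  have hW0 : 0 < W := by linarith [show (0 : ℝ) < 10 ^ 9 by norm_num]
  have hℓ0 : 0 < Real.log M := lt_of_lt_of_le (by positivity) h1
  have hM0 : (0 : ℝ) < M := by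
    rcases Nat.eq_zero_or_pos M with h | h
    · simp [h] at hℓ0
    · exact_mod_cast h
  have hexpM := Real.exp_log hM0
  set ℓ := Real.log M
  have hE : 1 ≤ Real.exp (3 / 8 * ℓ) := Real.one_le_exp (by positivity)
  obtain ⟨Y, hY, hY'⟩ : ∃ Y : ℕ, (Y : ℝ) ≤ Real.exp (3 / 8 * ℓ) ∧
      Real.exp (3 / 8 * ℓ) ≤ 2 * Y := by
    refine ⟨⌊Real.exp (3 / 8 * ℓ)⌋₊, Nat.floor_le (by positivity), ?_⟩
    have h3 := Nat.lt_floor_add_one (Real.exp (3 / 8 * ℓ))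
    have h4 : (1 : ℝ) ≤ ⌊Real.exp (3 / 8 * ℓ)⌋₊ := by
      exact_mod_cast (Nat.one_le_floor_iff _).mpr hE
    linarith
  have hY0 : (0 : ℝ) < Y := by linarith
  have h3 := norm_sum_le_of_shifts (fun n : ℕ => phase (Real.exp (W ^ 8)) n)
    (fun n => (norm_phase _ _).le) (Y := Y) hM
  have h4 : ∑ n ∈ Ico M M', ‖∑ x : Fin Y, ∑ y : Fin Y,
      phase (Real.exp (W ^ 8)) ((n + (x : ℕ) * (y : ℕ) : ℕ) : ℝ)‖ ≤
      M * ((Y : ℝ) ^ 2 * (Real.exp (-(3 * W)) + 2 * Real.exp (-(ℓ / 4)))) := by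
    refine (Finset.sum_le_card_nsmul _ _
      ((Y : ℝ) ^ 2 * (Real.exp (-(3 * W)) + 2 * Real.exp (-(ℓ / 4)))) fun n hn => ?_).trans ?_
    · rw [mem_Ico] at hn
      refine inner_sum_le hW h1 h2 hY hY' ?_ ?_
      · rw [hexpM]
        exact_mod_cast hn.1
      · rw [hexpM]
        exact_mod_cast hn.2.le.trans hM'
    · rw [Nat.card_Ico, nsmul_eq_mul]
      gcongr
      omega
  have hY2 : (Y : ℝ) ^ 2 ≤ M * Real.exp (-(ℓ / 4)) := by
    calc (Y : ℝ) ^ 2 ≤ (Real.exp (3 / 8 * ℓ)) ^ 2 := by gcongr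
      _ = Real.exp ℓ * Real.exp (-(ℓ / 4)) := by
        rw [← Real.exp_nat_mul, ← Real.exp_add]
        push_cast
        ring_nf
      _ = _ := by rw [hexpM]
  have h5 : ‖∑ n ∈ Ico M M', phase (Real.exp (W ^ 8)) n‖ ≤
      M * (Real.exp (-(3 * W)) + 2 * Real.exp (-(ℓ / 4))) + 2 * (Y : ℝ) ^ 2 := by
    refine le_of_mul_le_mul_left (a := (Y : ℝ) ^ 2) ?_ (by positivity)
    linarith
  have h6 : Real.exp (-(ℓ / 4)) ≤ Real.exp (-(3 * W)) := by
    refine Real.exp_le_exp.mpr ?_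
    have h7 : (10 ^ 9 : ℝ) ^ 6 ≤ W ^ 6 := by gcongr
    have h8 : (12 : ℝ) ≤ W ^ 6 := le_trans (by norm_num) h7
    nlinarith
  have h7 : 5 * Real.exp (-(3 * W)) ≤ Real.exp (-(2 * W)) := by
    have h8 : (5 : ℝ) ≤ Real.exp W := by
      linarith [Real.add_one_le_exp W, show (5 : ℝ) ≤ 10 ^ 9 by norm_num]
    calc _ ≤ Real.exp W * Real.exp (-(3 * W)) := by gcongr
      _ = _ := by rw [← Real.exp_add]; ring_nf
  nlinarith

/-- A Vinogradov-type bound for the zeta sums `∑ n ^ (-i t)` with `t = exp (W ^ 8)`. -/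
theorem zeta_sum_le {W : ℝ} (hW : 10 ^ 9 ≤ W) {M M' : ℕ} (hM0 : 1 ≤ M) (hM : M ≤ M')
    (hM' : M' ≤ 2 * M) (h2 : Real.log M ≤ 3 / 2 * W ^ 8) :
    ‖∑ n ∈ Ico M M', phase (Real.exp (W ^ 8)) n‖ ≤
      3 * (M * Real.exp (-(Real.log M / W ^ 7))) := by
  have hW0 : 0 < W := by linarith [show (0 : ℝ) < 10 ^ 9 by norm_num]
  have hMr : (1 : ℝ) ≤ M := by exact_mod_cast hM0
  rcases le_or_gt (W ^ 7) (Real.log M) with h1 | h1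
  · refine (norm_sum_phase_le_of_large hW hM hM' h1 h2).trans ?_
    have h3 : Real.exp (-(2 * W)) ≤ Real.exp (-(Real.log M / W ^ 7)) := by
      refine Real.exp_le_exp.mpr (neg_le_neg ?_)
      rw [div_le_iff₀ (by positivity)]
      nlinarith [pow_pos hW0 8]
    have h4 := mul_le_mul_of_nonneg_left h3 (by positivity : (0 : ℝ) ≤ M)
    have h5 : 0 ≤ (M : ℝ) * Real.exp (-(Real.log M / W ^ 7)) := by positivity
    linarith
  · have h3 : ‖∑ n ∈ Ico M M', phase (Real.exp (W ^ 8)) n‖ ≤ M := by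
      refine (norm_sum_le _ _).trans ?_
      simp only [norm_phase, Finset.sum_const, Nat.card_Ico, nsmul_eq_mul, mul_one]
      exact_mod_cast (by omega : M' - M ≤ M)
    have h4 : Real.log M / W ^ 7 ≤ 1 := by
      rw [div_le_one (by positivity)]
      exact h1.le
    have h5 : 1 ≤ 3 * Real.exp (-(Real.log M / W ^ 7)) := by
      have h6 : Real.exp (-1) ≤ Real.exp (-(Real.log M / W ^ 7)) :=
        Real.exp_le_exp.mpr (by linarith)
      have h7 : (1 : ℝ) / 3 ≤ Real.exp (-1) := by
        rw [Real.exp_neg, one_div]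
        exact inv_anti₀ (Real.exp_pos _) (by linarith [Real.exp_one_lt_d9])
      linarith
    nlinarith

end ZetaSumFinal

section ZetaRepresentation
open Finset

theorem norm_cpow_neg_sub_le {a x : ℝ} (ha : 1 ≤ a) (hx : x ∈ Set.Icc a (a + 1)) {s : ℂ}
    (hs : 0 < s.re) :
    ‖(x : ℂ) ^ (-s) - (a : ℂ) ^ (-s)‖ ≤ ‖s‖ * a ^ (-s.re - 1) := by
  have hs0 : s ≠ 0 := fun h => by simp [h] at hs
  have key := Convex.norm_image_sub_le_of_norm_hasDerivWithin_le
    (f := fun y : ℝ => (y : ℂ) ^ (-s - 1 + 1) / (-s - 1 + 1))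
    (f' := fun y : ℝ => (y : ℂ) ^ (-s - 1)) (C := a ^ (-s.re - 1))
    (s := Set.Icc a (a + 1)) (x := a) (y := x)
    (fun y hy => (hasDerivAt_ofReal_cpow_const' (by linarith [hy.1])
      (by intro h; apply hs0; linear_combination -h)).hasDerivWithinAt)
    (fun y hy => by
      rw [Complex.norm_cpow_eq_rpow_re_of_pos (by linarith [hy.1])]
      simp only [Complex.sub_re, Complex.neg_re, Complex.one_re]
      exact Real.rpow_le_rpow_of_nonpos (by linarith) hy.1 (by linarith))
    (convex_Icc _ _) (by constructor <;> linarith) hx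
  have e : -s - 1 + 1 = -s := by ring
  simp only [e] at key
  rw [← sub_div, norm_div, norm_neg, div_le_iff₀ (norm_pos_iff.mpr hs0)] at key
  have h2 : ‖x - a‖ ≤ 1 := by
    rw [Real.norm_eq_abs, abs_le]; constructor <;> linarith [hx.1, hx.2]
  have h3 : (0 : ℝ) ≤ a ^ (-s.re - 1) := by positivity
  calc _ ≤ _ := key
    _ ≤ a ^ (-s.re - 1) * 1 * ‖s‖ := by gcongr
    _ = _ := by ring

noncomputable def zetaRem (n : ℕ) (s : ℂ) : ℂ :=
  ((n : ℂ) + 1) ^ (-s) - (((n : ℂ) + 2) ^ (1 - s) - ((n : ℂ) + 1) ^ (1 - s)) / (1 - s)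

theorem norm_zetaRem_le (n : ℕ) {s : ℂ} (hs : 0 < s.re) (h1 : s ≠ 1) :
    ‖zetaRem n s‖ ≤ ‖s‖ * ((n : ℝ) + 1) ^ (-s.re - 1) := by
  set a : ℝ := (n : ℝ) + 1 with ha
  have ha1 : 1 ≤ a := by rw [ha]; linarith [Nat.cast_nonneg (α := ℝ) n]
  have hs1 : 1 - s ≠ 0 := sub_ne_zero.mpr h1.symm
  have key := Convex.norm_image_sub_le_of_norm_hasDerivWithin_le
    (f := fun y : ℝ => (y : ℂ) ^ (-s + 1) / (-s + 1) - y * (a : ℂ) ^ (-s))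
    (f' := fun y : ℝ => (y : ℂ) ^ (-s) - 1 * (a : ℂ) ^ (-s)) (C := ‖s‖ * a ^ (-s.re - 1))
    (s := Set.Icc a (a + 1)) (x := a) (y := a + 1)
    (fun y hy => ((hasDerivAt_ofReal_cpow_const' (by linarith [hy.1])
      (by intro h; apply h1; linear_combination -h)).sub
        ((Complex.ofRealCLM.hasDerivAt (x := y)).mul_const _)).hasDerivWithinAt)
    (fun y hy => by rw [one_mul]; exact norm_cpow_neg_sub_le ha1 hy hs)
    (convex_Icc _ _) (by constructor <;> linarith) (by constructor <;> linarith)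
  have e : -s + 1 = 1 - s := by ring
  have : ‖a + 1 - a‖ = 1 := by simp
  rw [this, mul_one] at key
  convert key using 1
  rw [← norm_neg]
  congr 1
  simp only [zetaRem, e, ha]
  push_cast
  field_simp
  ring_nf

theorem differentiableOn_zetaRem (n : ℕ) : DifferentiableOn ℂ (zetaRem n) {s | s ≠ 1} := by
  intro s hs
  have hs1 : 1 - s ≠ 0 := sub_ne_zero.mpr (Ne.symm hs)
  have h1 : ((n : ℂ) + 1) ≠ 0 := by exact_mod_cast n.succ_ne_zero
  have h2 : ((n : ℂ) + 2) ≠ 0 := by exact_mod_cast (n + 1).succ_ne_zero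
  apply DifferentiableAt.differentiableWithinAt
  unfold zetaRem
  refine DifferentiableAt.sub ?_ (DifferentiableAt.div (DifferentiableAt.sub ?_ ?_) ?_ hs1)
  · exact (differentiableAt_id.neg).const_cpow (Or.inl h1)
  · exact (differentiableAt_id.const_sub 1).const_cpow (Or.inl h2)
  · exact (differentiableAt_id.const_sub 1).const_cpow (Or.inl h1)
  · exact differentiableAt_id.const_sub 1

theorem sum_zetaRem (N : ℕ) (s : ℂ) : ∑ n ∈ range N, zetaRem n s =
    ∑ n ∈ range N, ((n : ℂ) + 1) ^ (-s) - (((N : ℂ) + 1) ^ (1 - s) - 1) / (1 - s) := by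
  induction N with
  | zero => simp
  | succ N ih =>
    rw [sum_range_succ, ih, sum_range_succ, zetaRem]
    push_cast
    ring_nf

theorem summable_rpow_succ {σ : ℝ} (hσ : 0 < σ) :
    Summable fun n : ℕ => ((n : ℝ) + 1) ^ (-σ - 1) := by
  have := (Real.summable_nat_rpow (p := -σ - 1)).mpr (by linarith)
  simpa using (summable_nat_add_iff 1).mpr this

theorem tendsto_cpow_succ_zero {s : ℂ} (hs : 1 < s.re) :
    Filter.Tendsto (fun N : ℕ => ((N : ℂ) + 1) ^ (1 - s)) Filter.atTop (nhds 0) := by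
  rw [tendsto_zero_iff_norm_tendsto_zero]
  have h1 : Filter.Tendsto (fun N : ℕ => ((N : ℝ) + 1) ^ (-(s.re - 1))) Filter.atTop (nhds 0) :=
    (tendsto_rpow_neg_atTop (by linarith)).comp
      (Filter.tendsto_atTop_add_const_right _ _ tendsto_natCast_atTop_atTop)
  refine h1.congr fun N => ?_
  have : ((N : ℂ) + 1) = (((N : ℝ) + 1 : ℝ) : ℂ) := by push_cast; rfl
  rw [this, Complex.norm_cpow_eq_rpow_re_of_pos (by positivity)]
  simp

theorem zeta_eq_of_one_lt_re {s : ℂ} (hs : 1 < s.re) :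
    riemannZeta s = 1 / (s - 1) + ∑' n, zetaRem n s := by
  have h1 : s ≠ 1 := fun h => by simp [h] at hs
  have hsum : Summable fun n => zetaRem n s :=
    Summable.of_norm_bounded ((summable_rpow_succ (by linarith : 0 < s.re)).mul_left ‖s‖)
      fun n => norm_zetaRem_le n (by linarith) h1
  have t1 := hsum.hasSum.tendsto_sum_nat
  have hz : Summable fun n : ℕ => 1 / ((n : ℂ) + 1) ^ s := by
    have := (summable_nat_add_iff 1).mpr (Complex.summable_one_div_nat_cpow.mpr hs)
    simpa using this
  have t2 := hz.hasSum.tendsto_sum_nat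
  rw [← zeta_eq_tsum_one_div_nat_add_one_cpow hs] at t2
  have t3 := t2.sub (((tendsto_cpow_succ_zero hs).sub_const 1).div_const (1 - s))
  have heq : ∀ N : ℕ, ∑ n ∈ range N, 1 / ((n : ℂ) + 1) ^ s - (((N : ℂ) + 1) ^ (1 - s) - 1) / (1 - s)
      = ∑ n ∈ range N, zetaRem n s := by
    intro N
    rw [sum_zetaRem]
    congr 1
    refine sum_congr rfl fun n _ => ?_
    rw [Complex.cpow_neg, one_div]
  have t4 := tendsto_nhds_unique t1 (t3.congr heq)
  rw [t4]
  have : s - 1 ≠ 0 := sub_ne_zero.mpr h1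
  have h2 : 1 - s ≠ 0 := sub_ne_zero.mpr h1.symm
  field_simp
  ring

theorem zeta_eq_of_pos_re {s : ℂ} (hs : 1 / 2 < s.re) (hi : 1 < s.im) :
    riemannZeta s = 1 / (s - 1) + ∑' n, zetaRem n s := by
  set U : Set ℂ := {z | 1 / 2 < z.re} ∩ {z | 1 < z.im} ∩ Metric.ball 0 (‖s‖ + 10) with hU
  have hUo : IsOpen U := ((isOpen_lt continuous_const Complex.continuous_re).inter
    (isOpen_lt continuous_const Complex.continuous_im)).inter Metric.isOpen_ball
  have hUc : Convex ℝ U := ((convex_halfSpace_re_gt _).inter (convex_halfSpace_im_gt _)).inter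
    (convex_ball _ _)
  have hU1 : ∀ z ∈ U, z ≠ 1 := by
    intro z hz h
    have := hz.1.2
    simp [h] at this
    linarith
  have hd1 : DifferentiableOn ℂ riemannZeta U := fun z hz =>
    (differentiableAt_riemannZeta (hU1 z hz)).differentiableWithinAt
  have hd2 : DifferentiableOn ℂ (fun z => 1 / (z - 1) + ∑' n, zetaRem n z) U := by
    refine DifferentiableOn.add ?_ ?_
    · intro z hz
      exact (DifferentiableAt.fun_div (differentiableAt_const (1 : ℂ))
        (DifferentiableAt.sub_const (f := fun z : ℂ => z) differentiableAt_fun_id (1 : ℂ))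
        (sub_ne_zero.mpr (hU1 z hz))).differentiableWithinAt
    · refine Complex.differentiableOn_tsum_of_summable_norm
        (u := fun n : ℕ => (‖s‖ + 10) * ((n : ℝ) + 1) ^ (-(1 / 2 : ℝ) - 1))
        ((summable_rpow_succ (by norm_num)).mul_left _)
        (fun n => (differentiableOn_zetaRem n).mono hU1) hUo ?_
      intro n z hz
      have hz1 : 1 / 2 < z.re := hz.1.1
      have hz2 : ‖z‖ < ‖s‖ + 10 := by simpa using hz.2
      refine (norm_zetaRem_le n (by linarith) (hU1 z hz)).trans ?_
      have : ((n : ℝ) + 1) ^ (-z.re - 1) ≤ ((n : ℝ) + 1) ^ (-(1 / 2 : ℝ) - 1) :=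
        Real.rpow_le_rpow_of_exponent_le (by linarith [Nat.cast_nonneg (α := ℝ) n]) (by linarith)
      gcongr
  have hz0 : s + 3 ∈ U := by
    refine ⟨⟨?_, ?_⟩, ?_⟩
    · simp; linarith
    · simpa using hi
    · rw [mem_ball_zero_iff]
      refine (norm_add_le _ _).trans_lt ?_
      norm_num
  have hev : riemannZeta =ᶠ[nhds (s + 3)] fun z => 1 / (z - 1) + ∑' n, zetaRem n z := by
    have : {z : ℂ | 1 < z.re} ∈ nhds (s + 3) :=
      (isOpen_lt continuous_const Complex.continuous_re).mem_nhds (by simp; linarith)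
    filter_upwards [this] with z hz
    exact zeta_eq_of_one_lt_re hz
  have := (hd1.analyticOnNhd hUo).eqOn_of_preconnected_of_eventuallyEq (hd2.analyticOnNhd hUo)
    hUc.isPreconnected hz0 hev
  exact this ⟨⟨hs, hi⟩, by simp⟩

theorem zeta_eq_sum_add {s : ℂ} (hs : 1 / 2 < s.re) (hi : 1 < s.im) (N : ℕ) :
    riemannZeta s = ∑ n ∈ range N, ((n : ℂ) + 1) ^ (-s) + ((N : ℂ) + 1) ^ (1 - s) / (s - 1)
      + ∑' n, zetaRem (n + N) s := by
  have h1 : s ≠ 1 := fun h => by simp [h] at hi; linarith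
  have hsum : Summable fun n => zetaRem n s :=
    Summable.of_norm_bounded ((summable_rpow_succ (by linarith : 0 < s.re)).mul_left ‖s‖)
      fun n => norm_zetaRem_le n (by linarith) h1
  rw [zeta_eq_of_pos_re hs hi, ← hsum.sum_add_tsum_nat_add N, sum_zetaRem]
  have : s - 1 ≠ 0 := sub_ne_zero.mpr h1
  have h2 : 1 - s ≠ 0 := sub_ne_zero.mpr h1.symm
  field_simp
  ring

end ZetaRepresentation

section ZetaBound
open Finset

theorem norm_sum_antitone_mul_le {w : ℕ → ℝ} (hw : ∀ i, 0 ≤ w i) (hanti : Antitone w)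
    {c : ℕ → ℂ} {B : ℝ} {n : ℕ} (h : ∀ m ≤ n, ‖∑ i ∈ range m, c i‖ ≤ B) :
    ‖∑ i ∈ range n, (w i : ℂ) * c i‖ ≤ w 0 * B := by
  have hid : ∀ m, ∑ i ∈ range m, (w i : ℂ) * c i = w m * ∑ i ∈ range m, c i +
      ∑ i ∈ range m, ((w i - w (i + 1) : ℝ) : ℂ) * ∑ j ∈ range (i + 1), c j := by
    intro m
    induction m with
    | zero => simp
    | succ m ih =>
      rw [sum_range_succ, ih, sum_range_succ (fun i => ((w i - w (i + 1) : ℝ) : ℂ) * _),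
        sum_range_succ c]
      push_cast
      ring
  have htel : ∀ m, ∑ i ∈ range m, (w i - w (i + 1)) = w 0 - w m := fun m => by
    simpa using sum_range_sub' w m
  rw [hid]
  calc _ ≤ ‖(w n : ℂ) * ∑ i ∈ range n, c i‖ +
        ∑ i ∈ range n, ‖((w i - w (i + 1) : ℝ) : ℂ) * ∑ j ∈ range (i + 1), c j‖ :=
        (norm_add_le _ _).trans (by gcongr; exact norm_sum_le _ _)
    _ ≤ w n * B + ∑ i ∈ range n, (w i - w (i + 1)) * B := by
        gcongr with i hi
        · rw [norm_mul, Complex.norm_real, Real.norm_of_nonneg (hw n)]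
          exact mul_le_mul_of_nonneg_left (h n le_rfl) (hw n)
        · have h0 : 0 ≤ w i - w (i + 1) := sub_nonneg.mpr (hanti i.le_succ)
          rw [norm_mul, Complex.norm_real, Real.norm_of_nonneg h0]
          exact mul_le_mul_of_nonneg_left (h _ (mem_range.mp hi)) h0
    _ = _ := by
        rw [← sum_mul, htel]
        ring

theorem natCast_cpow_neg_eq {n : ℕ} (hn : 1 ≤ n) (σ t : ℝ) :
    (n : ℂ) ^ (-((σ : ℂ) + t * Complex.I)) = (((n : ℝ) ^ (-σ) : ℝ) : ℂ) * phase t n := by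
  have hn0 : (n : ℂ) ≠ 0 := by exact_mod_cast (by omega : n ≠ 0)
  have hn1 : (0 : ℝ) < n := by exact_mod_cast hn
  rw [Complex.cpow_def_of_ne_zero hn0, phase, Real.rpow_def_of_pos hn1, Complex.ofReal_exp,
    ← Complex.exp_add, ← Complex.natCast_log]
  congr 1
  push_cast
  ring

theorem norm_dyadic_block_le {W : ℝ} (hW : 10 ^ 9 ≤ W) {σ : ℝ} (h1 : 1 - 1 / W ^ 7 ≤ σ)
    (M : ℕ) (hM : 1 ≤ M) (h2 : Real.log M ≤ 3 / 2 * W ^ 8) :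
    ‖∑ n ∈ Ico M (2 * M), (n : ℂ) ^ (-((σ : ℂ) + (Real.exp (W ^ 8) : ℝ) * Complex.I))‖ ≤ 3 := by
  have hW0 : 0 < W := by linarith
  have hM0 : (0 : ℝ) < M := by exact_mod_cast hM
  have hlog : 0 ≤ Real.log M := Real.log_nonneg (by exact_mod_cast hM)
  have hW1 : 1 / W ^ 7 ≤ 1 := by
    rw [div_le_one (by positivity)]
    exact one_le_pow₀ (by linarith)
  have hs0 : 0 ≤ σ := by linarith
  rw [sum_Ico_eq_sum_range]
  have hmul : 2 * M - M = M := by omega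
  rw [hmul, sum_congr rfl fun i _ => natCast_cpow_neg_eq (n := M + i) (by omega) σ _]
  have := norm_sum_antitone_mul_le (w := fun i => ((M + i : ℕ) : ℝ) ^ (-σ))
    (c := fun i => phase (Real.exp (W ^ 8)) ((M + i : ℕ) : ℝ)) (n := M)
    (B := 3 * (M * Real.exp (-(Real.log M / W ^ 7)))) (fun i => by positivity)
    (fun i j hij => Real.rpow_le_rpow_of_nonpos (by positivity) (by exact_mod_cast by omega)
      (by linarith))
    (fun m hm => by
      have := zeta_sum_le hW (M := M) (M' := M + m) hM (by omega) (by omega) h2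
      rwa [sum_Ico_eq_sum_range, Nat.add_sub_cancel_left] at this)
  refine this.trans ?_
  have e : ((M + 0 : ℕ) : ℝ) ^ (-σ) * (3 * (M * Real.exp (-(Real.log M / W ^ 7)))) =
      3 * Real.exp (Real.log M * (1 - 1 / W ^ 7 - σ)) := by
    have : Real.exp (Real.log M * (1 - 1 / W ^ 7 - σ)) =
        Real.exp (Real.log M) * Real.exp (Real.log M * -σ) * Real.exp (-(Real.log M / W ^ 7)) := by
      rw [← Real.exp_add, ← Real.exp_add]
      congr 1
      ring
    rw [this, Real.exp_log hM0, Real.rpow_def_of_pos (by simpa using hM0)]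
    simp only [add_zero]
    ring
  rw [e]
  have : Real.exp (Real.log M * (1 - 1 / W ^ 7 - σ)) ≤ 1 := by
    rw [Real.exp_le_one_iff]
    exact mul_nonpos_of_nonneg_of_nonpos hlog (by linarith)
  linarith

theorem sum_Ico_one_two_pow {f : ℕ → ℂ} (J : ℕ) :
    ∑ n ∈ Ico 1 (2 ^ J), f n = ∑ j ∈ range J, ∑ n ∈ Ico (2 ^ j) (2 * 2 ^ j), f n := by
  induction J with
  | zero => simp
  | succ J ih =>
    rw [sum_range_succ, ← ih, sum_Ico_consecutive _ Nat.one_le_two_pow (by omega), pow_succ']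

theorem norm_tail_zetaRem_le {s : ℂ} (hs : 9 / 10 ≤ s.re) (h1 : s ≠ 1) (N : ℕ) :
    ‖∑' n, zetaRem (n + N) s‖ ≤
      (∑' n : ℕ, ((n : ℝ) + 1) ^ (-(1 / 10 : ℝ) - 1)) * (‖s‖ * ((N : ℝ) + 1) ^ (-(8 / 10 : ℝ))) := by
  have hsum := summable_rpow_succ (σ := 1 / 10) (by norm_num)
  rw [← tsum_mul_right]
  refine tsum_of_norm_bounded (hsum.mul_right _).hasSum fun n => ?_
  refine (norm_zetaRem_le _ (by linarith) h1).trans ?_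
  push_cast
  have a0 : (0 : ℝ) ≤ n := Nat.cast_nonneg n
  have b0 : (0 : ℝ) ≤ N := Nat.cast_nonneg N
  have h2 : ((n : ℝ) + N + 1) ^ (-s.re - 1) ≤
      ((n : ℝ) + 1) ^ (-(1 / 10 : ℝ) - 1) * ((N : ℝ) + 1) ^ (-(8 / 10 : ℝ)) := by
    calc _ ≤ ((n : ℝ) + N + 1) ^ ((-(1 / 10 : ℝ) - 1) + (-(8 / 10 : ℝ))) :=
          Real.rpow_le_rpow_of_exponent_le (by linarith) (by linarith)
      _ = ((n : ℝ) + N + 1) ^ (-(1 / 10 : ℝ) - 1) * ((n : ℝ) + N + 1) ^ (-(8 / 10 : ℝ)) :=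
          Real.rpow_add (by positivity) _ _
      _ ≤ _ := by
          gcongr ?_ * ?_
          · exact Real.rpow_le_rpow_of_nonpos (by positivity) (by linarith) (by norm_num)
          · exact Real.rpow_le_rpow_of_nonpos (by positivity) (by linarith) (by norm_num)
  calc _ ≤ ‖s‖ * (((n : ℝ) + 1) ^ (-(1 / 10 : ℝ) - 1) * ((N : ℝ) + 1) ^ (-(8 / 10 : ℝ))) := by
        gcongr
    _ = _ := by ring

theorem exists_norm_zeta_le : ∃ C : ℝ, 1 ≤ C ∧ ∀ W σ : ℝ, 10 ^ 9 ≤ W → 1 - 1 / W ^ 7 ≤ σ → σ ≤ 3 →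
    ‖riemannZeta ((σ : ℂ) + (Real.exp (W ^ 8) : ℝ) * Complex.I)‖ ≤ C * W ^ 8 := by
  set S := ∑' n : ℕ, ((n : ℝ) + 1) ^ (-(1 / 10 : ℝ) - 1) with hS
  have hS0 : 0 ≤ S := tsum_nonneg fun n => by positivity
  refine ⟨8 + 8 * S, by linarith, fun W σ hW h1 h2 => ?_⟩
  have hW0 : 0 < W := by linarith
  have hW8 : 1 ≤ W ^ 8 := one_le_pow₀ (by linarith)
  have hWW : W ≤ W ^ 8 := le_self_pow₀ (by linarith) (by norm_num)
  have hW7 : 1 / W ^ 7 ≤ 1 / 10 := by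
    rw [div_le_div_iff₀ (by positivity) (by norm_num)]
    have : W ≤ W ^ 7 := le_self_pow₀ (by linarith) (by norm_num)
    linarith
  set t := Real.exp (W ^ 8) with ht
  have ht3 : 3 ≤ t := by
    have := Real.add_one_le_exp (W ^ 8)
    linarith
  set s : ℂ := (σ : ℂ) + (t : ℝ) * Complex.I with hs
  have hre : s.re = σ := by simp [hs]
  have him : s.im = t := by simp [hs]
  have hs1 : s ≠ 1 := fun h => by
    have := congrArg Complex.im h
    rw [him] at this
    simp at this
    linarith
  have hl2 : 0 < Real.log 2 := Real.log_pos (by norm_num)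
  set J := ⌊29 / 20 * W ^ 8 / Real.log 2⌋₊ with hJ
  have hJ1 : J * Real.log 2 ≤ 29 / 20 * W ^ 8 := by
    rw [← le_div_iff₀ hl2]
    exact Nat.floor_le (by positivity)
  have hJ2 : 29 / 20 * W ^ 8 ≤ (J + 1) * Real.log 2 := by
    rw [← div_le_iff₀ hl2]
    exact (Nat.lt_floor_add_one _).le
  have hJpos : 1 ≤ 2 ^ J := Nat.one_le_two_pow
  have hNcast : (((2 ^ J - 1 : ℕ) : ℝ) + 1) = 2 ^ J := by
    rw [Nat.cast_sub hJpos]; push_cast; ring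
  have hNcastC : (((2 ^ J - 1 : ℕ) : ℂ) + 1) = ((2 ^ J : ℝ) : ℂ) := by
    rw [← hNcast]; push_cast; rfl
  have h2J : (2 : ℝ) ^ J = Real.exp (J * Real.log 2) := by
    rw [mul_comm, Real.exp_mul, Real.exp_log (by norm_num), Real.rpow_natCast]
  rw [zeta_eq_sum_add (s := s) (by rw [hre]; linarith) (by rw [him]; linarith) (2 ^ J - 1)]
  have hpart1 : ‖∑ n ∈ range (2 ^ J - 1), ((n : ℂ) + 1) ^ (-s)‖ ≤ 7 * W ^ 8 := by
    have e : ∑ n ∈ range (2 ^ J - 1), ((n : ℂ) + 1) ^ (-s) =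
        ∑ n ∈ Ico 1 (2 ^ J), ((n : ℕ) : ℂ) ^ (-s) := by
      rw [sum_Ico_eq_sum_range]
      refine sum_congr rfl fun n _ => ?_
      push_cast
      rw [add_comm]
    rw [e, sum_Ico_one_two_pow]
    calc _ ≤ ∑ j ∈ range J, (3 : ℝ) := by
          refine (norm_sum_le _ _).trans (sum_le_sum fun j hj => ?_)
          refine norm_dyadic_block_le hW h1 (2 ^ j) Nat.one_le_two_pow ?_
          have : (j : ℝ) ≤ J := by exact_mod_cast (mem_range.mp hj).le
          push_cast
          rw [Real.log_pow]
          nlinarith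
      _ = 3 * J := by simp [mul_comm]
      _ ≤ _ := by
          have := Real.log_two_gt_d9
          have hJ0 : (0 : ℝ) ≤ J := Nat.cast_nonneg J
          nlinarith
  have hpart2 : ‖(((2 ^ J - 1 : ℕ) : ℂ) + 1) ^ (1 - s) / (s - 1)‖ ≤ 1 := by
    have ht2 : t ≤ ‖s - 1‖ := by
      have := Complex.abs_im_le_norm (s - 1)
      simp only [Complex.sub_im, him, Complex.one_im, sub_zero] at this
      exact (le_abs_self t).trans this
    rw [norm_div, div_le_one (by linarith), hNcastC,
      Complex.norm_cpow_eq_rpow_re_of_pos (by positivity)]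
    refine le_trans ?_ ht2
    rw [Complex.sub_re, Complex.one_re, hre, h2J, ← Real.exp_mul, ht]
    refine Real.exp_le_exp.mpr ?_
    have hJ0 : (0 : ℝ) ≤ J * Real.log 2 := by positivity
    rcases le_total (1 - σ) 0 with h | h
    · nlinarith
    · have : 1 - σ ≤ 1 / 10 := by linarith
      nlinarith
  have hpart3 : ‖∑' n, zetaRem (n + (2 ^ J - 1)) s‖ ≤ S * 8 := by
    refine (norm_tail_zetaRem_le (by rw [hre]; linarith) hs1 _).trans ?_
    refine mul_le_mul_of_nonneg_left ?_ hS0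
    have hsn : ‖s‖ ≤ 2 * t := by
      refine (norm_add_le _ _).trans ?_
      rw [norm_mul, Complex.norm_I, Complex.norm_real, Complex.norm_real, mul_one,
        Real.norm_of_nonneg (by linarith), Real.norm_of_nonneg (by linarith)]
      linarith
    have h5 : (((2 ^ J - 1 : ℕ) : ℝ) + 1) ^ (-(8 / 10 : ℝ)) ≤ 2 / t := by
      rw [hNcast, h2J, ← Real.exp_mul, ht, div_eq_mul_inv (2 : ℝ), ← Real.exp_neg]
      calc _ ≤ Real.exp (Real.log 2 + -W ^ 8) := Real.exp_le_exp.mpr (by nlinarith)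
        _ = _ := by rw [Real.exp_add, Real.exp_log (by norm_num)]
    calc _ ≤ 2 * t * (2 / t) := by gcongr
      _ ≤ 8 := by
        field_simp
        norm_num
  calc _ ≤ 7 * W ^ 8 + 1 + S * 8 :=
        (norm_add_le _ _).trans (add_le_add ((norm_add_le _ _).trans
          (add_le_add hpart1 hpart2)) hpart3)
    _ ≤ _ := by nlinarith

end ZetaBound

section LocalZeroLemma
open Metric

theorem exists_eq_mul_exp {f : ℂ → ℂ} {r : ℝ} (hr : 0 < r) (hf : DifferentiableOn ℂ f (ball 0 r))
    (h0 : ∀ z ∈ ball (0 : ℂ) r, f z ≠ 0) : ∃ h : ℂ → ℂ, DifferentiableOn ℂ h (ball 0 r) ∧ h 0 = 0 ∧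
      (∀ z ∈ ball (0 : ℂ) r, f z = f 0 * Complex.exp (h z)) ∧ deriv h 0 = logDeriv f 0 := by
  have hd : DifferentiableOn ℂ (deriv f) (ball 0 r) := hf.deriv isOpen_ball
  obtain ⟨g, hg⟩ := (hd.div hf h0).isExactOn_ball
  have h0r : (0 : ℂ) ∈ ball (0 : ℂ) r := mem_ball_self hr
  have hconst : ∀ z ∈ ball (0 : ℂ) r, f z * Complex.exp (-g z) = f 0 * Complex.exp (-g 0) := by
    intro z hz
    have hder : ∀ w ∈ ball (0 : ℂ) r,
        HasDerivAt (fun w => f w * Complex.exp (-g w)) 0 w := by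
      intro w hw
      have h1 := (hf.differentiableAt (isOpen_ball.mem_nhds hw)).hasDerivAt
      have h2 := (hg w hw).neg.cexp
      have := h1.mul h2
      have h3 := h0 w hw
      refine this.congr_deriv ?_
      simp only [Pi.div_apply, Pi.neg_apply]
      field_simp
      ring
    have hc := (convex_ball (0 : ℂ) r).is_const_of_fderivWithin_eq_zero (𝕜 := ℂ)
      (f := fun w => f w * Complex.exp (-g w))
      (fun w hw => (hder w hw).differentiableAt.differentiableWithinAt)
      (fun w hw => by
        rw [fderivWithin_of_isOpen isOpen_ball hw]
        ext
        simp [(hder w hw).deriv]) hz h0r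
    exact hc
  refine ⟨fun z => g z - g 0, fun z hz => ((hg z hz).differentiableAt.sub_const _).differentiableWithinAt,
    by simp, fun z hz => ?_, ?_⟩
  · have := hconst z hz
    calc f z = (f z * Complex.exp (-g z)) * Complex.exp (g z) := by
          rw [mul_assoc, ← Complex.exp_add]; simp
      _ = _ := by rw [this, mul_assoc, ← Complex.exp_add]; ring_nf
  · rw [((hg 0 h0r).sub_const (g 0)).deriv]
    rfl

theorem re_le_of_norm_le {a b h : ℂ} {M : ℝ} (ha : a ≠ 0) (hb : b = a * Complex.exp h)
    (hn : ‖b‖ ≤ Real.exp M * ‖a‖) : h.re ≤ M := by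
  rw [hb, norm_mul, Complex.norm_exp, mul_comm] at hn
  exact Real.exp_le_exp.mp (le_of_mul_le_mul_right hn (norm_pos_iff.mpr ha))

theorem norm_logDeriv_le_of_ne_zero {f : ℂ → ℂ} {r M : ℝ} (hr : 0 < r) (hM : 0 < M)
    (hf : DifferentiableOn ℂ f (ball 0 r)) (h0 : ∀ z ∈ ball (0 : ℂ) r, f z ≠ 0)
    (hb : ∀ z ∈ ball (0 : ℂ) r, ‖f z‖ ≤ Real.exp M * ‖f 0‖) : ‖logDeriv f 0‖ ≤ 4 * M / r := by
  obtain ⟨h, hd, hh0, he, hlog⟩ := exists_eq_mul_exp hr hf h0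
  have h0r : (0 : ℂ) ∈ ball (0 : ℂ) r := mem_ball_self hr
  rw [← hlog]
  have := Complex.norm_deriv_le_of_forall_mem_sphere_norm_le (c := 0) (R := r / 2) (C := 2 * M)
    (f := h) (by linarith) ?_ ?_
  · calc _ ≤ _ := this
      _ = _ := by field_simp; ring
  · refine DifferentiableOn.diffContOnCl (hd.mono ?_)
    rw [closure_ball _ (by linarith)]
    exact closedBall_subset_ball (by linarith)
  · intro z hz
    have hz' : ‖z‖ = r / 2 := by simpa using hz
    have := Complex.borelCaratheodory_zero hM hd
      (fun z hz => re_le_of_norm_le (h0 0 h0r) (he z hz) (hb z hz)) hr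
      (z := z) (by rw [mem_ball_zero_iff, hz']; linarith) hh0
    refine this.trans (le_of_eq ?_)
    rw [hz']
    field_simp
    ring

theorem norm_ge_of_ne_zero {f : ℂ → ℂ} {r M : ℝ} (hr : 0 < r) (hM : 0 < M)
    (hf : DifferentiableOn ℂ f (ball 0 r)) (h0 : ∀ z ∈ ball (0 : ℂ) r, f z ≠ 0)
    (hb : ∀ z ∈ ball (0 : ℂ) r, ‖f z‖ ≤ Real.exp M * ‖f 0‖) {z : ℂ} (hz : ‖z‖ ≤ 3 / 4 * r) :
    Real.exp (-(6 * M)) * ‖f 0‖ ≤ ‖f z‖ := by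
  obtain ⟨h, hd, hh0, he, -⟩ := exists_eq_mul_exp hr hf h0
  have h0r : (0 : ℂ) ∈ ball (0 : ℂ) r := mem_ball_self hr
  have hzr : z ∈ ball (0 : ℂ) r := by rw [mem_ball_zero_iff]; linarith
  have := Complex.borelCaratheodory_zero hM hd
      (fun z hz => re_le_of_norm_le (h0 0 h0r) (he z hz) (hb z hz)) hr hzr hh0
  have h6 : ‖h z‖ ≤ 6 * M := by
    refine this.trans ?_
    rw [div_le_iff₀ (by linarith)]
    nlinarith
  rw [he z hzr, norm_mul, Complex.norm_exp, mul_comm]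
  refine mul_le_mul_of_nonneg_left (Real.exp_le_exp.mpr ?_) (norm_nonneg _)
  have := (abs_le.mp (Complex.abs_re_le_norm (h z))).1
  linarith

/-- Dividing out a zero by a Blaschke factor. -/
theorem exists_remove_zero {f : ℂ → ℂ} {R R' B : ℝ} (hR : 0 < R) (hRR : R < R')
    (hf : DifferentiableOn ℂ f (ball 0 R')) (hB : ∀ z ∈ closedBall (0 : ℂ) R, ‖f z‖ ≤ B)
    {ρ : ℂ} (hρ : ‖ρ‖ ≤ R / 2) (hρ0 : f ρ = 0) (hf0 : f 0 ≠ 0) :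
    ∃ G : ℂ → ℂ, DifferentiableOn ℂ G (ball 0 R') ∧ (∀ z ∈ closedBall (0 : ℂ) R, ‖G z‖ ≤ B) ∧
      2 * ‖f 0‖ ≤ ‖G 0‖ ∧ (∀ z ∈ closedBall (0 : ℂ) R, G z = 0 → f z = 0) ∧
      logDeriv f 0 = logDeriv G 0 - 1 / ρ + (starRingEnd ℂ ρ) / R ^ 2 := by
  have hρne : ρ ≠ 0 := fun h => hf0 (h ▸ hρ0)
  have hρR' : ρ ∈ ball (0 : ℂ) R' := by rw [mem_ball_zero_iff]; linarith
  have h0R' : (0 : ℂ) ∈ ball (0 : ℂ) R' := mem_ball_self (by linarith)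
  have hRC : (R : ℂ) ≠ 0 := by exact_mod_cast hR.ne'
  set f1 := dslope f ρ with hf1
  have hd1 : DifferentiableOn ℂ f1 (ball 0 R') :=
    (Complex.differentiableOn_dslope (isOpen_ball.mem_nhds hρR')).mpr hf
  have hfac : ∀ z, f z = (z - ρ) * f1 z := fun z => by
    have := sub_smul_dslope f ρ z
    rw [hρ0, sub_zero, smul_eq_mul] at this
    exact this.symm
  set b : ℂ → ℂ := fun z => (R ^ 2 - (starRingEnd ℂ ρ) * z) / R with hb
  have hbd : Differentiable ℂ b := by
    intro z
    simp only [hb]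
    fun_prop
  have hb0 : b 0 = R := by
    simp only [hb]
    field_simp
    simp
  have hbder : deriv b 0 = -(starRingEnd ℂ ρ) / R := by
    have h : HasDerivAt b ((-((starRingEnd ℂ ρ) * 1)) / R) 0 :=
      (((hasDerivAt_id (0 : ℂ)).const_mul _).const_sub _).div_const _
    rw [h.deriv, mul_one]
  have hf10 : f1 0 ≠ 0 := fun h => hf0 (by rw [hfac, h, mul_zero])
  have hbne : ∀ z ∈ closedBall (0 : ℂ) R, b z ≠ 0 := by
    intro z hz h
    simp only [hb, div_eq_zero_iff, hRC, or_false, sub_eq_zero] at h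
    have h2 := congrArg norm h
    rw [norm_mul, norm_pow, Complex.norm_real, Real.norm_of_nonneg hR.le, RCLike.norm_conj] at h2
    have hz' : ‖z‖ ≤ R := by simpa using hz
    nlinarith [norm_nonneg z, norm_nonneg ρ]
  have hGd : DifferentiableOn ℂ (fun z => f1 z * b z) (ball 0 R') :=
    hd1.mul hbd.differentiableOn
  refine ⟨fun z => f1 z * b z, hGd, ?_, ?_, ?_, ?_⟩
  · have hsph : ∀ z ∈ frontier (ball (0 : ℂ) R), ‖f1 z * b z‖ ≤ B := by
      intro z hz
      rw [frontier_ball _ hR.ne'] at hz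
      have hzn : ‖z‖ = R := by simpa using hz
      have hn : ‖b z‖ = ‖z - ρ‖ := by
        have h1 := Complex.norm_canonicalFactor_eval_circle_eq_one (w := ρ) (R := R)
          (by rw [mem_ball_zero_iff]; linarith) hz
        have hzρ : z - ρ ≠ 0 := by
          intro h
          rw [sub_eq_zero] at h
          rw [← h, hzn] at hρ
          linarith
        rw [Complex.canonicalFactor_apply] at h1
        have e : b z = (R ^ 2 - (starRingEnd ℂ ρ) * z) / (R * (z - ρ)) * (z - ρ) := by
          simp only [hb]
          field_simp
        rw [e, norm_mul, h1, one_mul]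
      rw [norm_mul, hn, mul_comm, ← norm_mul, ← hfac]
      exact hB z (by simp [hzn])
    intro z hz
    refine Complex.norm_le_of_forall_mem_frontier_norm_le (isBounded_ball (x := (0 : ℂ)) (r := R)) ?_ hsph ?_
    · refine DifferentiableOn.diffContOnCl (hGd.mono ?_)
      rw [closure_ball _ hR.ne']
      exact closedBall_subset_ball hRR
    · rwa [closure_ball _ hR.ne']
  · have h1 : ‖f 0‖ = ‖ρ‖ * ‖f1 0‖ := by rw [hfac 0, norm_mul, zero_sub, norm_neg]
    simp only [norm_mul, hb0, Complex.norm_real, Real.norm_of_nonneg hR.le, h1]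
    nlinarith [norm_nonneg (f1 0)]
  · intro z hz h
    rw [hfac]
    rcases mul_eq_zero.mp h with h | h
    · rw [h, mul_zero]
    · exact absurd h (hbne z hz)
  · have e1 : logDeriv f 0 = logDeriv (fun z => z - ρ) 0 + logDeriv f1 0 := by
      have : f = fun z => (z - ρ) * f1 z := funext hfac
      rw [this]
      exact logDeriv_mul 0 (by simpa using hρne) hf10 (by fun_prop)
        (hd1.differentiableAt (isOpen_ball.mem_nhds h0R'))
    have e2 : logDeriv (fun z => f1 z * b z) 0 = logDeriv f1 0 + logDeriv b 0 :=
      logDeriv_mul 0 hf10 (by rw [hb0]; exact hRC)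
        (hd1.differentiableAt (isOpen_ball.mem_nhds h0R')) hbd.differentiableAt
    have e3 : logDeriv (fun z => z - ρ) 0 = -1 / ρ := by
      rw [logDeriv_apply]
      simp
      ring
    have e4 : logDeriv b 0 = -(starRingEnd ℂ ρ) / R ^ 2 := by
      rw [logDeriv_apply, hbder, hb0]
      field_simp
    rw [e1, e2, e3, e4]
    ring

theorem re_one_div_sub_nonpos {ρ : ℂ} {R : ℝ} (hρ : ‖ρ‖ ≤ R) (hre : ρ.re ≤ 0) :
    (1 / ρ - (starRingEnd ℂ ρ) / R ^ 2).re ≤ 0 := by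
  by_cases h0 : ρ = 0
  · simp [h0]
  have hn : 0 < ‖ρ‖ := norm_pos_iff.mpr h0
  have e : (1 / ρ - (starRingEnd ℂ ρ) / R ^ 2).re = ρ.re * (1 / ‖ρ‖ ^ 2 - 1 / R ^ 2) := by
    have h2 : ((starRingEnd ℂ ρ) / (R : ℂ) ^ 2).re = ρ.re / R ^ 2 := by
      rw [← Complex.ofReal_pow, Complex.div_ofReal_re, Complex.conj_re]
    rw [Complex.sub_re, h2, one_div, Complex.inv_re, Complex.normSq_eq_norm_sq]
    ring
  rw [e]
  refine mul_nonpos_of_nonpos_of_nonneg hre ?_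
  rw [sub_nonneg]
  gcongr

theorem neg_re_logDeriv_le {R R' M B : ℝ} (hR : 0 < R) (hRR : R < R') (hM : 0 < M) (n : ℕ) :
    ∀ f : ℂ → ℂ, DifferentiableOn ℂ f (ball 0 R') → f 0 ≠ 0 →
    (∀ z ∈ closedBall (0 : ℂ) R, ‖f z‖ ≤ B) → B ≤ Real.exp M * ‖f 0‖ → B < 2 ^ n * ‖f 0‖ →
    (∀ z ∈ closedBall (0 : ℂ) R, f z = 0 → z.re ≤ 0) → -(logDeriv f 0).re ≤ 8 * M / R := by
  induction n with
  | zero =>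
    intro f hf hf0 hB h1 h2 hz
    have := hB 0 (by simp [hR.le])
    simp at h2
    linarith
  | succ n ih =>
    intro f hf hf0 hB h1 h2 hz
    by_cases hzero : ∃ ρ : ℂ, ‖ρ‖ ≤ R / 2 ∧ f ρ = 0
    · obtain ⟨ρ, hρ, hρ0⟩ := hzero
      obtain ⟨G, hGd, hGB, hG0, hGz, hlog⟩ := exists_remove_zero hR hRR hf hB hρ hρ0 hf0
      have hf0' : 0 < ‖f 0‖ := norm_pos_iff.mpr hf0
      have hG1 := ih G hGd (norm_pos_iff.mp (by linarith)) hGB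
        (h1.trans (by gcongr; linarith))
        (h2.trans_le (by rw [pow_succ]; nlinarith [pow_pos (two_pos : (0 : ℝ) < 2) n]))
        (fun z hz' h => hz z hz' (hGz z hz' h))
      have hre := re_one_div_sub_nonpos (by linarith : ‖ρ‖ ≤ R)
        (hz ρ (by rw [mem_closedBall_zero_iff]; linarith) hρ0)
      rw [hlog]
      simp only [Complex.sub_re, Complex.add_re] at hre ⊢
      linarith
    · push Not at hzero
      have := norm_logDeriv_le_of_ne_zero (f := f) (r := R / 2) (M := M) (by linarith) hM
        (hf.mono (ball_subset_ball (by linarith)))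
        (fun z hz => hzero z (by simpa using (mem_ball_zero_iff.mp hz).le))
        (fun z hz => (hB z (by
          rw [mem_closedBall_zero_iff]; linarith [mem_ball_zero_iff.mp hz])).trans h1)
      have h3 := (abs_le.mp (Complex.abs_re_le_norm (logDeriv f 0))).1
      have e : 4 * M / (R / 2) = 8 * M / R := by field_simp; ring
      linarith

theorem neg_re_logDeriv_le' {R R' M : ℝ} (hR : 0 < R) (hRR : R < R') (hM : 0 < M) {f : ℂ → ℂ}
    (hf : DifferentiableOn ℂ f (ball 0 R')) (hf0 : f 0 ≠ 0)
    (hB : ∀ z ∈ closedBall (0 : ℂ) R, ‖f z‖ ≤ Real.exp M * ‖f 0‖)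
    (hz : ∀ z ∈ closedBall (0 : ℂ) R, f z = 0 → z.re ≤ 0) : -(logDeriv f 0).re ≤ 8 * M / R := by
  obtain ⟨n, hn⟩ := pow_unbounded_of_one_lt (Real.exp M) (one_lt_two : (1 : ℝ) < 2)
  have hf0' : 0 < ‖f 0‖ := norm_pos_iff.mpr hf0
  exact neg_re_logDeriv_le hR hRR hM n f hf hf0 hB le_rfl (by gcongr) hz

theorem neg_re_logDeriv_le_of_zero {R R' M δ : ℝ} (hR : 0 < R) (hRR : R < R') (hM : 0 < M)
    {f : ℂ → ℂ} (hf : DifferentiableOn ℂ f (ball 0 R')) (hf0 : f 0 ≠ 0)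
    (hB : ∀ z ∈ closedBall (0 : ℂ) R, ‖f z‖ ≤ Real.exp M * ‖f 0‖)
    (hz : ∀ z ∈ closedBall (0 : ℂ) R, f z = 0 → z.re ≤ 0) (hδ0 : 0 < δ) (hδ : δ ≤ R / 2)
    (hfδ : f (-(δ : ℂ)) = 0) : -(logDeriv f 0).re ≤ 8 * M / R - 1 / δ + δ / R ^ 2 := by
  have hnδ : ‖(-(δ : ℂ))‖ = δ := by rw [norm_neg, Complex.norm_real, Real.norm_of_nonneg hδ0.le]
  obtain ⟨G, hGd, hGB, hG0, hGz, hlog⟩ := exists_remove_zero hR hRR hf hB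
    (ρ := -(δ : ℂ)) (by rw [hnδ]; exact hδ) hfδ hf0
  have hf0' : 0 < ‖f 0‖ := norm_pos_iff.mpr hf0
  have hG1 := neg_re_logDeriv_le' hR hRR hM hGd (norm_pos_iff.mp (by linarith))
    (fun z hz => (hGB z hz).trans (by gcongr; linarith)) (fun z hz' h => hz z hz' (hGz z hz' h))
  have e : (logDeriv f 0).re = (logDeriv G 0).re + 1 / δ - δ / R ^ 2 := by
    rw [hlog]
    have : logDeriv G 0 - 1 / (-(δ : ℂ)) + (starRingEnd ℂ (-(δ : ℂ))) / (R : ℂ) ^ 2 =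
        logDeriv G 0 + ((1 / δ - δ / R ^ 2 : ℝ) : ℂ) := by
      rw [map_neg, Complex.conj_ofReal]
      push_cast
      rw [div_neg]
      ring
    rw [this, Complex.add_re, Complex.ofReal_re]
    ring
  linarith

end LocalZeroLemma

section ZetaNearOneLine
open ArithmeticFunction

theorem three_four_one_re_nonneg {z : ℂ} (hz : ‖z‖ = 1) : 0 ≤ (3 + 4 * z + z ^ 2).re := by
  have h : z.re ^ 2 + z.im ^ 2 = 1 := by
    have := Complex.normSq_apply z
    rw [Complex.normSq_eq_norm_sq, hz] at this
    nlinarith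
  have e : (3 + 4 * z + z ^ 2).re = 2 * (1 + z.re) ^ 2 := by
    simp [pow_two]
    nlinarith
  rw [e]
  positivity

theorem neg_logDeriv_zeta_three_four_one {σ : ℝ} (hσ : 1 < σ) (y : ℝ) :
    0 ≤ 3 * (-(logDeriv riemannZeta σ).re) +
      4 * (-(logDeriv riemannZeta ((σ : ℂ) + y * Complex.I)).re) +
      -(logDeriv riemannZeta ((σ : ℂ) + (2 * y : ℝ) * Complex.I)).re := by
  have key : ∀ x : ℝ, HasSum (fun n => (LSeries.term (fun n => (Λ n : ℂ)) ((σ : ℂ) + x * Complex.I) n).re)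
      (-(logDeriv riemannZeta ((σ : ℂ) + x * Complex.I)).re) := by
    intro x
    have hre : 1 < ((σ : ℂ) + x * Complex.I).re := by simpa using hσ
    have h1 := (LSeriesSummable_vonMangoldt hre).hasSum
    have h2 := LSeries_vonMangoldt_eq_deriv_riemannZeta_div hre
    rw [LSeries] at h2
    rw [h2, neg_div] at h1
    have := Complex.hasSum_re h1
    simpa [logDeriv_apply] using this
  have k0 := key 0
  have e0 : (σ : ℂ) + (0 : ℝ) * Complex.I = σ := by simp
  rw [e0] at k0
  have hs := ((k0.mul_left 3).add ((key y).mul_left 4)).add (key (2 * y))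
  refine hs.nonneg fun n => ?_
  rcases Nat.eq_zero_or_pos n with rfl | hn
  · simp
  have hterm : ∀ x : ℝ, LSeries.term (fun n => (Λ n : ℂ)) ((σ : ℂ) + x * Complex.I) n =
      ((Λ n * (n : ℝ) ^ (-σ) : ℝ) : ℂ) * phase x n := by
    intro x
    rw [LSeries.term_of_ne_zero (by omega), div_eq_mul_inv, ← Complex.cpow_neg,
      natCast_cpow_neg_eq hn]
    push_cast
    ring
  have hterm0 := hterm 0
  rw [e0] at hterm0
  have hp0 : phase 0 n = 1 := by simp [phase]
  have hp2 : phase (2 * y) n = phase y n ^ 2 := by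
    rw [phase, phase, ← Complex.exp_nat_mul]
    congr 1
    push_cast
    ring
  rw [hterm, hterm, hterm0, hp0, hp2, Complex.re_ofReal_mul, Complex.re_ofReal_mul,
    Complex.re_ofReal_mul]
  have h3 := three_four_one_re_nonneg (norm_phase y n)
  have h4 : 0 ≤ Λ n * (n : ℝ) ^ (-σ) := mul_nonneg vonMangoldt_nonneg (by positivity)
  have e : 3 * (Λ n * (n : ℝ) ^ (-σ) * (1 : ℂ).re) + 4 * (Λ n * (n : ℝ) ^ (-σ) * (phase y n).re) +
      Λ n * (n : ℝ) ^ (-σ) * (phase y n ^ 2).re =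
      Λ n * (n : ℝ) ^ (-σ) * (3 + 4 * phase y n + phase y n ^ 2).re := by
    simp only [Complex.add_re, Complex.mul_re, Complex.one_re]
    simp
    ring
  rw [e]
  exact mul_nonneg h4 h3

theorem exists_neg_logDeriv_zeta_le :
    ∃ C δ₁ : ℝ, 0 < δ₁ ∧ ∀ δ : ℝ, 0 < δ → δ < δ₁ →
      -(logDeriv riemannZeta ((1 + δ : ℝ) : ℂ)).re ≤ 1 / δ + C := by
  set F : ℂ → ℂ := Function.update (fun s => (s - 1) * riemannZeta s) 1 1 with hF
  have hFne : ∀ s ≠ 1, F s = (s - 1) * riemannZeta s := fun s hs => by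
    rw [hF, Function.update_of_ne hs]
  have hF1 : F 1 = 1 := by simp [hF]
  have hpunc : ∀ s ≠ 1, F =ᶠ[nhds s] fun z => (z - 1) * riemannZeta z := fun s hs =>
    (isOpen_ne.eventually_mem hs).mono fun z hz => hFne z hz
  have han : AnalyticAt ℂ F 1 := by
    refine Complex.analyticAt_of_differentiable_on_punctured_nhds_of_continuousAt ?_ ?_
    · filter_upwards [self_mem_nhdsWithin] with s hs
      refine DifferentiableAt.congr_of_eventuallyEq ?_ (hpunc s hs)
      exact (differentiableAt_id.sub_const 1).mul (differentiableAt_riemannZeta hs)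
    · rw [hF, continuousAt_update_same]
      exact riemannZeta_residue_one
  have hcont : ContinuousAt (logDeriv F) 1 := by
    have : ContinuousAt (fun s => deriv F s / F s) 1 :=
      han.deriv.continuousAt.div han.continuousAt (by rw [hF1]; exact one_ne_zero)
    exact this
  obtain ⟨δ₁, hδ₁, hball⟩ := Metric.continuousAt_iff.mp hcont 1 one_pos
  refine ⟨‖logDeriv F 1‖ + 1, δ₁, hδ₁, fun δ h0 h1 => ?_⟩
  have hs : ((1 + δ : ℝ) : ℂ) ≠ 1 := by
    rw [Ne, Complex.ofReal_eq_one]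
    linarith
  have hd : dist ((1 + δ : ℝ) : ℂ) 1 < δ₁ := by
    rw [dist_eq_norm]
    have : ((1 + δ : ℝ) : ℂ) - 1 = (δ : ℝ) := by push_cast; ring
    rw [this, Complex.norm_real, Real.norm_of_nonneg h0.le]
    exact h1
  have hb := hball hd
  rw [dist_eq_norm] at hb
  have hζ : riemannZeta ((1 + δ : ℝ) : ℂ) ≠ 0 :=
    riemannZeta_ne_zero_of_one_le_re (by rw [Complex.ofReal_re]; linarith)
  have hsub : ((1 + δ : ℝ) : ℂ) - 1 ≠ 0 := sub_ne_zero.mpr hs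
  have e : logDeriv F ((1 + δ : ℝ) : ℂ) = 1 / (δ : ℂ) + logDeriv riemannZeta ((1 + δ : ℝ) : ℂ) := by
    have h2 : logDeriv F ((1 + δ : ℝ) : ℂ) =
        logDeriv (fun z => (z - 1) * riemannZeta z) ((1 + δ : ℝ) : ℂ) := by
      rw [logDeriv_apply, logDeriv_apply, (hpunc _ hs).deriv_eq, (hpunc _ hs).eq_of_nhds]
    rw [h2, logDeriv_mul (f := fun z => z - 1) _ hsub hζ (by fun_prop)
      (differentiableAt_riemannZeta hs), logDeriv_apply (fun z : ℂ => z - 1)]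
    simp
  have h3 : ‖logDeriv F ((1 + δ : ℝ) : ℂ)‖ ≤ ‖logDeriv F 1‖ + 1 := by
    have := norm_le_norm_add_norm_sub (logDeriv F 1) (logDeriv F ((1 + δ : ℝ) : ℂ))
    rw [norm_sub_rev] at this
    linarith
  have h4 := (abs_le.mp (Complex.abs_re_le_norm (logDeriv F ((1 + δ : ℝ) : ℂ)))).1
  have h5 : (logDeriv F ((1 + δ : ℝ) : ℂ)).re =
      1 / δ + (logDeriv riemannZeta ((1 + δ : ℝ) : ℂ)).re := by
    rw [e, Complex.add_re, ← Complex.ofReal_one, ← Complex.ofReal_div, Complex.ofReal_re]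
  linarith

theorem exists_le_norm_zeta : ∃ K : ℝ, 1 ≤ K ∧ ∀ s : ℂ, 1 < s.re → s.re ≤ 3 →
    (s.re - 1) / K ≤ ‖riemannZeta s‖ := by
  set S := ∑' n : ℕ, ((n : ℝ) + 1) ^ (-(1 : ℝ) - 1) with hS
  have hsum := summable_rpow_succ (σ := 1) one_pos
  have hS0 : 0 ≤ S := tsum_nonneg fun n => by positivity
  refine ⟨1 + 6 * S, by linarith, fun s h1 h3 => ?_⟩
  set σ := s.re with hσ
  have hσ1 : (σ : ℂ) ≠ 1 := by rw [Ne, Complex.ofReal_eq_one]; linarith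
  have hre : ((σ : ℝ) : ℂ).re = σ := Complex.ofReal_re _
  have hreal : ‖riemannZeta (σ : ℂ)‖ ≤ 1 / (σ - 1) + 3 * S := by
    rw [zeta_eq_of_one_lt_re (by rw [hre]; exact h1)]
    refine (norm_add_le _ _).trans (add_le_add ?_ ?_)
    · have : (σ : ℂ) - 1 = ((σ - 1 : ℝ) : ℂ) := by push_cast; rfl
      rw [this, norm_div, norm_one, Complex.norm_real, Real.norm_of_nonneg (by linarith)]
    · rw [hS, ← tsum_mul_left]
      refine tsum_of_norm_bounded (hsum.mul_left 3).hasSum fun n => ?_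
      refine (norm_zetaRem_le n (by rw [hre]; linarith) hσ1).trans ?_
      rw [hre, Complex.norm_real, Real.norm_of_nonneg (by linarith)]
      have : ((n : ℝ) + 1) ^ (-σ - 1) ≤ ((n : ℝ) + 1) ^ (-(1 : ℝ) - 1) :=
        Real.rpow_le_rpow_of_exponent_le (by linarith [Nat.cast_nonneg (α := ℝ) n]) (by linarith)
      gcongr
  have hμ := LSeriesSummable_moebius_iff.mpr h1
  have hprod := LSeries_one_mul_Lseries_moebius h1
  rw [LSeries_one_eq_riemannZeta h1] at hprod
  have hz : HasSum (fun n : ℕ => 1 / (n : ℝ) ^ σ) ‖riemannZeta (σ : ℂ)‖ := by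
    have hs1 : Summable fun n : ℕ => 1 / (n : ℝ) ^ σ := Real.summable_one_div_nat_rpow.mpr h1
    have e1 : riemannZeta (σ : ℂ) = ((∑' n : ℕ, 1 / (n : ℝ) ^ σ : ℝ) : ℂ) := by
      rw [zeta_eq_tsum_one_div_nat_cpow (by rw [hre]; exact h1), Complex.ofReal_tsum]
      refine tsum_congr fun n => ?_
      push_cast
      rw [Complex.ofReal_cpow (Nat.cast_nonneg n)]
      push_cast
      rfl
    rw [e1, Complex.norm_real, Real.norm_of_nonneg (tsum_nonneg fun n => by positivity)]
    exact hs1.hasSum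
  have hL : ‖LSeries (fun n => ((moebius n : ℤ) : ℂ)) s‖ ≤ ‖riemannZeta (σ : ℂ)‖ := by
    rw [LSeries]
    refine tsum_of_norm_bounded hz fun n => ?_
    rw [LSeries.norm_term_eq]
    split_ifs with h
    · positivity
    · rw [← hσ]
      gcongr
      have := abs_moebius_le_one (n := n)
      rw [Complex.norm_intCast]
      exact_mod_cast this
  have hone : 1 = ‖riemannZeta s‖ * ‖LSeries (fun n => ((moebius n : ℤ) : ℂ)) s‖ := by
    rw [← norm_mul, hprod, norm_one]
  have hb : ‖LSeries (fun n => ((moebius n : ℤ) : ℂ)) s‖ ≤ (1 + 6 * S) / (σ - 1) := by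
    refine hL.trans (hreal.trans ?_)
    rw [add_div]
    have : 3 * S ≤ 6 * S / (σ - 1) := by
      rw [le_div_iff₀ (by linarith)]
      nlinarith
    linarith
  have hpos : 0 < (1 + 6 * S) / (σ - 1) := div_pos (by linarith) (by linarith)
  have : 1 ≤ ‖riemannZeta s‖ * ((1 + 6 * S) / (σ - 1)) :=
    hone.le.trans (mul_le_mul_of_nonneg_left hb (norm_nonneg _))
  rw [← div_le_iff₀ hpos, one_div_div] at this
  exact this

theorem exists_norm_zeta_le_of_le_exp : ∃ C : ℝ, 1 ≤ C ∧ ∀ V σ y : ℝ, 0 ≤ V →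
    Real.exp ((10 ^ 9) ^ 8) ≤ y → y ≤ Real.exp (V ^ 8) → 1 - 1 / V ^ 7 ≤ σ → σ ≤ 3 →
    ‖riemannZeta ((σ : ℂ) + y * Complex.I)‖ ≤ C * V ^ 8 := by
  obtain ⟨C, hC, h⟩ := exists_norm_zeta_le
  refine ⟨C, hC, fun V σ y hV hy1 hy2 h1 h3 => ?_⟩
  have hy0 : 0 < y := (Real.exp_pos _).trans_le hy1
  have hl1 : ((10 : ℝ) ^ 9) ^ 8 ≤ Real.log y := by rwa [Real.le_log_iff_exp_le hy0]
  have hl2 : Real.log y ≤ V ^ 8 := by rwa [Real.log_le_iff_le_exp hy0]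
  have hl0 : 0 ≤ Real.log y := le_trans (by positivity) hl1
  set W := Real.log y ^ ((8 : ℝ)⁻¹) with hW
  have hW8 : W ^ 8 = Real.log y := by
    rw [hW]
    exact_mod_cast Real.rpow_inv_natCast_pow hl0 (n := 8) (by norm_num)
  have hW0 : 0 ≤ W := by positivity
  have hW9 : 10 ^ 9 ≤ W := by
    rw [← hW8] at hl1
    exact le_of_pow_le_pow_left₀ (by norm_num) hW0 hl1
  have hWV : W ≤ V := by
    rw [← hW8] at hl2
    exact le_of_pow_le_pow_left₀ (by norm_num) hV hl2
  have hWp : 0 < W := by linarith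
  have h7 : 1 / V ^ 7 ≤ 1 / W ^ 7 := by gcongr
  have := h W σ hW9 (by linarith) h3
  rw [hW8, Real.exp_log hy0] at this
  refine this.trans ?_
  gcongr

end ZetaNearOneLine

section ZeroFreeRegion

theorem eventually_le_log_of_pos (c : ℝ) : ∃ V₀ : ℝ, ∀ V ≥ V₀, c ≤ Real.log V := by
  obtain ⟨V₀, h⟩ := Filter.eventually_atTop.mp (Real.tendsto_log_atTop.eventually_ge_atTop c)
  exact ⟨V₀, h⟩

theorem mul_log_le_self {V : ℝ} (hV : 10 ^ 8 ≤ V) : 5000 * Real.log V ≤ V := by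
  have h := Real.log_le_sub_one_of_pos (Real.sqrt_pos.mpr (by linarith : 0 < V))
  rw [Real.log_sqrt (by linarith)] at h
  have h1 : (10 : ℝ) ^ 4 ≤ √V := Real.le_sqrt_of_sq_le (by linarith)
  have h2 := Real.sq_sqrt (by linarith : 0 ≤ V)
  nlinarith

theorem exists_norm_zeta_le_exp_mul : ∃ V₀ : ℝ, ∀ V ≥ V₀, ∀ y δ : ℝ,
    Real.exp ((10 ^ 9) ^ 8) + 1 ≤ y → y + 1 ≤ Real.exp (V ^ 8) → 1 / V ^ 8 ≤ δ → δ ≤ 1 →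
    ∀ z ∈ Metric.closedBall (0 : ℂ) (1 / V ^ 7),
      ‖riemannZeta (((1 + δ : ℝ) : ℂ) + y * Complex.I + z)‖ ≤
        Real.exp (17 * Real.log V) * ‖riemannZeta (((1 + δ : ℝ) : ℂ) + y * Complex.I)‖ := by
  obtain ⟨C, hC, hC'⟩ := exists_norm_zeta_le_of_le_exp
  obtain ⟨K, hK, hK'⟩ := exists_le_norm_zeta
  refine ⟨C * K + 1, fun V hV y δ hy1 hy2 hδ1 hδ2 z hz => ?_⟩
  have hCK : 1 ≤ C * K := by nlinarith
  have hV1 : 1 < V := by linarith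
  have hV0 : 0 < V := by linarith
  have h7 : 1 / V ^ 7 ≤ 1 := by
    rw [div_le_one (by positivity)]
    exact one_le_pow₀ hV1.le
  have h7' : 0 < 1 / V ^ 7 := by positivity
  have hδ0 : 0 < δ := lt_of_lt_of_le (by positivity) hδ1
  have hzn : ‖z‖ ≤ 1 / V ^ 7 := by simpa using hz
  have hzre := abs_le.mp ((Complex.abs_re_le_norm z).trans hzn)
  have hzim := abs_le.mp ((Complex.abs_im_le_norm z).trans hzn)
  have e : ((1 + δ : ℝ) : ℂ) + y * Complex.I + z =
      ((1 + δ + z.re : ℝ) : ℂ) + ((y + z.im : ℝ) : ℂ) * Complex.I := by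
    apply Complex.ext <;> simp
  have hup := hC' V (1 + δ + z.re) (y + z.im) hV0.le (by linarith) (by linarith) (by linarith)
    (by linarith)
  rw [← e] at hup
  have hlow := hK' (((1 + δ : ℝ) : ℂ) + y * Complex.I) (by simpa using hδ0)
    (by simp; linarith)
  have hre : (((1 + δ : ℝ) : ℂ) + y * Complex.I).re - 1 = δ := by simp
  rw [hre] at hlow
  have hM : Real.exp (17 * Real.log V) = V ^ 17 := by
    rw [mul_comm, Real.exp_mul, Real.exp_log hV0]
    exact_mod_cast Real.rpow_natCast V 17
  rw [hM]
  refine hup.trans ?_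
  calc C * V ^ 8 ≤ V ^ 17 * (1 / V ^ 8 / K) := by
        have : V ^ 17 * (1 / V ^ 8 / K) = V * V ^ 8 / K := by field_simp
        rw [this, le_div_iff₀ (by linarith)]
        have : 0 < V ^ 8 := by positivity
        nlinarith
    _ ≤ V ^ 17 * ‖riemannZeta (((1 + δ : ℝ) : ℂ) + y * Complex.I)‖ := by
        refine mul_le_mul_of_nonneg_left (le_trans ?_ hlow) (by positivity)
        gcongr

theorem differentiableOn_zeta_add {s₀ : ℂ} {r : ℝ} (h : r ≤ |s₀.im|) :
    DifferentiableOn ℂ (fun z => riemannZeta (s₀ + z)) (Metric.ball 0 r) := by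
  intro z hz
  have hz' : ‖z‖ < r := by simpa using hz
  have hne : s₀ + z ≠ 1 := by
    intro h1
    have him := congrArg Complex.im h1
    rw [Complex.add_im, Complex.one_im] at him
    have h2 := Complex.abs_im_le_norm z
    have h3 : |s₀.im| = |z.im| := by
      rw [eq_neg_of_add_eq_zero_left him, abs_neg]
    linarith
  refine DifferentiableAt.differentiableWithinAt ?_
  exact DifferentiableAt.comp z (differentiableAt_riemannZeta hne)
    (differentiableAt_id.const_add s₀)

theorem logDeriv_zeta_add (s₀ : ℂ) :
    logDeriv (fun z => riemannZeta (s₀ + z)) 0 = logDeriv riemannZeta s₀ := by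
  rw [logDeriv_apply, logDeriv_apply, deriv_comp_const_add, add_zero]

theorem exists_zeta_ne_zero : ∃ V₀ : ℝ, ∀ V ≥ V₀, ∀ y β : ℝ,
    Real.exp ((10 ^ 9) ^ 8) + 1 ≤ y → 2 * y + 1 ≤ Real.exp (V ^ 8) →
    1 - 1 / (50000 * V ^ 7 * Real.log V) ≤ β →
    riemannZeta ((β : ℂ) + y * Complex.I) ≠ 0 := by
  obtain ⟨V₁, hM⟩ := exists_norm_zeta_le_exp_mul
  obtain ⟨C₁, δ₁, hδ₁, hpole⟩ := exists_neg_logDeriv_zeta_le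
  obtain ⟨V₂, hlog⟩ := eventually_le_log_of_pos (1 + 3 * |C₁| + 1 / δ₁)
  refine ⟨max (max V₁ V₂) (10 ^ 8), fun V hV y β hy1 hy2 hβ hzero => ?_⟩
  have hVV₁ : V₁ ≤ V := le_trans (le_trans (le_max_left _ _) (le_max_left _ _)) hV
  have hVV₂ : V₂ ≤ V := le_trans (le_trans (le_max_right _ _) (le_max_left _ _)) hV
  have hV5 : 10 ^ 8 ≤ V := (le_max_right _ _).trans hV
  have hV0 : 0 < V := by linarith
  set L := Real.log V with hL
  have hL1 : 1 + 3 * |C₁| + 1 / δ₁ ≤ L := hlog V hVV₂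
  have hδ₁' : 0 < 1 / δ₁ := by positivity
  have hLone : 1 ≤ L := by linarith [abs_nonneg C₁]
  have hLV : 5000 * L ≤ V := mul_log_le_self hV5
  set Q := V ^ 7 with hQ
  have hQ1 : 1 ≤ Q := one_le_pow₀ (by linarith)
  have hQ0 : 0 < Q := by linarith
  set δ := 1 / (5000 * Q * L) with hδ
  have hQL : 0 < 5000 * Q * L := by positivity
  have hδ0 : 0 < δ := by positivity
  have hinv : 1 / δ = 5000 * Q * L := by rw [hδ, one_div_one_div]
  have hδQ : δ ≤ 1 / Q / 5000 := by
    rw [hδ, div_div]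
    refine one_div_le_one_div_of_le (by positivity) ?_
    nlinarith
  have hQinv : 1 / Q ≤ 1 := by rw [div_le_one hQ0]; exact hQ1
  have hQi0 : 0 < 1 / Q := by positivity
  have hδ1 : δ ≤ 1 := by linarith
  have hδlow : 1 / V ^ 8 ≤ δ := by
    rw [hδ]
    refine one_div_le_one_div_of_le (by positivity) ?_
    calc 5000 * Q * L = Q * (5000 * L) := by ring
      _ ≤ Q * V := by gcongr
      _ = V ^ 8 := by rw [hQ]; ring
  have hδδ₁ : δ < δ₁ := by
    have h1 : 1 / δ₁ < 1 / δ := by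
      rw [hinv]
      have : 1 / δ₁ ≤ L - 1 := by linarith [abs_nonneg C₁]
      nlinarith
    exact (one_div_lt_one_div hδ₁ hδ0).mp h1
  have hβ1 : β < 1 := by
    by_contra h
    exact riemannZeta_ne_zero_of_one_le_re (s := (β : ℂ) + y * Complex.I)
      (by simpa using not_lt.mp h) hzero
  have hβ' : 1 - δ / 10 ≤ β := by
    have : 1 / (50000 * Q * L) = δ / 10 := by rw [hδ, div_div]; ring_nf
    rwa [this] at hβ
  set d := 1 + δ - β with hd
  have hd0 : 0 < d := by linarith
  have hd1 : d ≤ 11 / 10 * δ := by linarith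
  have hy0 : 1 ≤ y := by linarith [Real.exp_pos ((10 ^ 9) ^ 8)]
  have hMn : 0 < 17 * L := by linarith
  set R := 1 / Q / 2 with hR
  have hR0 : 0 < R := by positivity
  have hRR : R < 1 / Q := by rw [hR]; linarith
  have hsub : ∀ z ∈ Metric.closedBall (0 : ℂ) R, z ∈ Metric.closedBall (0 : ℂ) (1 / Q) :=
    fun z hz => Metric.closedBall_subset_closedBall hRR.le hz
  have hzeros : ∀ x : ℝ, ∀ z ∈ Metric.closedBall (0 : ℂ) R,
      riemannZeta (((1 + δ : ℝ) : ℂ) + x * Complex.I + z) = 0 → z.re ≤ 0 := by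
    intro x z _ h0
    by_contra hneg
    refine riemannZeta_ne_zero_of_one_le_re ?_ h0
    simp only [Complex.add_re, Complex.ofReal_re, Complex.mul_re, Complex.I_re, Complex.I_im,
      Complex.ofReal_im]
    linarith [not_le.mp hneg]
  have hne : ∀ x : ℝ, riemannZeta (((1 + δ : ℝ) : ℂ) + x * Complex.I + 0) ≠ 0 := by
    intro x
    refine riemannZeta_ne_zero_of_one_le_re ?_
    simp [hδ0.le]
  have hb1 := hM V hVV₁ y δ hy1 (by linarith) hδlow hδ1
  have hb2 := hM V hVV₁ (2 * y) δ (by linarith) hy2 hδlow hδ1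
  have him : ∀ x : ℝ, (((1 + δ : ℝ) : ℂ) + x * Complex.I).im = x := fun x => by simp
  have hdiff : ∀ x : ℝ, 1 ≤ x → DifferentiableOn ℂ
      (fun z => riemannZeta (((1 + δ : ℝ) : ℂ) + x * Complex.I + z)) (Metric.ball 0 (1 / Q)) := by
    intro x hx
    refine differentiableOn_zeta_add ?_
    rw [him, abs_of_nonneg (by linarith)]
    linarith
  have i1 := neg_re_logDeriv_le_of_zero hR0 hRR hMn (hdiff y hy0) (hne y)
    (fun z hz => by simpa only [add_zero] using hb1 z (hsub z hz)) (hzeros y) hd0 (by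
      rw [hR]; linarith) (by
      have : ((1 + δ : ℝ) : ℂ) + y * Complex.I + (-(d : ℂ)) = (β : ℂ) + y * Complex.I := by
        rw [hd]; push_cast; ring
      show riemannZeta _ = 0
      rw [this, hzero])
  have i2 := neg_re_logDeriv_le' hR0 hRR hMn (hdiff (2 * y) (by linarith)) (hne (2 * y))
    (fun z hz => by simpa only [add_zero] using hb2 z (hsub z hz)) (hzeros (2 * y))
  rw [logDeriv_zeta_add] at i1 i2
  have i3 := neg_logDeriv_zeta_three_four_one (σ := 1 + δ) (by linarith) y
  have i4 := hpole δ hδ0 hδδ₁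
  have j1 : 8 * (17 * L) / R = 272 * (Q * L) := by
    rw [hR]; field_simp; ring
  have j2 : d / R ^ 2 ≤ Q := by
    have : d ≤ 1 / Q / 4 := by linarith
    have e : (1 / Q / 4) / R ^ 2 = Q := by rw [hR]; field_simp; norm_num
    rw [← e]
    gcongr
  have j3 : 10 / 11 * (5000 * Q * L) ≤ 1 / d := by
    have : 1 / (11 / 10 * δ) ≤ 1 / d := one_div_le_one_div_of_le hd0 hd1
    refine le_trans (le_of_eq ?_) this
    rw [← hinv]
    field_simp
  have j4 : 3 * C₁ ≤ L := by linarith [le_abs_self C₁]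
  have j5 : L ≤ Q * L := by nlinarith
  have j6 : Q ≤ Q * L := by nlinarith
  have j7 : 0 < Q * L := by positivity
  rw [j1] at i1 i2
  rw [hinv] at i4
  linarith

end ZeroFreeRegion

section ZetaBounds

theorem exists_zeta_bounds : ∃ V₀ : ℝ, 1 ≤ V₀ ∧ ∀ V ≥ V₀, ∀ σ y : ℝ,
    1 - 1 / (100000 * V ^ 7 * Real.log V) ≤ σ → σ ≤ 2 →
    Real.exp ((10 ^ 9) ^ 8) + 2 ≤ y → 2 * y + 3 ≤ Real.exp (V ^ 8) →
    riemannZeta ((σ : ℂ) + y * Complex.I) ≠ 0 ∧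
    ‖riemannZeta ((σ : ℂ) + y * Complex.I)‖ ≤ V ^ 120 ∧
    ‖(riemannZeta ((σ : ℂ) + y * Complex.I))⁻¹‖ ≤ V ^ 120 ∧
    ‖deriv riemannZeta ((σ : ℂ) + y * Complex.I)‖ ≤ V ^ 17 := by
  obtain ⟨C, hC, hC'⟩ := exists_norm_zeta_le_of_le_exp
  obtain ⟨K, hK, hK'⟩ := exists_le_norm_zeta
  obtain ⟨V₂, hV₂⟩ := exists_zeta_ne_zero
  obtain ⟨V₃, hV₃⟩ := eventually_le_log_of_pos 1
  refine ⟨max (max V₂ (max V₃ (2 * C))) (max (10 ^ 8) (10 * K)),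
    le_trans (by norm_num) ((le_max_left (10 ^ 8) (10 * K)).trans (le_max_right _ _)),
    fun V hV σ y hσ1 hσ2 hy1 hy2 => ?_⟩
  simp only [ge_iff_le, max_le_iff] at hV
  obtain ⟨⟨h2, h3, h4⟩, h5, h6⟩ := hV
  have hV0 : 0 < V := by linarith
  set L := Real.log V with hL
  have hL1 : 1 ≤ L := hV₃ V h3
  have hLV : 5000 * L ≤ V := mul_log_le_self h5
  set w := 1 / (50000 * V ^ 7 * L) with hw
  have hw0 : 0 < w := by positivity
  have hw2 : 1 / (100000 * V ^ 7 * L) = w / 2 := by rw [hw, div_div]; ring_nf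
  rw [hw2] at hσ1
  have hQ1 : 1 ≤ V ^ 7 := one_le_pow₀ (by linarith)
  have hQi : 1 / V ^ 7 ≤ 1 := by rw [div_le_one (by positivity)]; exact hQ1
  have hwQ : w ≤ 1 / V ^ 7 / 50000 := by
    rw [hw, div_div]
    refine one_div_le_one_div_of_le (by positivity) ?_
    nlinarith
  have hQi0 : 0 < 1 / V ^ 7 := by positivity
  have hwlow : 1 / V ^ 8 / 10 ≤ w := by
    rw [hw, div_div]
    refine one_div_le_one_div_of_le (by positivity) ?_
    calc 50000 * V ^ 7 * L = V ^ 7 * (5000 * L) * 10 := by ring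
      _ ≤ V ^ 7 * V * 10 := by gcongr
      _ = V ^ 8 * 10 := by ring
  have hYpos := Real.exp_pos (((10 : ℝ) ^ 9) ^ 8)
  have hup : ∀ σ' y' : ℝ, 1 - 1 / V ^ 7 ≤ σ' → σ' ≤ 3 → |y' - y| ≤ 1 →
      ‖riemannZeta ((σ' : ℂ) + y' * Complex.I)‖ ≤ C * V ^ 8 := by
    intro σ' y' ha hb hc
    have := abs_le.mp hc
    exact hC' V σ' y' hV0.le (by linarith) (by linarith) ha hb
  have hne : ∀ σ' y' : ℝ, 1 - w ≤ σ' → |y' - y| ≤ 1 →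
      riemannZeta ((σ' : ℂ) + y' * Complex.I) ≠ 0 := by
    intro σ' y' ha hc
    have := abs_le.mp hc
    exact hV₂ V h2 y' σ' (by linarith) (by linarith) ha
  have hself : |y - y| ≤ 1 := by simp
  refine ⟨hne σ y (by linarith) hself, ?_, ?_, ?_⟩
  · calc _ ≤ C * V ^ 8 := hup σ y (by linarith) (by linarith) hself
      _ ≤ V * V ^ 8 := by gcongr; linarith
      _ = V ^ 9 := by ring
      _ ≤ V ^ 120 := pow_le_pow_right₀ (by linarith) (by norm_num)
  · rw [norm_inv]
    refine inv_le_of_inv_le₀ (by positivity) ?_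
    have hwK : 1 / V ^ 9 ≤ w / K / 1 := by
      rw [div_one, le_div_iff₀ (by linarith)]
      refine le_trans ?_ hwlow
      rw [div_mul_eq_mul_div, div_div, div_le_div_iff₀ (by positivity) (by positivity)]
      have : 0 < V ^ 8 := by positivity
      have e : V ^ 9 = V * V ^ 8 := by ring
      rw [e]
      nlinarith
    rw [div_one] at hwK
    by_cases hc : 1 + w ≤ σ
    · have := hK' ((σ : ℂ) + y * Complex.I) (by simp; linarith) (by simp; linarith)
      refine le_trans ?_ this
      have hre : ((σ : ℂ) + y * Complex.I).re - 1 = σ - 1 := by simp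
      rw [hre]
      calc (V ^ 120)⁻¹ ≤ 1 / V ^ 9 := by
            rw [one_div]
            gcongr
            · linarith
            · norm_num
        _ ≤ w / K := hwK
        _ ≤ (σ - 1) / K := by gcongr; linarith
    · push Not at hc
      set s₀ : ℂ := ((1 + w : ℝ) : ℂ) + y * Complex.I with hs₀
      have hs₀re : s₀.re = 1 + w := by simp [hs₀]
      have hs₀im : s₀.im = y := by simp [hs₀]
      have hM : 0 < 18 * L := by linarith
      have hlow := hK' s₀ (by rw [hs₀re]; linarith) (by rw [hs₀re]; linarith)
      rw [hs₀re, add_sub_cancel_left] at hlow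
      have hs₀' : 1 / V ^ 9 ≤ ‖riemannZeta s₀‖ := hwK.trans hlow
      have hball : ∀ z ∈ Metric.ball (0 : ℂ) (2 * w), ∃ σ' y' : ℝ, 1 - w ≤ σ' ∧ σ' ≤ 3 ∧
          |y' - y| ≤ 1 ∧ s₀ + z = (σ' : ℂ) + y' * Complex.I := by
        intro z hz
        have hzn : ‖z‖ < 2 * w := by simpa using hz
        have hzre := abs_le.mp ((Complex.abs_re_le_norm z).trans hzn.le)
        refine ⟨1 + w + z.re, y + z.im, by linarith, by linarith, ?_, ?_⟩
        · rw [add_sub_cancel_left]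
          linarith [Complex.abs_im_le_norm z]
        · rw [hs₀]
          apply Complex.ext <;> simp
      have hnorm := norm_ge_of_ne_zero (f := fun z => riemannZeta (s₀ + z)) (r := 2 * w)
        (M := 18 * L) (by linarith) hM
        (differentiableOn_zeta_add (by rw [hs₀im, abs_of_nonneg (by linarith)]; linarith))
        (fun z hz => by
          obtain ⟨σ', y', ha, -, hb', e⟩ := hball z hz
          rw [e]
          exact hne σ' y' ha hb')
        (fun z hz => by
          obtain ⟨σ', y', ha, ha', hb', e⟩ := hball z hz
          have := hup σ' y' (by linarith) ha' hb'
          rw [← e] at this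
          refine this.trans ?_
          rw [add_zero]
          have hexp : Real.exp (18 * L) = V ^ 18 := by
            rw [mul_comm, Real.exp_mul, Real.exp_log hV0]
            exact_mod_cast Real.rpow_natCast V 18
          rw [hexp]
          calc C * V ^ 8 ≤ V * V ^ 8 := by gcongr; linarith
            _ = V ^ 18 * (1 / V ^ 9) := by field_simp
            _ ≤ _ := by gcongr)
        (z := ((σ - 1 - w : ℝ) : ℂ)) (by
          rw [Complex.norm_real, Real.norm_eq_abs, abs_le]
          constructor <;> linarith)
      have e : s₀ + ((σ - 1 - w : ℝ) : ℂ) = (σ : ℂ) + y * Complex.I := by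
        rw [hs₀]; push_cast; ring
      simp only [e, add_zero] at hnorm
      refine le_trans ?_ hnorm
      have hexp : Real.exp (-(6 * (18 * L))) = (V ^ 108)⁻¹ := by
        rw [Real.exp_neg]
        congr 1
        rw [← mul_assoc, mul_comm, Real.exp_mul, Real.exp_log hV0]
        norm_num
      rw [hexp]
      calc (V ^ 120)⁻¹ ≤ (V ^ 117)⁻¹ := by
            gcongr
            · linarith
            · norm_num
        _ = (V ^ 108)⁻¹ * (1 / V ^ 9) := by field_simp
        _ ≤ _ := by gcongr
  · set r := 1 / V ^ 7 / 2 with hr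
    have hr0 : 0 < r := by positivity
    have hsph : ∀ z ∈ Metric.sphere ((σ : ℂ) + y * Complex.I) r,
        ‖riemannZeta z‖ ≤ C * V ^ 8 := by
      intro z hz
      have hzn : ‖z - ((σ : ℂ) + y * Complex.I)‖ = r := by simpa [dist_eq_norm] using hz
      have hre := (Complex.abs_re_le_norm (z - ((σ : ℂ) + y * Complex.I))).trans hzn.le
      have him := (Complex.abs_im_le_norm (z - ((σ : ℂ) + y * Complex.I))).trans hzn.le
      have e1 : (z - ((σ : ℂ) + y * Complex.I)).re = z.re - σ := by simp
      have e2 : (z - ((σ : ℂ) + y * Complex.I)).im = z.im - y := by simp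
      rw [e1] at hre
      rw [e2] at him
      have := abs_le.mp hre
      have h := hup z.re z.im (by linarith) (by linarith) (by linarith)
      rwa [Complex.re_add_im] at h
    have hd : DifferentiableOn ℂ riemannZeta
        (Metric.closedBall ((σ : ℂ) + y * Complex.I) r) := by
      intro z hz
      refine (differentiableAt_riemannZeta ?_).differentiableWithinAt
      rintro rfl
      have hzn : ‖1 - ((σ : ℂ) + y * Complex.I)‖ ≤ r := by simpa [dist_eq_norm] using hz
      have him := (Complex.abs_im_le_norm (1 - ((σ : ℂ) + y * Complex.I))).trans hzn
      have e2 : (1 - ((σ : ℂ) + y * Complex.I)).im = - y := by simp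
      rw [e2, abs_neg, abs_of_nonneg (by linarith)] at him
      linarith
    refine (Complex.norm_deriv_le_of_forall_mem_sphere_norm_le hr0
      (hd.diffContOnCl_ball subset_rfl) hsph).trans ?_
    calc C * V ^ 8 / r = 2 * C * V ^ 15 := by rw [hr]; field_simp
      _ ≤ V * V ^ 15 := by gcongr
      _ = V ^ 16 := by ring
      _ ≤ V ^ 17 := pow_le_pow_right₀ (by linarith) (by norm_num)

end ZetaBounds

section GaussianLine
open MeasureTheory

/-- The integrand of the Gaussian-smoothed inverse Mellin transform. -/
noncomputable def gaussLine (h x : ℝ) (s : ℂ) : ℂ :=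
  Complex.exp (s * x + (h : ℂ) ^ 2 * s ^ 2 / 2)

theorem norm_gaussLine (h x c u : ℝ) : ‖gaussLine h x ((c : ℂ) + u * Complex.I)‖ =
    Real.exp (c * x + h ^ 2 * c ^ 2 / 2) * Real.exp (-(h ^ 2 / 2) * u ^ 2) := by
  rw [gaussLine, Complex.norm_exp, ← Real.exp_add]
  congr 1
  simp only [Complex.add_re, Complex.mul_re, Complex.mul_im, Complex.ofReal_re, Complex.ofReal_im,
    Complex.I_re, Complex.I_im, Complex.add_im, pow_two, Complex.div_ofNat_re]
  ring

theorem gaussLine_eq (h x c u : ℝ) : gaussLine h x ((c : ℂ) + u * Complex.I) =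
    Complex.exp ((-(h ^ 2 / 2) : ℂ) * (u : ℂ) ^ 2 + (Complex.I * (x + h ^ 2 * c)) * u +
      (c * x + h ^ 2 * c ^ 2 / 2)) := by
  rw [gaussLine]
  congr 1
  have : (((c : ℂ) + u * Complex.I)) ^ 2 = c ^ 2 + 2 * c * u * Complex.I - u ^ 2 := by
    ring_nf
    rw [Complex.I_sq]
    ring
  rw [this]
  ring

theorem continuous_gaussLine (h x c : ℝ) :
    Continuous fun u : ℝ => gaussLine h x ((c : ℂ) + u * Complex.I) := by
  unfold gaussLine
  fun_prop

theorem neg_sq_div_two_re_neg {h : ℝ} (hh : 0 < h) : ((-(h ^ 2 / 2) : ℂ)).re < 0 := by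
  have : ((-(h ^ 2 / 2) : ℂ)) = ((-(h ^ 2 / 2) : ℝ) : ℂ) := by push_cast; ring
  rw [this, Complex.ofReal_re]
  have : 0 < h ^ 2 := by positivity
  linarith

theorem integrable_gaussLine {h : ℝ} (hh : 0 < h) (x c : ℝ) :
    Integrable fun u : ℝ => gaussLine h x ((c : ℂ) + u * Complex.I) := by
  simp_rw [gaussLine_eq]
  exact integrable_cexp_quadratic' (neg_sq_div_two_re_neg hh) _ _

theorem integral_gaussLine {h : ℝ} (hh : 0 < h) (x c : ℝ) :
    ∫ u : ℝ, gaussLine h x ((c : ℂ) + u * Complex.I) =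
      ((√(2 * Real.pi) / h * Real.exp (-(x ^ 2 / (2 * h ^ 2))) : ℝ) : ℂ) := by
  simp_rw [gaussLine_eq]
  rw [integral_cexp_quadratic (neg_sq_div_two_re_neg hh)]
  have hh' : (h : ℂ) ≠ 0 := by exact_mod_cast hh.ne'
  have e1 : (Real.pi : ℂ) / -(-(h ^ 2 / 2)) = (((√(2 * Real.pi) / h) ^ 2 : ℝ) : ℂ) := by
    rw [div_pow, Real.sq_sqrt (by positivity)]
    push_cast
    field_simp
  have e2 : ((c * x + h ^ 2 * c ^ 2 / 2 : ℂ)) -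
      (Complex.I * (x + h ^ 2 * c)) ^ 2 / (4 * -(h ^ 2 / 2)) =
      ((-(x ^ 2 / (2 * h ^ 2)) : ℝ) : ℂ) := by
    rw [mul_pow, Complex.I_sq]
    push_cast
    field_simp
    ring
  rw [e1, e2, ← Complex.ofReal_exp]
  have e3 : (1 / 2 : ℂ) = ((1 / 2 : ℝ) : ℂ) := by push_cast; rfl
  rw [e3, ← Complex.ofReal_cpow (by positivity), ← Complex.ofReal_mul, ← Real.sqrt_eq_rpow,
    Real.sqrt_sq (by positivity)]

theorem norm_integral_gaussLine_sub_le {h T : ℝ} (hh : 0 < h) (hT : 0 ≤ T) (x c : ℝ) :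
    ‖(∫ u : ℝ in -T..T, gaussLine h x ((c : ℂ) + u * Complex.I)) -
      ((√(2 * Real.pi) / h * Real.exp (-(x ^ 2 / (2 * h ^ 2))) : ℝ) : ℂ)‖ ≤
    Real.exp (c * x + h ^ 2 * c ^ 2 / 2) * Real.exp (-(h ^ 2 * T ^ 2 / 4)) *
      √(Real.pi / (h ^ 2 / 4)) := by
  rw [← integral_gaussLine hh x c, intervalIntegral.integral_of_le (by linarith),
    ← integral_add_compl (measurableSet_Ioc (a := -T) (b := T)) (integrable_gaussLine hh x c),
    sub_add_cancel_left, norm_neg]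
  have hint : Integrable fun u : ℝ => Real.exp (c * x + h ^ 2 * c ^ 2 / 2) *
      Real.exp (-(h ^ 2 * T ^ 2 / 4)) * Real.exp (-(h ^ 2 / 4) * u ^ 2) :=
    (integrable_exp_neg_mul_sq (by positivity)).const_mul _
  refine (norm_integral_le_integral_norm _).trans ?_
  rw [← integral_gaussian, ← integral_const_mul]
  refine (setIntegral_mono_on (integrable_gaussLine hh x c).norm.integrableOn
    hint.integrableOn measurableSet_Ioc.compl fun u hu => ?_).trans
    (setIntegral_le_integral hint (Filter.Eventually.of_forall fun u => by positivity))
  rw [norm_gaussLine, mul_assoc]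
  gcongr
  rw [← Real.exp_add]
  refine Real.exp_le_exp.mpr ?_
  have hu' : T ^ 2 ≤ u ^ 2 := by
    rw [sq_le_sq, abs_of_nonneg hT]
    by_contra hlt
    have := abs_lt.mp (not_le.mp hlt)
    exact hu ⟨this.1, this.2.le⟩
  have : 0 < h ^ 2 := by positivity
  nlinarith

end GaussianLine

section SmoothedSum
open MeasureTheory

theorem exp_neg_sq_le {h : ℝ} (hh : 0 < h) (hh1 : h ≤ 1) (x : ℝ) :
    Real.exp (-(x ^ 2 / (2 * h ^ 2))) ≤ Real.exp (x + 1 / 2) := by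
  refine Real.exp_le_exp.mpr ?_
  have h2 : 0 < h ^ 2 := by positivity
  have h3 : h ^ 2 ≤ 1 := pow_le_one₀ hh.le hh1
  have : x ^ 2 / (2 * h ^ 2) + x + h ^ 2 / 2 = (x + h ^ 2) ^ 2 / (2 * h ^ 2) := by
    field_simp
    ring
  have : 0 ≤ x ^ 2 / (2 * h ^ 2) + x + h ^ 2 / 2 := by rw [this]; positivity
  linarith

theorem exp_sub_log_eq {n : ℕ} (hn : n ≠ 0) (y : ℝ) :
    Real.exp (y - Real.log n + 1 / 2) = Real.exp (y + 1 / 2) / n := by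
  have hn' : (0 : ℝ) < n := by exact_mod_cast Nat.pos_of_ne_zero hn
  have : y - Real.log n + 1 / 2 = (y + 1 / 2) - Real.log n := by ring
  rw [this, Real.exp_sub, Real.exp_log hn']

theorem norm_mul_gaussLine_le {b : ℕ → ℂ} (hb0 : b 0 = 0) {h : ℝ} (hh : 0 < h) (hh1 : h ≤ 1)
    (y u : ℝ) (n : ℕ) :
    ‖b n * gaussLine h (y - Real.log n) (((1 : ℝ) : ℂ) + u * Complex.I)‖ ≤
      ‖b n‖ / n * Real.exp (y + 1 / 2) := by
  rcases eq_or_ne n 0 with rfl | hn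
  · simp [hb0]
  rw [norm_mul, norm_gaussLine, div_mul_eq_mul_div, mul_div_assoc (‖b n‖), ← exp_sub_log_eq hn]
  have h3 : h ^ 2 ≤ 1 := pow_le_one₀ hh.le hh1
  gcongr
  rw [← Real.exp_add]
  refine Real.exp_le_exp.mpr ?_
  have : 0 ≤ h ^ 2 / 2 * u ^ 2 := by positivity
  linarith

theorem hasSum_integral_mul_gaussLine {b : ℕ → ℂ} (hb0 : b 0 = 0)
    (hb : Summable fun n : ℕ => ‖b n‖ / n) {Φ : ℂ → ℂ} {h : ℝ} (hh : 0 < h) (hh1 : h ≤ 1)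
    (hΦ : ∀ u : ℝ, HasSum (fun n : ℕ => b n *
      Complex.exp (-(((1 : ℝ) : ℂ) + u * Complex.I) * Real.log n))
      (Φ (((1 : ℝ) : ℂ) + u * Complex.I))) (y T : ℝ) :
    HasSum (fun n : ℕ => b n * ∫ u : ℝ in -T..T,
        gaussLine h (y - Real.log n) (((1 : ℝ) : ℂ) + u * Complex.I))
      (∫ u : ℝ in -T..T, Φ (((1 : ℝ) : ℂ) + u * Complex.I) *
        gaussLine h y (((1 : ℝ) : ℂ) + u * Complex.I)) := by
  simp_rw [← intervalIntegral.integral_const_mul]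
  refine intervalIntegral.hasSum_integral_of_dominated_convergence
    (fun n _ => ‖b n‖ / n * Real.exp (y + 1 / 2))
    (fun n => ((continuous_gaussLine h _ 1).const_mul _).aestronglyMeasurable)
    (fun n => Filter.Eventually.of_forall fun u _ => norm_mul_gaussLine_le hb0 hh hh1 y u n)
    (Filter.Eventually.of_forall fun u _ => hb.mul_right _)
    intervalIntegrable_const
    (Filter.Eventually.of_forall fun u _ => ?_)
  have := (hΦ u).mul_right (gaussLine h y (((1 : ℝ) : ℂ) + u * Complex.I))
  refine this.congr_fun fun n => ?_
  rw [mul_assoc, gaussLine, gaussLine, ← Complex.exp_add]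
  congr 2
  push_cast
  ring

theorem norm_integral_sub_smoothed_sum_le {b : ℕ → ℂ} (hb0 : b 0 = 0)
    (hb : Summable fun n : ℕ => ‖b n‖ / n) {Φ : ℂ → ℂ} {h : ℝ} (hh : 0 < h) (hh1 : h ≤ 1)
    (hΦ : ∀ u : ℝ, HasSum (fun n : ℕ => b n *
      Complex.exp (-(((1 : ℝ) : ℂ) + u * Complex.I) * Real.log n))
      (Φ (((1 : ℝ) : ℂ) + u * Complex.I))) (y : ℝ) {T : ℝ} (hT : 0 ≤ T) :
    ‖(∫ u : ℝ in -T..T, Φ (((1 : ℝ) : ℂ) + u * Complex.I) *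
        gaussLine h y (((1 : ℝ) : ℂ) + u * Complex.I)) - (√(2 * Real.pi) / h : ℝ) *
      ∑' n : ℕ, b n * (Real.exp (-((y - Real.log n) ^ 2 / (2 * h ^ 2))) : ℝ)‖ ≤
    (∑' n : ℕ, ‖b n‖ / n) * (Real.exp (y + 1 / 2) * Real.exp (-(h ^ 2 * T ^ 2 / 4)) *
      √(Real.pi / (h ^ 2 / 4))) := by
  have h1 := hasSum_integral_mul_gaussLine hb0 hb hh hh1 hΦ y T
  have hsum : Summable fun n : ℕ =>
      b n * (Real.exp (-((y - Real.log n) ^ 2 / (2 * h ^ 2))) : ℝ) := by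
    refine Summable.of_norm_bounded (hb.mul_right (Real.exp (y + 1 / 2))) fun n => ?_
    rcases eq_or_ne n 0 with rfl | hn
    · simp [hb0]
    rw [norm_mul, Complex.norm_real, Real.norm_of_nonneg (Real.exp_pos _).le,
      div_mul_eq_mul_div, mul_div_assoc, ← exp_sub_log_eq hn]
    exact mul_le_mul_of_nonneg_left (exp_neg_sq_le hh hh1 _) (norm_nonneg _)
  have h2 := hsum.hasSum.mul_left (((√(2 * Real.pi) / h : ℝ)) : ℂ)
  have h3 := h1.sub h2
  rw [← h3.tsum_eq]
  refine tsum_of_norm_bounded (hb.hasSum.mul_right _) fun n => ?_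
  rcases eq_or_ne n 0 with rfl | hn
  · simp [hb0]
  have h4 := norm_integral_gaussLine_sub_le hh hT (y - Real.log n) 1
  have e : (b n * ∫ u : ℝ in -T..T, gaussLine h (y - Real.log n) (((1 : ℝ) : ℂ) + u * Complex.I)) -
      ((√(2 * Real.pi) / h : ℝ) : ℂ) *
        (b n * (Real.exp (-((y - Real.log n) ^ 2 / (2 * h ^ 2))) : ℝ)) =
      b n * ((∫ u : ℝ in -T..T, gaussLine h (y - Real.log n) (((1 : ℝ) : ℂ) + u * Complex.I)) -
        ((√(2 * Real.pi) / h * Real.exp (-((y - Real.log n) ^ 2 / (2 * h ^ 2))) : ℝ) : ℂ)) := by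
    push_cast
    ring
  rw [e, norm_mul]
  have h5 : ‖b n‖ / n * (Real.exp (y + 1 / 2) * Real.exp (-(h ^ 2 * T ^ 2 / 4)) *
      √(Real.pi / (h ^ 2 / 4))) = ‖b n‖ * (Real.exp (y - Real.log n + 1 / 2) *
      Real.exp (-(h ^ 2 * T ^ 2 / 4)) * √(Real.pi / (h ^ 2 / 4))) := by
    rw [exp_sub_log_eq hn]
    ring
  rw [h5]
  refine mul_le_mul_of_nonneg_left (h4.trans ?_) (norm_nonneg _)
  have h6 : h ^ 2 ≤ 1 := pow_le_one₀ hh.le hh1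
  gcongr <;> linarith

theorem norm_integral_line_le {Φ : ℂ → ℂ} {h w T P y : ℝ} (hh : 0 < h) (hh1 : h ≤ 1)
    (hw0 : 0 ≤ w) (hw1 : w ≤ 1) (hT : 0 ≤ T) (hy : 0 ≤ y)
    (hd : DifferentiableOn ℂ Φ (Set.Icc (-w) 1 ×ℂ Set.Icc (-T) T))
    (hP : ∀ z ∈ Set.Icc (-w) 1 ×ℂ Set.Icc (-T) T, ‖Φ z‖ ≤ P) :
    ‖∫ u : ℝ in -T..T, Φ (((1 : ℝ) : ℂ) + u * Complex.I) *
        gaussLine h y (((1 : ℝ) : ℂ) + u * Complex.I)‖ ≤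
      P * (Real.exp (-(w * y) + 1 / 2) * √(Real.pi / (h ^ 2 / 2))) +
      4 * (P * (Real.exp (y + 1 / 2) * Real.exp (-(h ^ 2 * T ^ 2 / 4)))) := by
  set G : ℂ → ℂ := fun s => Φ s * gaussLine h y s with hG
  have h2 : h ^ 2 ≤ 1 := pow_le_one₀ hh.le hh1
  have h20 : 0 < h ^ 2 := by positivity
  have hdG : DifferentiableOn ℂ G (Set.Icc (-w) 1 ×ℂ Set.Icc (-T) T) := by
    refine hd.mul (Differentiable.differentiableOn ?_)
    unfold gaussLine
    fun_prop
  have hP0 : 0 ≤ P := (norm_nonneg _).trans (hP (((0 : ℝ) : ℂ) + (0 : ℝ) * Complex.I)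
    (by simp [Complex.mem_reProdIm]; exact ⟨hw0, hT⟩))
  have hrect := Complex.integral_boundary_rect_eq_zero_of_differentiableOn G
    (((-w : ℝ) : ℂ) + ((-T : ℝ) : ℂ) * Complex.I) (((1 : ℝ) : ℂ) + (T : ℂ) * Complex.I) (by
      have e1 : (((-w : ℝ) : ℂ) + ((-T : ℝ) : ℂ) * Complex.I).re = -w := by simp
      have e2 : (((-w : ℝ) : ℂ) + ((-T : ℝ) : ℂ) * Complex.I).im = -T := by simp
      have e3 : (((1 : ℝ) : ℂ) + (T : ℂ) * Complex.I).re = 1 := by simp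
      have e4 : (((1 : ℝ) : ℂ) + (T : ℂ) * Complex.I).im = T := by simp
      rw [e1, e2, e3, e4, Set.uIcc_of_le (by linarith), Set.uIcc_of_le (by linarith)]
      exact hdG)
  have e1 : (((-w : ℝ) : ℂ) + ((-T : ℝ) : ℂ) * Complex.I).re = -w := by simp
  have e2 : (((-w : ℝ) : ℂ) + ((-T : ℝ) : ℂ) * Complex.I).im = -T := by simp
  have e3 : (((1 : ℝ) : ℂ) + (T : ℂ) * Complex.I).re = 1 := by simp
  have e4 : (((1 : ℝ) : ℂ) + (T : ℂ) * Complex.I).im = T := by simp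
  rw [e1, e2, e3, e4] at hrect
  simp only [smul_eq_mul] at hrect
  set X₁ := ∫ x : ℝ in -w..1, G (x + ((-T : ℝ) : ℂ) * Complex.I)
  set X₂ := ∫ x : ℝ in -w..1, G (x + (T : ℂ) * Complex.I)
  set Y₁ := ∫ u : ℝ in -T..T, G (((1 : ℝ) : ℂ) + u * Complex.I)
  set Y₂ := ∫ u : ℝ in -T..T, G (((-w : ℝ) : ℂ) + u * Complex.I) with hY₂
  have hY : Y₁ = Y₂ + Complex.I * (X₁ - X₂) := by
    linear_combination (-Complex.I) * hrect + (Y₁ - Y₂) * Complex.I_sq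
  have hor : ∀ τ : ℝ, τ ^ 2 = T ^ 2 → -T ≤ τ → τ ≤ T →
      ‖∫ x : ℝ in -w..1, G (x + (τ : ℂ) * Complex.I)‖ ≤
      2 * (P * (Real.exp (y + 1 / 2) * Real.exp (-(h ^ 2 * T ^ 2 / 4)))) := by
    intro τ hτ hτ1 hτ2
    refine (intervalIntegral.norm_integral_le_of_norm_le_const
      (C := P * (Real.exp (y + 1 / 2) * Real.exp (-(h ^ 2 * T ^ 2 / 4)))) fun x hx => ?_).trans ?_
    · rw [Set.uIoc_of_le (by linarith)] at hx
      rw [hG, norm_mul, norm_gaussLine]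
      refine mul_le_mul (hP _ ?_) ?_ (by positivity) hP0
      · rw [Complex.mem_reProdIm]
        simp
        exact ⟨⟨hx.1.le, hx.2⟩, hτ1, hτ2⟩
      · have hx2 : x ^ 2 ≤ 1 := by
          rw [sq_le_one_iff_abs_le_one, abs_le]
          exact ⟨by linarith [hx.1], hx.2⟩
        refine mul_le_mul (Real.exp_le_exp.mpr ?_) (Real.exp_le_exp.mpr ?_) (by positivity)
          (by positivity)
        · have : x * y ≤ y := by nlinarith [hx.2]
          have : h ^ 2 * x ^ 2 ≤ 1 := by nlinarith [sq_nonneg x]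
          linarith
        · rw [hτ]
          have : 0 ≤ h ^ 2 * T ^ 2 := by positivity
          linarith
    · rw [abs_of_nonneg (by linarith), mul_comm]
      refine mul_le_mul_of_nonneg_right (by linarith) (by positivity)
  have hvert : ‖Y₂‖ ≤ P * (Real.exp (-(w * y) + 1 / 2) * √(Real.pi / (h ^ 2 / 2))) := by
    have hgi : Integrable fun u : ℝ => P * (Real.exp (-(w * y) + 1 / 2) *
        Real.exp (-(h ^ 2 / 2) * u ^ 2)) :=
      ((integrable_exp_neg_mul_sq (by positivity)).const_mul _).const_mul _
    rw [← integral_gaussian, ← integral_const_mul, ← integral_const_mul, hY₂]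
    refine (intervalIntegral.norm_integral_le_of_norm_le
      (g := fun u => P * (Real.exp (-(w * y) + 1 / 2) * Real.exp (-(h ^ 2 / 2) * u ^ 2)))
      (by linarith)
      (Filter.Eventually.of_forall fun u hu => ?_) hgi.intervalIntegrable).trans ?_
    · rw [hG, norm_mul, norm_gaussLine]
      refine mul_le_mul (hP _ ?_) ?_ (by positivity) hP0
      · rw [Complex.mem_reProdIm]
        simp
        exact ⟨by linarith, hu.1.le, hu.2⟩
      · refine mul_le_mul_of_nonneg_right (Real.exp_le_exp.mpr ?_) (by positivity)
        have : h ^ 2 * (-w) ^ 2 ≤ 1 := by nlinarith [sq_nonneg w]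
        linarith
    · rw [intervalIntegral.integral_of_le (by linarith)]
      exact setIntegral_le_integral hgi (Filter.Eventually.of_forall fun u => by positivity)
  have hX₁ := hor (-T) (by ring) le_rfl (by linarith)
  have hX₂ := hor T rfl (by linarith) le_rfl
  have : ‖Complex.I * (X₁ - X₂)‖ ≤ ‖X₁‖ + ‖X₂‖ := by
    rw [norm_mul, Complex.norm_I, one_mul]
    exact norm_sub_le _ _
  calc ‖Y₁‖ ≤ ‖Y₂‖ + ‖Complex.I * (X₁ - X₂)‖ := by rw [hY]; exact norm_add_le _ _
    _ ≤ _ := by linarith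

theorem norm_smoothed_sum_le {b : ℕ → ℂ} (hb0 : b 0 = 0)
    (hb : Summable fun n : ℕ => ‖b n‖ / n) {Φ : ℂ → ℂ} {h w T P y : ℝ} (hh : 0 < h) (hh1 : h ≤ 1)
    (hΦ : ∀ u : ℝ, HasSum (fun n : ℕ => b n *
      Complex.exp (-(((1 : ℝ) : ℂ) + u * Complex.I) * Real.log n))
      (Φ (((1 : ℝ) : ℂ) + u * Complex.I)))
    (hw0 : 0 ≤ w) (hw1 : w ≤ 1) (hT : 0 ≤ T) (hy : 0 ≤ y)
    (hd : DifferentiableOn ℂ Φ (Set.Icc (-w) 1 ×ℂ Set.Icc (-T) T))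
    (hP : ∀ z ∈ Set.Icc (-w) 1 ×ℂ Set.Icc (-T) T, ‖Φ z‖ ≤ P) :
    ‖∑' n : ℕ, b n * (Real.exp (-((y - Real.log n) ^ 2 / (2 * h ^ 2))) : ℝ)‖ ≤
      4 * ((∑' n : ℕ, ‖b n‖ / n) + P) *
        (Real.exp (y - h ^ 2 * T ^ 2 / 4) + Real.exp (-(w * y))) := by
  have i1 := norm_integral_sub_smoothed_sum_le hb0 hb hh hh1 hΦ y hT
  have i2 := norm_integral_line_le hh hh1 hw0 hw1 hT hy hd hP
  set B := ∑' n : ℕ, ‖b n‖ / n with hB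
  set S := ∑' n : ℕ, b n * (Real.exp (-((y - Real.log n) ^ 2 / (2 * h ^ 2))) : ℝ) with hS
  set J := ∫ u : ℝ in -T..T, Φ (((1 : ℝ) : ℂ) + u * Complex.I) *
        gaussLine h y (((1 : ℝ) : ℂ) + u * Complex.I) with hJ
  have hB0 : 0 ≤ B := tsum_nonneg fun n => by positivity
  have hP0 : 0 ≤ P := (norm_nonneg _).trans (hP (((0 : ℝ) : ℂ) + (0 : ℝ) * Complex.I)
    (by simp [Complex.mem_reProdIm]; exact ⟨hw0, hT⟩))
  have hpi : 2 ≤ √(2 * Real.pi) := by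
    refine Real.le_sqrt_of_sq_le ?_
    linarith [Real.pi_gt_three]
  have hpi0 : 0 < √(2 * Real.pi) := by linarith
  have s1 : √(Real.pi / (h ^ 2 / 4)) ≤ 3 / 2 * (√(2 * Real.pi) / h) := by
    refine Real.sqrt_le_iff.mpr ⟨by positivity, ?_⟩
    rw [mul_pow, div_pow (√(2 * Real.pi)), Real.sq_sqrt (by positivity)]
    have : Real.pi / (h ^ 2 / 4) = 4 * (Real.pi / h ^ 2) := by field_simp
    rw [this, mul_div_assoc]
    have : 0 < Real.pi / h ^ 2 := by positivity
    nlinarith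
  have s2 : √(Real.pi / (h ^ 2 / 2)) = √(2 * Real.pi) / h := by
    have : Real.pi / (h ^ 2 / 2) = 2 * Real.pi / h ^ 2 := by field_simp
    rw [this, Real.sqrt_div (by positivity), Real.sqrt_sq hh.le]
  have s3 : 1 ≤ 1 / 2 * (√(2 * Real.pi) / h) := by
    have : √(2 * Real.pi) ≤ √(2 * Real.pi) / h := by
      rw [le_div_iff₀ hh]
      nlinarith
    linarith
  set q := √(2 * Real.pi) / h with hq
  have hq0 : 0 < q := by positivity
  have hhalf : Real.exp (1 / 2) ≤ 2 := by
    have h1 : Real.exp (1 / 2) ^ 2 = Real.exp 1 := by rw [← Real.exp_nat_mul]; norm_num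
    have h2 := Real.exp_one_lt_d9
    nlinarith [Real.exp_pos (1 / 2)]
  have hq2 : q * ‖S‖ ≤ ‖J‖ + ‖J - (q : ℂ) * S‖ := by
    have : ‖(q : ℂ) * S‖ = q * ‖S‖ := by
      rw [norm_mul, Complex.norm_real, Real.norm_of_nonneg hq0.le]
    rw [← this]
    have := norm_sub_le J (J - (q : ℂ) * S)
    rwa [sub_sub_cancel] at this
  have ee1 : Real.exp (y + 1 / 2) * Real.exp (-(h ^ 2 * T ^ 2 / 4)) ≤
      2 * Real.exp (y - h ^ 2 * T ^ 2 / 4) := by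
    rw [← Real.exp_add]
    have : y + 1 / 2 + -(h ^ 2 * T ^ 2 / 4) = 1 / 2 + (y - h ^ 2 * T ^ 2 / 4) := by ring
    rw [this, Real.exp_add]
    gcongr
  have ee2 : Real.exp (-(w * y) + 1 / 2) ≤ 2 * Real.exp (-(w * y)) := by
    rw [add_comm, Real.exp_add]
    gcongr
  set E₁ := Real.exp (y - h ^ 2 * T ^ 2 / 4) with hE₁
  set E₂ := Real.exp (-(w * y)) with hE₂
  have hE₁0 : 0 < E₁ := Real.exp_pos _
  have hE₂0 : 0 < E₂ := Real.exp_pos _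
  have j1 : ‖J - (q : ℂ) * S‖ ≤ B * (2 * E₁ * (3 / 2 * q)) := by
    refine i1.trans ?_
    gcongr
  have j2 : ‖J‖ ≤ P * (2 * E₂ * q) + 4 * (P * (2 * E₁)) * (1 / 2 * q) := by
    refine i2.trans ?_
    rw [s2]
    refine add_le_add (by gcongr) ?_
    calc 4 * (P * (Real.exp (y + 1 / 2) * Real.exp (-(h ^ 2 * T ^ 2 / 4))))
        ≤ 4 * (P * (2 * E₁)) := by gcongr
      _ ≤ 4 * (P * (2 * E₁)) * (1 / 2 * q) := le_mul_of_one_le_right (by positivity) s3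
  have : q * ‖S‖ ≤ q * (4 * (B + P) * (E₁ + E₂)) := by
    have k1 : 0 ≤ q * (B * E₁) := by positivity
    have k2 : 0 ≤ q * (B * E₂) := by positivity
    have k3 : 0 ≤ q * (P * E₂) := by positivity
    linarith
  exact le_of_mul_le_mul_left this hq0

end SmoothedSum

section Unsmoothing
open MeasureTheory

/-- The centred normal density of standard deviation `h`. -/
noncomputable def gaussKer (h z : ℝ) : ℝ :=
  (√(2 * Real.pi) * h)⁻¹ * Real.exp (-(z ^ 2 / (2 * h ^ 2)))

theorem gaussKer_nonneg {h : ℝ} (hh : 0 < h) (z : ℝ) : 0 ≤ gaussKer h z := by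
  unfold gaussKer
  positivity

theorem continuous_gaussKer_sub (h x : ℝ) : Continuous fun y => gaussKer h (y - x) := by
  unfold gaussKer
  fun_prop

theorem integrable_exp_neg_sq_sub {c : ℝ} (hc : 0 < c) (x : ℝ) :
    Integrable fun y : ℝ => Real.exp (-(c * (y - x) ^ 2)) := by
  have := (integrable_exp_neg_mul_sq hc).comp_sub_right x
  simpa only [neg_mul] using this

theorem integral_exp_neg_sq_sub (c x : ℝ) :
    ∫ y : ℝ, Real.exp (-(c * (y - x) ^ 2)) = √(Real.pi / c) := by
  have := integral_sub_right_eq_self (μ := volume) (fun y : ℝ => Real.exp (-c * y ^ 2)) x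
  rw [integral_gaussian] at this
  simpa only [neg_mul] using this

theorem gaussKer_eq (h z : ℝ) : gaussKer h z =
    (√(2 * Real.pi) * h)⁻¹ * Real.exp (-(1 / (2 * h ^ 2) * z ^ 2)) := by
  rw [gaussKer]
  congr 3
  ring

theorem integrable_gaussKer_sub {h : ℝ} (hh : 0 < h) (x : ℝ) :
    Integrable fun y => gaussKer h (y - x) := by
  simp_rw [gaussKer_eq]
  exact (integrable_exp_neg_sq_sub (by positivity) x).const_mul _

theorem integral_gaussKer_sub {h : ℝ} (hh : 0 < h) (x : ℝ) :
    ∫ y, gaussKer h (y - x) = 1 := by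
  simp_rw [gaussKer_eq]
  rw [integral_const_mul, integral_exp_neg_sq_sub]
  have : Real.pi / (1 / (2 * h ^ 2)) = (2 * Real.pi) * h ^ 2 := by field_simp
  rw [this, Real.sqrt_mul (x := 2 * Real.pi) (by positivity), Real.sqrt_sq hh.le]
  exact inv_mul_cancel₀ (by positivity)

theorem setIntegral_gaussKer_sub_le {h D x : ℝ} (hh : 0 < h) {A : Set ℝ}
    (hA : MeasurableSet A) (hD : 0 ≤ D)
    (hle : ∀ y ∈ A, Real.exp (-((y - x) ^ 2 / (2 * h ^ 2))) ≤
      D * Real.exp (-(1 / (8 * h ^ 2) * (y - x) ^ 2))) :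
    ∫ y in A, gaussKer h (y - x) ≤ 2 * D := by
  have hint : Integrable fun y : ℝ => (√(2 * Real.pi) * h)⁻¹ *
      (D * Real.exp (-(1 / (8 * h ^ 2) * (y - x) ^ 2))) :=
    ((integrable_exp_neg_sq_sub (by positivity) x).const_mul _).const_mul _
  refine (setIntegral_mono_on (integrable_gaussKer_sub hh x).integrableOn hint.integrableOn hA
    fun y hy => mul_le_mul_of_nonneg_left (hle y hy) (by positivity)).trans
    ((setIntegral_le_integral hint (Filter.Eventually.of_forall fun y => by positivity)).trans
    (le_of_eq ?_))
  rw [integral_const_mul, integral_const_mul, integral_exp_neg_sq_sub]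
  have : Real.pi / (1 / (8 * h ^ 2)) = (2 * Real.pi) * (2 * h) ^ 2 := by field_simp; norm_num
  rw [this, Real.sqrt_mul (x := 2 * Real.pi) (by positivity), Real.sqrt_sq (by positivity)]
  field_simp

theorem exp_neg_sq_le_of_le_abs {h κ z m : ℝ} (hh : 0 < h) (hh1 : h ≤ 1) (hκ : 0 ≤ κ)
    (hz : κ ≤ |z|) (hm : z ≤ m ∨ 0 ≤ m) :
    Real.exp (-(z ^ 2 / (2 * h ^ 2))) ≤ Real.exp (-(κ ^ 2 / (4 * h ^ 2)) + (m + 2)) *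
      Real.exp (-(1 / (8 * h ^ 2) * z ^ 2)) := by
  rw [← Real.exp_add]
  refine Real.exp_le_exp.mpr ?_
  have h2 : 0 < h ^ 2 := by positivity
  have h3 : h ^ 2 ≤ 1 := pow_le_one₀ hh.le hh1
  have hsq : κ ^ 2 ≤ z ^ 2 := by
    rw [← sq_abs z]
    exact pow_le_pow_left₀ hκ hz 2
  have i1 : κ ^ 2 / (4 * h ^ 2) ≤ z ^ 2 / (4 * h ^ 2) := by gcongr
  have e1 : z ^ 2 / (2 * h ^ 2) = z ^ 2 / (4 * h ^ 2) + 2 * (1 / (8 * h ^ 2) * z ^ 2) := by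
    field_simp
    ring
  have i2 : 0 ≤ 1 / (8 * h ^ 2) * z ^ 2 := by positivity
  have i3 : 0 ≤ 1 / (8 * h ^ 2) * z ^ 2 + z + 2 * h ^ 2 := by
    have : 1 / (8 * h ^ 2) * z ^ 2 + z + 2 * h ^ 2 = (z + 4 * h ^ 2) ^ 2 / (8 * h ^ 2) := by
      field_simp
      ring
    rw [this]
    positivity
  rcases hm with hm | hm <;> linarith

theorem abs_indicator_sub_integral_gaussKer_le {h κ α β : ℝ} (hh : 0 < h) (hh1 : h ≤ 1)
    (hκ : 0 < κ) (hαβ : α ≤ β) (x : ℝ) :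
    |(Set.Ico α β).indicator 1 x - ∫ y in α..β, gaussKer h (y - x)| ≤
      (if |x - α| < κ then 1 else 0) + (if |x - β| < κ then 1 else 0) +
      2 * Real.exp (-(κ ^ 2 / (4 * h ^ 2)) + (β - x + 2)) := by
  have hint := integrable_gaussKer_sub hh x
  rw [intervalIntegral.integral_of_le hαβ]
  set v := ∫ y in Set.Ioc α β, gaussKer h (y - x) with hv
  have hcompl := integral_add_compl (measurableSet_Ioc (a := α) (b := β)) hint
  rw [integral_gaussKer_sub hh, ← hv] at hcompl
  have hv0 : 0 ≤ v := integral_nonneg fun y => gaussKer_nonneg hh _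
  have hv1 : 0 ≤ ∫ y in (Set.Ioc α β)ᶜ, gaussKer h (y - x) :=
    integral_nonneg fun y => gaussKer_nonneg hh _
  have hE := Real.exp_pos (-(κ ^ 2 / (4 * h ^ 2)) + (β - x + 2))
  have hcrude : |(Set.Ico α β).indicator 1 x - v| ≤ 1 := by
    rw [abs_le]
    by_cases hx : x ∈ Set.Ico α β
    · rw [Set.indicator_of_mem hx, Pi.one_apply]
      constructor <;> linarith
    · rw [Set.indicator_of_notMem hx]
      constructor <;> linarith
  by_cases h1 : |x - α| < κ
  · rw [if_pos h1]
    have : (0 : ℝ) ≤ if |x - β| < κ then 1 else 0 := by split_ifs <;> norm_num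
    linarith
  by_cases h2 : |x - β| < κ
  · rw [if_pos h2, if_neg h1]
    linarith
  rw [if_neg h1, if_neg h2, zero_add, zero_add]
  rw [not_lt, le_abs] at h1 h2
  by_cases hx : x ∈ Set.Ico α β
  · rw [Set.indicator_of_mem hx, Pi.one_apply]
    have hx1 : α + κ ≤ x := by
      rcases h1 with h1 | h1
      · linarith
      · linarith [hx.1]
    have hx2 : x + κ ≤ β := by
      rcases h2 with h2 | h2
      · linarith [hx.2]
      · linarith
    have e : 1 - v = ∫ y in (Set.Ioc α β)ᶜ, gaussKer h (y - x) := by linarith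
    rw [e, abs_of_nonneg hv1]
    refine setIntegral_gaussKer_sub_le hh measurableSet_Ioc.compl hE.le fun y hy =>
      exp_neg_sq_le_of_le_abs hh hh1 hκ.le ?_ (Or.inr (by linarith))
    rw [le_abs]
    by_contra hcon
    push Not at hcon
    exact hy ⟨by linarith, by linarith⟩
  · rw [Set.indicator_of_notMem hx, zero_sub, abs_neg, abs_of_nonneg hv0]
    refine setIntegral_gaussKer_sub_le hh measurableSet_Ioc hE.le fun y hy =>
      exp_neg_sq_le_of_le_abs hh hh1 hκ.le ?_ (Or.inl (by linarith [hy.2]))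
    rw [le_abs]
    by_contra hcon
    push Not at hcon
    refine hx ⟨?_, ?_⟩
    · rcases h1 with h1 | h1
      · linarith
      · linarith [hy.1]
    · rcases h2 with h2 | h2
      · linarith [hy.2]
      · linarith

theorem norm_tsum_mul_integral_gaussKer_le {b : ℕ → ℂ} (hb0 : b 0 = 0)
    (hb : Summable fun n : ℕ => ‖b n‖ / n) {h α β ε : ℝ} (hh : 0 < h) (hh1 : h ≤ 1)
    (hαβ : α ≤ β)
    (hε : ∀ y ∈ Set.Icc α β,
      ‖∑' n : ℕ, b n * (Real.exp (-((y - Real.log n) ^ 2 / (2 * h ^ 2))) : ℝ)‖ ≤ ε) :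
    (Summable fun n : ℕ => b n * ((∫ y in α..β, gaussKer h (y - Real.log n) : ℝ) : ℂ)) ∧
    ‖∑' n : ℕ, b n * ((∫ y in α..β, gaussKer h (y - Real.log n) : ℝ) : ℂ)‖ ≤
      (β - α) * (ε / h) := by
  have hterm : ∀ y : ℝ, ∀ n : ℕ,
      ‖b n * (Real.exp (-((y - Real.log n) ^ 2 / (2 * h ^ 2))) : ℝ)‖ ≤
      ‖b n‖ / n * Real.exp (y + 1 / 2) := by
    intro y n
    rcases eq_or_ne n 0 with rfl | hn
    · simp [hb0]
    rw [norm_mul, Complex.norm_real, Real.norm_of_nonneg (Real.exp_pos _).le,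
      div_mul_eq_mul_div, mul_div_assoc, ← exp_sub_log_eq hn]
    exact mul_le_mul_of_nonneg_left (exp_neg_sq_le hh hh1 _) (norm_nonneg _)
  set q := (√(2 * Real.pi) * h)⁻¹ with hq
  have hq0 : 0 < q := by positivity
  have hqh : q ≤ 1 / h := by
    rw [hq, ← one_div]
    refine one_div_le_one_div_of_le hh (le_mul_of_one_le_left hh.le ?_)
    refine Real.le_sqrt_of_sq_le ?_
    linarith [Real.pi_gt_three]
  have key : HasSum (fun n : ℕ => ∫ y in α..β, b n * ((gaussKer h (y - Real.log n) : ℝ) : ℂ))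
      (∫ y in α..β, (q : ℂ) *
        ∑' n : ℕ, b n * (Real.exp (-((y - Real.log n) ^ 2 / (2 * h ^ 2))) : ℝ)) := by
    refine intervalIntegral.hasSum_integral_of_dominated_convergence
      (fun n _ => q * (‖b n‖ / n * Real.exp (β + 1 / 2)))
      (fun n => (((Complex.continuous_ofReal.comp
        (continuous_gaussKer_sub h _))).const_mul _).aestronglyMeasurable)
      (fun n => Filter.Eventually.of_forall fun y hy => ?_)
      (Filter.Eventually.of_forall fun y _ => (hb.mul_right _).mul_left _)
      intervalIntegrable_const
      (Filter.Eventually.of_forall fun y _ => ?_)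
    · rw [Set.uIoc_of_le hαβ] at hy
      have e : b n * ((gaussKer h (y - Real.log n) : ℝ) : ℂ) =
          (q : ℂ) * (b n * (Real.exp (-((y - Real.log n) ^ 2 / (2 * h ^ 2))) : ℝ)) := by
        rw [gaussKer, ← hq, Complex.ofReal_mul]
        ring
      rw [e, norm_mul, Complex.norm_real, Real.norm_of_nonneg hq0.le]
      refine mul_le_mul_of_nonneg_left ((hterm y n).trans ?_) hq0.le
      refine mul_le_mul_of_nonneg_left (Real.exp_le_exp.mpr (by linarith [hy.2])) (by positivity)
    · have hs : Summable fun n : ℕ =>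
          b n * (Real.exp (-((y - Real.log n) ^ 2 / (2 * h ^ 2))) : ℝ) :=
        Summable.of_norm_bounded (hb.mul_right _) (hterm y)
      refine (hs.hasSum.mul_left (q : ℂ)).congr_fun fun n => ?_
      rw [gaussKer, ← hq, Complex.ofReal_mul]
      ring
  simp_rw [intervalIntegral.integral_const_mul, intervalIntegral.integral_ofReal] at key
  refine ⟨key.summable, ?_⟩
  rw [key.tsum_eq, norm_mul, Complex.norm_real, Real.norm_of_nonneg hq0.le]
  have hε0 : 0 ≤ ε := (norm_nonneg _).trans (hε α ⟨le_rfl, hαβ⟩)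
  have := intervalIntegral.norm_integral_le_of_norm_le_const (a := α) (b := β) (C := ε)
    (f := fun y => ∑' n : ℕ, b n * (Real.exp (-((y - Real.log n) ^ 2 / (2 * h ^ 2))) : ℝ))
    (fun y hy => by
      rw [Set.uIoc_of_le hαβ] at hy
      exact hε y ⟨hy.1.le, hy.2⟩)
  rw [abs_of_nonneg (by linarith)] at this
  calc _ ≤ 1 / h * (ε * (β - α)) := by gcongr
    _ = _ := by ring

end Unsmoothing

section Unsmoothing

theorem exp_sub_exp_neg_le {κ : ℝ} (hκ : 0 ≤ κ) (hκ1 : κ ≤ 1 / 2) :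
    Real.exp κ - Real.exp (-κ) ≤ 3 * κ := by
  have h1 := abs_le.mp (Real.abs_exp_sub_one_sub_id_le (x := κ)
    (by rw [abs_of_nonneg hκ]; linarith))
  have h2 := Real.add_one_le_exp (-κ)
  nlinarith

theorem tsum_norm_mul_edge_le {b : ℕ → ℂ} (hb0 : b 0 = 0) {L α κ : ℝ} (hκ : 0 ≤ κ)
    (hκ1 : κ ≤ 1 / 2) (hL0 : 0 ≤ L)
    (hL : ∀ n : ℕ, n ≠ 0 → (n : ℝ) ≤ 2 * Real.exp α → ‖b n‖ ≤ L / n) :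
    (Summable fun n : ℕ => ‖b n‖ * if |Real.log n - α| < κ then (1 : ℝ) else 0) ∧
    ∑' n : ℕ, ‖b n‖ * (if |Real.log n - α| < κ then (1 : ℝ) else 0) ≤
      2 * L * (3 * κ + Real.exp (-α)) := by
  have hk2 : Real.exp κ ≤ 2 := by
    have h1 : Real.exp (1 / 2) ^ 2 = Real.exp 1 := by rw [← Real.exp_nat_mul]; norm_num
    have h2 := Real.exp_one_lt_d9
    have h3 : Real.exp κ ≤ Real.exp (1 / 2) := Real.exp_le_exp.mpr hκ1
    nlinarith [Real.exp_pos (1 / 2)]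
  set s := Finset.Ioc ⌊Real.exp (α - κ)⌋₊ ⌊Real.exp (α + κ)⌋₊ with hs
  have hmem : ∀ n : ℕ, n ≠ 0 → |Real.log n - α| < κ → n ∈ s ∧
      Real.exp (α - κ) < n ∧ (n : ℝ) ≤ Real.exp (α + κ) := by
    intro n hn h
    have hn' : (0 : ℝ) < n := by exact_mod_cast Nat.pos_of_ne_zero hn
    have h' := abs_lt.mp h
    have h1 : Real.exp (α - κ) < n := by
      rw [← Real.lt_log_iff_exp_lt hn']
      linarith
    have h2 : (n : ℝ) ≤ Real.exp (α + κ) := by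
      rw [← Real.log_le_iff_le_exp hn']
      linarith
    refine ⟨Finset.mem_Ioc.mpr ⟨?_, Nat.le_floor h2⟩, h1, h2⟩
    exact (Nat.floor_lt (Real.exp_pos _).le).mpr h1
  have hzero : ∀ n ∉ s, ‖b n‖ * (if |Real.log n - α| < κ then (1 : ℝ) else 0) = 0 := by
    intro n hn
    rcases eq_or_ne n 0 with rfl | hn0
    · simp [hb0]
    rw [if_neg fun h => hn (hmem n hn0 h).1, mul_zero]
  refine ⟨summable_of_ne_finset_zero hzero, ?_⟩
  rw [tsum_eq_sum hzero]
  have hterm : ∀ n ∈ s, ‖b n‖ * (if |Real.log n - α| < κ then (1 : ℝ) else 0) ≤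
      2 * L * Real.exp (-α) := by
    intro n _
    have hpos : 0 ≤ 2 * L * Real.exp (-α) := by positivity
    rcases eq_or_ne n 0 with rfl | hn0
    · simpa [hb0] using hpos
    split_ifs with h
    · obtain ⟨-, h1, h2⟩ := hmem n hn0 h
      rw [mul_one]
      refine (hL n hn0 (h2.trans ?_)).trans ?_
      · rw [Real.exp_add, mul_comm]
        gcongr
      · calc L / n ≤ L / Real.exp (α - κ) := by gcongr
          _ = L * Real.exp κ * Real.exp (-α) := by
            rw [div_eq_mul_inv, ← Real.exp_neg, mul_assoc, ← Real.exp_add]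
            congr 2
            ring
          _ ≤ L * 2 * Real.exp (-α) := by gcongr
          _ = _ := by ring
    · rw [mul_zero]
      exact hpos
  refine (Finset.sum_le_card_nsmul s _ _ hterm).trans ?_
  have hle : ⌊Real.exp (α - κ)⌋₊ ≤ ⌊Real.exp (α + κ)⌋₊ :=
    Nat.floor_le_floor (Real.exp_le_exp.mpr (by linarith))
  have hcard : (s.card : ℝ) ≤ 3 * κ * Real.exp α + 1 := by
    rw [hs, Nat.card_Ioc, Nat.cast_sub hle]
    have h1 := Nat.floor_le (Real.exp_pos (α + κ)).le
    have h2 := Nat.lt_floor_add_one (Real.exp (α - κ))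
    have h3 := exp_sub_exp_neg_le hκ hκ1
    rw [sub_eq_add_neg α κ] at h2
    rw [Real.exp_add] at h1 h2
    have h4 : Real.exp α * (Real.exp κ - Real.exp (-κ)) ≤ Real.exp α * (3 * κ) :=
      mul_le_mul_of_nonneg_left h3 (Real.exp_pos _).le
    have e : α - κ = α + -κ := sub_eq_add_neg α κ
    rw [e, Real.exp_add α κ, Real.exp_add α (-κ)]
    linarith
  rw [nsmul_eq_mul]
  have hinv : Real.exp α * Real.exp (-α) = 1 := by rw [← Real.exp_add]; simp
  calc (s.card : ℝ) * (2 * L * Real.exp (-α)) ≤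
        (3 * κ * Real.exp α + 1) * (2 * L * Real.exp (-α)) := by gcongr
    _ = 2 * L * (3 * κ * (Real.exp α * Real.exp (-α)) + Real.exp (-α)) := by ring
    _ = _ := by rw [hinv, mul_one]

theorem norm_sum_Ico_ceil_le {b : ℕ → ℂ} (hb0 : b 0 = 0)
    (hb : Summable fun n : ℕ => ‖b n‖ / n) {h κ a c L ε : ℝ} (hh : 0 < h) (hh1 : h ≤ 1)
    (hκ : 0 < κ) (hκ1 : κ ≤ 1 / 2) (ha : 1 ≤ a) (hac : a ≤ c) (hL0 : 0 ≤ L)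
    (hL : ∀ n : ℕ, n ≠ 0 → (n : ℝ) ≤ 2 * c → ‖b n‖ ≤ L / n)
    (hε : ∀ y ∈ Set.Icc (Real.log a) (Real.log c),
      ‖∑' n : ℕ, b n * (Real.exp (-((y - Real.log n) ^ 2 / (2 * h ^ 2))) : ℝ)‖ ≤ ε) :
    ‖∑ n ∈ Finset.Ico ⌈a⌉₊ ⌈c⌉₊, b n‖ ≤ (Real.log c - Real.log a) * (ε / h) +
      4 * L * (3 * κ + 1 / a) +
      2 * (Real.exp (-(κ ^ 2 / (4 * h ^ 2)) + 2) * c * ∑' n : ℕ, ‖b n‖ / n) := by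
  have ha0 : 0 < a := by linarith
  have hc0 : 0 < c := by linarith
  set α := Real.log a with hα
  set β := Real.log c with hβ
  have hαβ : α ≤ β := Real.log_le_log ha0 hac
  have hexpα : Real.exp α = a := Real.exp_log ha0
  have hexpβ : Real.exp β = c := Real.exp_log hc0
  obtain ⟨hsv, hv⟩ := norm_tsum_mul_integral_gaussKer_le hb0 hb hh hh1 hαβ hε
  set ind : ℕ → ℝ := fun n => (Set.Ico α β).indicator 1 (Real.log n) with hind
  set v : ℕ → ℝ := fun n => ∫ y in α..β, gaussKer h (y - Real.log n) with hvdef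
  have hindsum : HasSum (fun n : ℕ => b n * (ind n : ℂ)) (∑ n ∈ Finset.Ico ⌈a⌉₊ ⌈c⌉₊, b n) := by
    have e : ∑ n ∈ Finset.Ico ⌈a⌉₊ ⌈c⌉₊, b n =
        ∑ n ∈ Finset.Ico ⌈a⌉₊ ⌈c⌉₊, b n * (ind n : ℂ) := by
      refine Finset.sum_congr rfl fun n hn => ?_
      rw [Finset.mem_Ico, Nat.ceil_le, Nat.lt_ceil] at hn
      have hn0 : (0 : ℝ) < n := by linarith
      have : Real.log n ∈ Set.Ico α β :=
        ⟨Real.log_le_log ha0 hn.1, Real.log_lt_log hn0 hn.2⟩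
      simp [hind, Set.indicator_of_mem this]
    rw [e]
    refine hasSum_sum_of_ne_finset_zero fun n hn => ?_
    rcases eq_or_ne n 0 with rfl | hn0
    · simp [hb0]
    have hn' : (0 : ℝ) < n := by exact_mod_cast Nat.pos_of_ne_zero hn0
    have : Real.log n ∉ Set.Ico α β := by
      rintro ⟨h1, h2⟩
      refine hn ?_
      rw [Finset.mem_Ico, Nat.ceil_le, Nat.lt_ceil]
      exact ⟨(Real.log_le_log_iff ha0 hn').mp h1, (Real.log_lt_log_iff hn' hc0).mp h2⟩
    simp [hind, Set.indicator_of_notMem this]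
  obtain ⟨hs1, ht1⟩ := tsum_norm_mul_edge_le (b := b) hb0 (α := α) hκ.le hκ1 hL0
    (fun n hn hle => hL n hn (by rw [hexpα] at hle; linarith))
  obtain ⟨hs2, ht2⟩ := tsum_norm_mul_edge_le (b := b) hb0 (α := β) hκ.le hκ1 hL0
    (fun n hn hle => hL n hn (by rwa [hexpβ] at hle))
  set E := 2 * (Real.exp (-(κ ^ 2 / (4 * h ^ 2)) + 2) * c) with hE
  have hdiff := hindsum.sub hsv.hasSum
  have hbound := tsum_of_norm_bounded ((hs1.hasSum.add hs2.hasSum).add (hb.hasSum.mul_left E))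
    (f := fun n => b n * (ind n : ℂ) - b n * (v n : ℂ)) (fun n => by
      rcases eq_or_ne n 0 with rfl | hn0
      · simp [hb0]
      have hn' : (0 : ℝ) < n := by exact_mod_cast Nat.pos_of_ne_zero hn0
      rw [← mul_sub, ← Complex.ofReal_sub, norm_mul, Complex.norm_real, Real.norm_eq_abs]
      have := abs_indicator_sub_integral_gaussKer_le hh hh1 hκ hαβ (Real.log n)
      have e2 : 2 * Real.exp (-(κ ^ 2 / (4 * h ^ 2)) + (β - Real.log n + 2)) = E / n := by
        have e3 : -(κ ^ 2 / (4 * h ^ 2)) + (β - Real.log n + 2) =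
          (-(κ ^ 2 / (4 * h ^ 2)) + 2) + β - Real.log n := by ring
        rw [e3, Real.exp_sub, Real.exp_add _ β, hexpβ, Real.exp_log hn', hE]
        ring
      rw [e2] at this
      calc ‖b n‖ * |ind n - v n| ≤ ‖b n‖ * _ := mul_le_mul_of_nonneg_left this (norm_nonneg _)
        _ = _ := by ring)
  rw [hdiff.tsum_eq] at hbound
  have hge := norm_sub_norm_le (∑ n ∈ Finset.Ico ⌈a⌉₊ ⌈c⌉₊, b n) (∑' n : ℕ, b n * (v n : ℂ))
  rw [Real.exp_neg, hexpα, ← one_div] at ht1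
  rw [Real.exp_neg, hexpβ, ← one_div] at ht2
  have hca : 1 / c ≤ 1 / a := one_div_le_one_div_of_le ha0 hac
  have ht2' : 2 * L * (3 * κ + 1 / c) ≤ 2 * L * (3 * κ + 1 / a) := by gcongr
  have e4 : 2 * (Real.exp (-(κ ^ 2 / (4 * h ^ 2)) + 2) * c * ∑' n : ℕ, ‖b n‖ / n) =
      E * ∑' n : ℕ, ‖b n‖ / n := by rw [hE]; ring
  rw [e4]
  have hv' : ‖∑' n : ℕ, b n * (v n : ℂ)‖ ≤ (β - α) * (ε / h) := hv
  linarith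

end Unsmoothing

section ZetaSeries

/-- A real Dirichlet series with coefficients bounded by `log n + 1` that continues to the
Vinogradov–Korobov region of `ζ`, with polynomial bounds there. -/
structure IsZetaSeries (a : ℕ → ℝ) (F : ℂ → ℂ) : Prop where
  abs_le : ∀ n : ℕ, |a n| ≤ Real.log n + 1
  hasSum : ∀ s : ℂ, 1 < s.re → LSeriesHasSum (fun n => (a n : ℂ)) s (F s)
  region : ∃ V₀ : ℝ, ∀ V ≥ V₀, ∀ σ y : ℝ,
    1 - 1 / (100000 * V ^ 7 * Real.log V) ≤ σ → σ ≤ 2 →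
    Real.exp ((10 ^ 9) ^ 8) + 2 ≤ y → 2 * y + 3 ≤ Real.exp (V ^ 8) →
    DifferentiableAt ℂ F ((σ : ℂ) + y * Complex.I) ∧
    ‖F ((σ : ℂ) + y * Complex.I)‖ ≤ V ^ 240

theorem add_mul_I_ne_one {σ y : ℝ} (hy : Real.exp ((10 ^ 9) ^ 8) + 2 ≤ y) :
    (σ : ℂ) + y * Complex.I ≠ 1 := by
  intro h
  have := congrArg Complex.im h
  have h2 := Real.exp_pos ((10 ^ 9) ^ 8)
  simp at this
  linarith

theorem differentiableAt_deriv_riemannZeta {s : ℂ} (hs : s ≠ 1) :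
    DifferentiableAt ℂ (deriv riemannZeta) s := by
  have ho : IsOpen ({1}ᶜ : Set ℂ) := isOpen_compl_singleton
  have h : DifferentiableOn ℂ riemannZeta {1}ᶜ := fun z hz =>
    (differentiableAt_riemannZeta hz).differentiableWithinAt
  exact (h.deriv ho).differentiableAt (ho.mem_nhds hs)

theorem isZetaSeries_one : IsZetaSeries (fun _ => 1) riemannZeta := by
  obtain ⟨V₀, hV0, h⟩ := exists_zeta_bounds
  refine ⟨fun n => ?_, fun s hs => ?_, V₀, fun V hV σ y h1 h2 h3 h4 => ?_⟩
  · rw [abs_one]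
    linarith [Real.log_natCast_nonneg n]
  · have := LSeriesHasSum_one hs
    convert this using 2
    simp
  · obtain ⟨-, hb, -, -⟩ := h V hV σ y h1 h2 h3 h4
    exact ⟨differentiableAt_riemannZeta (add_mul_I_ne_one h3),
      hb.trans (pow_le_pow_right₀ (hV0.trans hV) (by norm_num))⟩

theorem isZetaSeries_log : IsZetaSeries (fun n => Real.log n) fun s => -deriv riemannZeta s := by
  obtain ⟨V₀, hV0, h⟩ := exists_zeta_bounds
  refine ⟨fun n => ?_, fun s hs => ?_, V₀, fun V hV σ y h1 h2 h3 h4 => ?_⟩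
  · rw [abs_of_nonneg (Real.log_natCast_nonneg n)]
    linarith
  · have habs : LSeries.abscissaOfAbsConv 1 < (s.re : EReal) := by
      rw [LSeries.abscissaOfAbsConv_one]
      exact_mod_cast hs
    have h1 := LSeries_deriv habs
    have h2 := (LSeriesSummable_logMul_of_lt_re habs).LSeriesHasSum
    have h3 : deriv (LSeries 1) s = deriv riemannZeta s := by
      refine Filter.EventuallyEq.deriv_eq ?_
      filter_upwards [(isOpen_lt continuous_const Complex.continuous_re).mem_nhds hs] with z hz
      exact LSeries_one_eq_riemannZeta hz
    rw [← h3, h1, neg_neg]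
    have e : (fun n : ℕ => ((Real.log n : ℝ) : ℂ)) = LSeries.logMul 1 := by
      funext n
      simp [LSeries.logMul, Complex.natCast_log]
    rw [e]
    exact h2
  · obtain ⟨-, -, -, hb⟩ := h V hV σ y h1 h2 h3 h4
    refine ⟨(differentiableAt_deriv_riemannZeta (add_mul_I_ne_one h3)).neg, ?_⟩
    rw [norm_neg]
    exact hb.trans (pow_le_pow_right₀ (hV0.trans hV) (by norm_num))

theorem isZetaSeries_moebius :
    IsZetaSeries (fun n => ((ArithmeticFunction.moebius n : ℤ) : ℝ)) fun s =>
      (riemannZeta s)⁻¹ := by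
  obtain ⟨V₀, hV0, h⟩ := exists_zeta_bounds
  refine ⟨fun n => ?_, fun s hs => ?_, V₀, fun V hV σ y h1 h2 h3 h4 => ?_⟩
  · have : |((ArithmeticFunction.moebius n : ℤ) : ℝ)| ≤ 1 := by
      exact_mod_cast ArithmeticFunction.abs_moebius_le_one
    linarith [Real.log_natCast_nonneg n]
  · have h1 := LSeries_one_mul_Lseries_moebius hs
    rw [LSeries_one_eq_riemannZeta hs] at h1
    rw [← eq_inv_of_mul_eq_one_right h1]
    have h2 := (ArithmeticFunction.LSeriesSummable_moebius_iff.mpr hs).LSeriesHasSum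
    simpa using h2
  · obtain ⟨h0, -, hb, -⟩ := h V hV σ y h1 h2 h3 h4
    exact ⟨(differentiableAt_riemannZeta (add_mul_I_ne_one h3)).inv h0,
      hb.trans (pow_le_pow_right₀ (hV0.trans hV) (by norm_num))⟩

theorem isZetaSeries_vonMangoldt :
    IsZetaSeries (fun n => ArithmeticFunction.vonMangoldt n) fun s =>
      -deriv riemannZeta s / riemannZeta s := by
  obtain ⟨V₀, hV0, h⟩ := exists_zeta_bounds
  refine ⟨fun n => ?_, fun s hs => ?_, V₀, fun V hV σ y h1 h2 h3 h4 => ?_⟩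
  · rw [abs_of_nonneg ArithmeticFunction.vonMangoldt_nonneg]
    linarith [ArithmeticFunction.vonMangoldt_le_log (n := n)]
  · rw [← ArithmeticFunction.LSeries_vonMangoldt_eq_deriv_riemannZeta_div hs]
    exact (ArithmeticFunction.LSeriesSummable_vonMangoldt hs).LSeriesHasSum
  · obtain ⟨h0, -, hb, hb2⟩ := h V hV σ y h1 h2 h3 h4
    have hne := add_mul_I_ne_one (σ := σ) h3
    refine ⟨(differentiableAt_deriv_riemannZeta hne).neg.div
      (differentiableAt_riemannZeta hne) h0, ?_⟩
    have hV1 : 1 ≤ V := hV0.trans hV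
    rw [div_eq_mul_inv, norm_mul, norm_neg]
    calc _ ≤ V ^ 17 * V ^ 120 := by gcongr
      _ = V ^ 137 := by ring
      _ ≤ V ^ 240 := pow_le_pow_right₀ hV1 (by norm_num)

end ZetaSeries

section ZetaSeriesSums

theorem summable_log_add_one_div_sq :
    Summable fun n : ℕ => (Real.log n + 1) / n / n := by
  have h : Summable fun n : ℕ => 3 * (n : ℝ) ^ (-(3 / 2) : ℝ) :=
    (Real.summable_nat_rpow.mpr (by norm_num)).mul_left 3
  refine Summable.of_nonneg_of_le (fun n => ?_) (fun n => ?_) h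
  · have := Real.log_natCast_nonneg n
    positivity
  · rcases Nat.eq_zero_or_pos n with rfl | hn
    · simp
    have hn1 : (1 : ℝ) ≤ n := by exact_mod_cast hn
    have hn0 : (0 : ℝ) < n := by linarith
    have h1 := Real.log_le_rpow_div hn0.le (show (0 : ℝ) < 1 / 2 by norm_num)
    have h2 : (1 : ℝ) ≤ (n : ℝ) ^ (1 / 2 : ℝ) := Real.one_le_rpow hn1 (by norm_num)
    have e : (n : ℝ) ^ (-(3 / 2) : ℝ) = (n : ℝ) ^ (1 / 2 : ℝ) / n / n := by
      rw [div_div, ← sq, ← Real.rpow_natCast, ← Real.rpow_sub hn0]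
      norm_num
    rw [e, div_div, div_div, ← mul_div_assoc]
    gcongr
    linarith

theorem norm_term_one_add_le {a : ℕ → ℝ} (ha : ∀ n : ℕ, |a n| ≤ Real.log n + 1) (t : ℝ) (n : ℕ) :
    ‖LSeries.term (fun n => (a n : ℂ)) (1 + t * Complex.I) n‖ ≤ (Real.log n + 1) / n := by
  rcases Nat.eq_zero_or_pos n with rfl | hn
  · simp
  rw [LSeries.norm_term_eq, if_neg hn.ne']
  have : ((1 : ℂ) + t * Complex.I).re = 1 := by simp
  rw [this, Real.rpow_one, Complex.norm_real, Real.norm_eq_abs]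
  gcongr
  exact ha n

theorem term_one_add_mul_exp (a : ℕ → ℝ) (t u : ℝ) (n : ℕ) :
    LSeries.term (fun n => (a n : ℂ)) (1 + t * Complex.I) n *
      Complex.exp (-(((1 : ℝ) : ℂ) + u * Complex.I) * Real.log n) =
    LSeries.term (fun n => (a n : ℂ)) (2 + ((t + u : ℝ) : ℂ) * Complex.I) n := by
  rcases Nat.eq_zero_or_pos n with rfl | hn
  · simp
  have hn0 : (n : ℂ) ≠ 0 := by exact_mod_cast hn.ne'
  rw [LSeries.term_of_ne_zero hn.ne', LSeries.term_of_ne_zero hn.ne', div_eq_mul_inv,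
    div_eq_mul_inv, ← Complex.cpow_neg, ← Complex.cpow_neg, Complex.cpow_def_of_ne_zero hn0,
    Complex.cpow_def_of_ne_zero hn0, ← Complex.natCast_log, mul_assoc, ← Complex.exp_add]
  congr 2
  push_cast
  ring

theorem IsZetaSeries.exists_norm_sum_Ico_le {a : ℕ → ℝ} {F : ℂ → ℂ} (H : IsZetaSeries a F) :
    ∃ V₀ B : ℝ, 0 ≤ B ∧ ∀ V ≥ V₀, ∀ w t Q x z : ℝ, 4 ≤ Q → 0 ≤ w → w ≤ 1 →
      w ≤ 1 / (100000 * V ^ 7 * Real.log V) →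
      Real.exp ((10 ^ 9) ^ 8) + 2 ≤ t - Real.exp Q → 2 * (t + Real.exp Q) + 3 ≤ Real.exp (V ^ 8) →
      1 ≤ x → x ≤ z →
      ‖∑ n ∈ Finset.Ico ⌈x⌉₊ ⌈z⌉₊, (a n : ℂ) * (n : ℂ) ^ (-(1 + (t : ℂ) * Complex.I))‖ ≤
        (Real.log z - Real.log x) * (4 * (B + V ^ 240) *
          (z * Real.exp (-(Real.exp Q / 4)) + Real.exp (-(w * Real.log x))) * Real.exp (Q / 2)) +
        4 * (Real.log (2 * z) + 1) * (3 * Real.exp (-(Q / 4)) + 1 / x) +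
        2 * (Real.exp (-(Real.exp (Q / 2) / 4) + 2) * z * B) := by
  obtain ⟨V₀, hV₀⟩ := H.region
  set B : ℝ := ∑' n : ℕ, (Real.log n + 1) / n / n with hB
  have hBs := summable_log_add_one_div_sq
  have hB0 : 0 ≤ B := tsum_nonneg fun n => by
    have := Real.log_natCast_nonneg n
    positivity
  refine ⟨V₀, B, hB0, fun V hV w t Q x z hQ hw0 hw1 hw hlow hhigh hx hxz => ?_⟩
  set b : ℕ → ℂ := LSeries.term (fun n => (a n : ℂ)) (1 + t * Complex.I) with hb
  have hb0 : b 0 = 0 := by simp [hb]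
  have hble : ∀ n, ‖b n‖ ≤ (Real.log n + 1) / n := norm_term_one_add_le H.abs_le t
  have hble' : ∀ n : ℕ, ‖b n‖ / n ≤ (Real.log n + 1) / n / n := fun n =>
    div_le_div_of_nonneg_right (hble n) n.cast_nonneg
  have hbs : Summable fun n : ℕ => ‖b n‖ / n :=
    Summable.of_nonneg_of_le (fun n => by positivity) hble' hBs
  have hbB : ∑' n : ℕ, ‖b n‖ / n ≤ B := hbs.tsum_le_tsum hble' hBs
  have hx0 : 0 < x := by linarith
  have hz0 : 0 < z := by linarith
  have hhh : Real.exp (-(Q / 2)) ^ 2 = Real.exp (-Q) := by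
    rw [← Real.exp_nat_mul]; congr 1; push_cast; ring
  have hkk : Real.exp (-(Q / 4)) ^ 2 = Real.exp (-(Q / 2)) := by
    rw [← Real.exp_nat_mul]; congr 1; push_cast; ring
  have hTT : Real.exp (-Q) * Real.exp Q ^ 2 = Real.exp Q := by
    rw [← Real.exp_nat_mul, ← Real.exp_add]; congr 1; push_cast; ring
  have hkh : Real.exp (-(Q / 4)) ^ 2 / (4 * Real.exp (-(Q / 2)) ^ 2) = Real.exp (Q / 2) / 4 := by
    have e1 : Real.exp (Q / 2) * Real.exp (-(Q / 2)) = 1 := by rw [← Real.exp_add]; simp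
    rw [hkk, div_eq_div_iff (by positivity) (by norm_num)]
    linear_combination (-4 * Real.exp (-(Q / 2))) * e1
  have hk1 : Real.exp (-(Q / 4)) ≤ 1 / 2 := by
    have h1 : Real.exp (-(Q / 4)) ≤ Real.exp (-1) := Real.exp_le_exp.mpr (by linarith)
    have h2 := Real.exp_neg_one_lt_d9
    linarith
  set Φ : ℂ → ℂ := fun u => F ((1 + t * Complex.I) + u) with hΦdef
  have hreg : ∀ u ∈ (Set.Icc (-w) 1 ×ℂ Set.Icc (-Real.exp Q) (Real.exp Q)),
      DifferentiableAt ℂ F ((1 + t * Complex.I) + u) ∧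
        ‖F ((1 + t * Complex.I) + u)‖ ≤ V ^ 240 := by
    intro u hu
    rw [Complex.mem_reProdIm] at hu
    obtain ⟨⟨h1, h2⟩, h3, h4⟩ := hu
    have e : (1 + t * Complex.I) + u =
        ((1 + u.re : ℝ) : ℂ) + ((t + u.im : ℝ) : ℂ) * Complex.I := by
      apply Complex.ext <;> simp
    rw [e]
    exact hV₀ V hV _ _ (by linarith) (by linarith) (by linarith) (by linarith)
  have hΦ : ∀ u : ℝ, HasSum
      (fun n : ℕ => b n * Complex.exp (-(((1 : ℝ) : ℂ) + u * Complex.I) * Real.log n))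
      (Φ (((1 : ℝ) : ℂ) + u * Complex.I)) := by
    intro u
    have h1 := H.hasSum (2 + ((t + u : ℝ) : ℂ) * Complex.I) (by simp)
    have e : (1 + t * Complex.I) + (((1 : ℝ) : ℂ) + u * Complex.I) =
        2 + ((t + u : ℝ) : ℂ) * Complex.I := by push_cast; ring
    simp only [hΦdef, e, hb, term_one_add_mul_exp]
    exact h1
  have hd : DifferentiableOn ℂ Φ (Set.Icc (-w) 1 ×ℂ Set.Icc (-Real.exp Q) (Real.exp Q)) :=
    fun u hu => ((hreg u hu).1.comp u
      ((differentiableAt_const _).add differentiableAt_id)).differentiableWithinAt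
  have hh1 : Real.exp (-(Q / 2)) ≤ 1 := Real.exp_le_one_iff.mpr (by linarith)
  have hV240 : 0 ≤ V ^ 240 := (Even.pow_nonneg (by decide) V)
  have hlogx : 0 ≤ Real.log x := Real.log_nonneg hx
  have hsm : ∀ y ∈ Set.Icc (Real.log x) (Real.log z),
      ‖∑' n : ℕ, b n * (Real.exp (-((y - Real.log n) ^ 2 /
        (2 * Real.exp (-(Q / 2)) ^ 2))) : ℝ)‖ ≤
      4 * (B + V ^ 240) *
        (z * Real.exp (-(Real.exp Q / 4)) + Real.exp (-(w * Real.log x))) := by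
    intro y hy
    have h1 := norm_smoothed_sum_le hb0 hbs (Real.exp_pos (-(Q / 2))) hh1 hΦ hw0 hw1
      (Real.exp_pos Q).le (hlogx.trans hy.1) hd (fun u hu => (hreg u hu).2)
    refine h1.trans ?_
    have h2 : Real.exp (y - Real.exp (-(Q / 2)) ^ 2 * Real.exp Q ^ 2 / 4) ≤
        z * Real.exp (-(Real.exp Q / 4)) := by
      rw [hhh, hTT, sub_eq_add_neg, Real.exp_add]
      gcongr
      rw [← Real.exp_log hz0]
      exact Real.exp_le_exp.mpr hy.2
    have h3 : Real.exp (-(w * y)) ≤ Real.exp (-(w * Real.log x)) :=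
      Real.exp_le_exp.mpr (neg_le_neg (mul_le_mul_of_nonneg_left hy.1 hw0))
    gcongr
  have hlog2 : 0 ≤ Real.log (2 * z) + 1 := by
    have := Real.log_nonneg (show 1 ≤ 2 * z by linarith)
    linarith
  have hmain := norm_sum_Ico_ceil_le hb0 hbs (Real.exp_pos (-(Q / 2))) hh1
    (Real.exp_pos (-(Q / 4))) hk1 hx hxz hlog2 (fun n hn hle => (hble n).trans (by
      have : (0 : ℝ) < n := by exact_mod_cast Nat.pos_of_ne_zero hn
      gcongr)) hsm
  have hsum : ∑ n ∈ Finset.Ico ⌈x⌉₊ ⌈z⌉₊, (a n : ℂ) * (n : ℂ) ^ (-(1 + (t : ℂ) * Complex.I)) =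
      ∑ n ∈ Finset.Ico ⌈x⌉₊ ⌈z⌉₊, b n := by
    refine Finset.sum_congr rfl fun n hn => ?_
    rw [Finset.mem_Ico, Nat.ceil_le] at hn
    have hn0 : n ≠ 0 := by
      rintro rfl
      have := hn.1
      simp at this
      linarith
    rw [hb, LSeries.term_of_ne_zero hn0, Complex.cpow_neg, div_eq_mul_inv]
  rw [hsum]
  refine hmain.trans ?_
  rw [hkh, Real.exp_neg (Q / 2), div_inv_eq_mul]
  gcongr

end ZetaSeriesSums

section ZetaSeriesAsymptotics

theorem eventually_mul_rpow_le {α β : ℝ} (h : α < β) (C : ℝ) :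
    ∀ᶠ D : ℝ in Filter.atTop, C * D ^ α ≤ D ^ β := by
  filter_upwards [(tendsto_rpow_atTop (sub_pos.mpr h)).eventually_ge_atTop C,
    Filter.eventually_gt_atTop 0] with D hD hD0
  calc C * D ^ α ≤ D ^ (β - α) * D ^ α := by gcongr
    _ = D ^ β := by rw [← Real.rpow_add hD0, sub_add_cancel]

theorem eventually_mul_log_le {β : ℝ} (h : 0 < β) {C : ℝ} (hC : 0 < C) :
    ∀ᶠ D : ℝ in Filter.atTop, C * Real.log D ≤ D ^ β := by
  filter_upwards [(isLittleO_log_rpow_atTop h).bound (inv_pos.mpr hC),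
    Filter.eventually_gt_atTop 1] with D hD hD0
  have h0 : 0 < Real.log D := Real.log_pos hD0
  rw [Real.norm_of_nonneg h0.le, Real.norm_of_nonneg (by positivity)] at hD
  calc C * Real.log D ≤ C * (C⁻¹ * D ^ β) := by gcongr
    _ = D ^ β := by field_simp

theorem eventually_mul_pow_le_exp (n : ℕ) {b C : ℝ} (hb : 0 < b) (hC : 0 < C) :
    ∀ᶠ Q : ℝ in Filter.atTop, C * Q ^ n ≤ Real.exp (b * Q) := by
  filter_upwards [(isLittleO_pow_exp_pos_mul_atTop (k := n) hb).bound (inv_pos.mpr hC),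
    Filter.eventually_gt_atTop 0] with Q hQ hQ0
  rw [Real.norm_of_nonneg (by positivity), Real.norm_of_nonneg (by positivity)] at hQ
  calc C * Q ^ n ≤ C * (C⁻¹ * Real.exp (b * Q)) := by gcongr
    _ = Real.exp (b * Q) := by field_simp

theorem eventually_vinogradov_width (k : ℕ) (hk : 1 ≤ k) {A : ℝ} (hA : 0 < A) (V₀ : ℝ) :
    ∀ᶠ D : ℝ in Filter.atTop, ∀ ℓ : ℝ, D ^ (1 / 3 : ℝ) ≤ ℓ → ℓ ≤ A * D * Real.log D →
      ∃ V w : ℝ, V₀ ≤ V ∧ V ^ 8 = ℓ + Real.log 8 ∧ V ^ 240 ≤ D ^ 31 ∧ 0 ≤ w ∧ w ≤ 1 ∧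
        w ≤ 1 / (100000 * V ^ 7 * Real.log V) ∧ 5 * D ^ (1 / 9 : ℝ) ≤ w * (D / k) := by
  have hk0 : (0 : ℝ) < k := by exact_mod_cast hk
  have h24 := (tendsto_rpow_atTop (show (0 : ℝ) < 1 / 24 by norm_num)).eventually_ge_atTop
    (max V₀ 3)
  filter_upwards [h24, Filter.eventually_ge_atTop 1,
    eventually_mul_log_le (show (0 : ℝ) < 1 / 100 by norm_num) (show 0 < 2 * A by positivity),
    eventually_mul_rpow_le (show (0 : ℝ) < 101 / 100 by norm_num) (2 * Real.log 8),
    eventually_mul_log_le (show (0 : ℝ) < 4 / 1000 by norm_num) one_pos,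
    eventually_mul_rpow_le (show (1 / 9 : ℝ) < 11225 / 100000 by norm_num) (500000 * k)]
    with D hV hD1 hlogA hlog8 hlog hlast ℓ hℓ1 hℓ2
  have hD0 : 0 < D := by linarith
  have hl8 : 0 < Real.log 8 := Real.log_pos (by norm_num)
  have hD3 : 0 < D ^ (1 / 3 : ℝ) := Real.rpow_pos_of_pos hD0 _
  set M := ℓ + Real.log 8 with hM
  have hM0 : 0 < M := by linarith
  have hMle : M ≤ D ^ (101 / 100 : ℝ) := by
    rw [Real.rpow_zero, mul_one] at hlog8
    have e : D ^ (101 / 100 : ℝ) = D * D ^ (1 / 100 : ℝ) := by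
      rw [← Real.rpow_one_add' hD0.le (by norm_num)]
      norm_num
    have : D * (2 * A * Real.log D) ≤ D * D ^ (1 / 100 : ℝ) := by gcongr
    rw [← e] at this
    linarith
  have hVlow : D ^ (1 / 24 : ℝ) ≤ M ^ (1 / 8 : ℝ) := by
    have e : D ^ (1 / 24 : ℝ) = (D ^ (1 / 3 : ℝ)) ^ (1 / 8 : ℝ) := by
      rw [← Real.rpow_mul hD0.le]
      norm_num
    rw [e]
    exact Real.rpow_le_rpow hD3.le (by linarith) (by norm_num)
  have hVhigh : M ^ (1 / 8 : ℝ) ≤ D ^ (101 / 800 : ℝ) := by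
    calc M ^ (1 / 8 : ℝ) ≤ (D ^ (101 / 100 : ℝ)) ^ (1 / 8 : ℝ) :=
          Real.rpow_le_rpow hM0.le hMle (by norm_num)
      _ = _ := by rw [← Real.rpow_mul hD0.le]; norm_num
  set V := M ^ (1 / 8 : ℝ) with hVdef
  have hV3 : 3 ≤ V := ((le_max_right _ _).trans hV).trans hVlow
  have hV0 : 0 < V := by linarith
  have hlogV : 1 ≤ Real.log V := by
    rw [Real.le_log_iff_exp_le hV0]
    linarith [Real.exp_one_lt_d9]
  have hlogVD : Real.log V ≤ D ^ (4 / 1000 : ℝ) := by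
    refine (Real.log_le_log hV0 (hVhigh.trans ?_)).trans (by simpa using hlog)
    calc D ^ (101 / 800 : ℝ) ≤ D ^ (1 : ℝ) := Real.rpow_le_rpow_of_exponent_le hD1 (by norm_num)
      _ = D := Real.rpow_one D
  have hV7 : V ^ 7 ≤ D ^ (707 / 800 : ℝ) := by
    calc V ^ 7 ≤ (D ^ (101 / 800 : ℝ)) ^ 7 := by gcongr
      _ = _ := by rw [← Real.rpow_natCast, ← Real.rpow_mul hD0.le]; norm_num
  have hden : V ^ 7 * Real.log V ≤ D ^ (88775 / 100000 : ℝ) := by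
    calc V ^ 7 * Real.log V ≤ D ^ (707 / 800 : ℝ) * D ^ (4 / 1000 : ℝ) := by gcongr
      _ = _ := by rw [← Real.rpow_add hD0]; norm_num
  have hpow1 : 1 ≤ D ^ (88775 / 100000 : ℝ) := Real.one_le_rpow hD1 (by norm_num)
  refine ⟨V, 1 / (100000 * D ^ (88775 / 100000 : ℝ)), ((le_max_left _ _).trans hV).trans hVlow,
    ?_, ?_, by positivity, ?_, ?_, ?_⟩
  · rw [hVdef, ← Real.rpow_natCast, ← Real.rpow_mul hM0.le]
    norm_num
  · calc V ^ 240 ≤ (D ^ (101 / 800 : ℝ)) ^ 240 := by gcongr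
      _ = D ^ (303 / 10 : ℝ) := by rw [← Real.rpow_natCast, ← Real.rpow_mul hD0.le]; norm_num
      _ ≤ D ^ ((31 : ℕ) : ℝ) := Real.rpow_le_rpow_of_exponent_le hD1 (by norm_num)
      _ = D ^ 31 := Real.rpow_natCast D 31
  · rw [div_le_one (by positivity)]
    linarith
  · apply one_div_le_one_div_of_le (by positivity)
    rw [mul_assoc]
    gcongr
  · have e : D = D ^ (88775 / 100000 : ℝ) * D ^ (11225 / 100000 : ℝ) := by
      rw [← Real.rpow_add hD0]
      norm_num
    have e2 : 1 / (100000 * D ^ (88775 / 100000 : ℝ)) * (D / k) =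
        D ^ (11225 / 100000 : ℝ) / (100000 * k) := by
      nth_rewrite 2 [e]
      field_simp
    rw [e2, le_div_iff₀ (by positivity)]
    linarith

theorem eventually_error_le {k : ℕ} (hk : 1 ≤ k) {B : ℝ} (hB : 0 ≤ B) :
    ∀ᶠ D : ℝ in Filter.atTop, ∀ Q : ℝ, Q = D ^ (1 / 9 : ℝ) →
      (D + 1) * (4 * (B + D ^ 31) *
          (2 * Real.exp D * Real.exp (-(Real.exp Q / 4)) + Real.exp (-(5 * Q))) *
            Real.exp (Q / 2)) +
        4 * (D + 3) * (3 * Real.exp (-(Q / 4)) + Real.exp (-(D / k))) +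
        2 * (Real.exp (-(Real.exp (Q / 2) / 4) + 2) * (2 * Real.exp D) * B) ≤
      Real.exp (-(4 * D ^ (1 / 10 : ℝ))) := by
  have hk0 : (0 : ℝ) < k := by exact_mod_cast hk
  have hQ : Filter.Tendsto (fun D : ℝ => D ^ (1 / 9 : ℝ)) Filter.atTop Filter.atTop :=
    tendsto_rpow_atTop (by norm_num)
  filter_upwards [Filter.eventually_ge_atTop 1,
    hQ.eventually (eventually_mul_pow_le_exp 288 (b := 1 / 8) (C := 100 * (B + 1)) (by norm_num)
      (by positivity)),
    hQ.eventually (eventually_mul_pow_le_exp 9 (b := 1 / 2) (C := 24) (by norm_num)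
      (by norm_num)),
    hQ.eventually_ge_atTop 1,
    eventually_mul_rpow_le (show (1 / 9 : ℝ) < 1 by norm_num) k,
    eventually_mul_rpow_le (show (1 / 10 : ℝ) < 1 / 9 by norm_num) 32]
    with D hD1 h1 h2 hQ1 h3 h4 Q hQdef
  rw [← hQdef] at h1 h2 hQ1 h3 h4
  rw [Real.rpow_one] at h3
  have hD0 : 0 < D := by linarith
  have hQD : Q ^ 9 = D := by
    rw [hQdef, ← Real.rpow_natCast, ← Real.rpow_mul hD0.le]
    norm_num
  have hQD2 : Q ^ 288 = D ^ 32 := by rw [← hQD]; ring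
  rw [hQD2] at h1
  rw [hQD] at h2
  have hQle : Q ≤ D := by
    rw [← hQD]
    exact le_self_pow₀ hQ1 (by norm_num)
  have h2' : 24 * D ≤ Real.exp (Q / 2) := by
    rw [show Q / 2 = 1 / 2 * Q by ring]
    exact h2
  have h5 : 24 * D ≤ Real.exp Q := h2'.trans (Real.exp_le_exp.mpr (by linarith))
  have t1 : 2 * Real.exp D * Real.exp (-(Real.exp Q / 4)) ≤ 2 * Real.exp (-(5 * Q)) := by
    rw [mul_assoc, ← Real.exp_add]
    gcongr
    linarith
  have t2 : Real.exp (-(D / k)) ≤ Real.exp (-(Q / 4)) := by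
    apply Real.exp_le_exp.mpr
    have : Q ≤ D / k := by rw [le_div_iff₀ hk0]; linarith
    linarith
  have t3 : Real.exp (-(Real.exp (Q / 2) / 4) + 2) * (2 * Real.exp D) ≤
      16 * Real.exp (-(Q / 4)) := by
    have e2 : Real.exp 2 ≤ 8 := by
      have h := Real.exp_one_lt_d9
      have h' : Real.exp 2 = Real.exp 1 ^ 2 := by rw [← Real.exp_nat_mul]; norm_num
      rw [h']
      nlinarith [Real.exp_pos 1]
    calc Real.exp (-(Real.exp (Q / 2) / 4) + 2) * (2 * Real.exp D) =
          2 * Real.exp 2 * Real.exp (-(Real.exp (Q / 2) / 4) + D) := by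
            rw [Real.exp_add, Real.exp_add]; ring
      _ ≤ 2 * 8 * Real.exp (-(Q / 4)) := by
        gcongr
        linarith
      _ = _ := by ring
  have t4 : Real.exp (-(5 * Q)) * Real.exp (Q / 2) ≤ Real.exp (-(Q / 4)) := by
    rw [← Real.exp_add]
    apply Real.exp_le_exp.mpr
    linarith
  have hD31 : 1 ≤ D ^ 31 := one_le_pow₀ hD1
  have hD32 : D ≤ D ^ 32 := le_self_pow₀ hD1 (by norm_num)
  set X := Real.exp (-(Q / 4)) with hX
  have hX0 : 0 < X := Real.exp_pos _
  have p1 : (D + 1) * (4 * (B + D ^ 31) *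
      (2 * Real.exp D * Real.exp (-(Real.exp Q / 4)) + Real.exp (-(5 * Q))) *
            Real.exp (Q / 2)) ≤ 24 * (B + 1) * D ^ 32 * X := by
    calc _ ≤ (2 * D) * (4 * ((B + 1) * D ^ 31) *
          (2 * Real.exp (-(5 * Q)) + Real.exp (-(5 * Q))) * Real.exp (Q / 2)) := by
          gcongr
          · linarith
          · nlinarith
      _ = 24 * (B + 1) * D ^ 32 * (Real.exp (-(5 * Q)) * Real.exp (Q / 2)) := by ring
      _ ≤ _ := by gcongr
  have p2 : 4 * (D + 3) * (3 * X + Real.exp (-(D / k))) ≤ 64 * D ^ 32 * X := by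
    calc _ ≤ 4 * (4 * D ^ 32) * (3 * X + X) := by
          gcongr
          linarith
      _ = _ := by ring
  have p3 : 2 * (Real.exp (-(Real.exp (Q / 2) / 4) + 2) * (2 * Real.exp D) * B) ≤
      32 * B * D ^ 32 * X := by
    calc _ ≤ 2 * (16 * X * B) := by gcongr
      _ = 32 * B * 1 * X := by ring
      _ ≤ _ := by
        gcongr
        linarith
  have hfin : 100 * (B + 1) * D ^ 32 * X ≤ Real.exp (-(4 * D ^ (1 / 10 : ℝ))) := by
    calc 100 * (B + 1) * D ^ 32 * X ≤ Real.exp (1 / 8 * Q) * X := by gcongr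
      _ = Real.exp (-(Q / 8)) := by rw [hX, ← Real.exp_add]; congr 1; ring
      _ ≤ _ := by
        apply Real.exp_le_exp.mpr
        linarith
  have : 0 ≤ B * D ^ 32 * X := by positivity
  have : 0 ≤ D ^ 32 * X := by positivity
  nlinarith

theorem IsZetaSeries.eventually_norm_sum_Ico_le {a : ℕ → ℝ} {F : ℂ → ℂ} (H : IsZetaSeries a F)
    {k : ℕ} (hk : 1 ≤ k) {A : ℝ} (hA : 0 < A) :
    ∀ᶠ D : ℝ in Filter.atTop, ∀ t x z : ℝ, Real.exp (D ^ (1 / 3 : ℝ)) ≤ t →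
      Real.log t ≤ A * D * Real.log D → Real.exp (D / k) ≤ x → x ≤ z → z ≤ 2 * Real.exp D →
      ‖∑ n ∈ Finset.Ico ⌈x⌉₊ ⌈z⌉₊, (a n : ℂ) * (n : ℂ) ^ (-(1 + (t : ℂ) * Complex.I))‖ ≤
        Real.exp (-(4 * D ^ (1 / 10 : ℝ))) := by
  obtain ⟨V₀, B, hB, hmain⟩ := H.exists_norm_sum_Ico_le
  have hk0 : (0 : ℝ) < k := by exact_mod_cast hk
  have hgrow : Filter.Tendsto (fun D : ℝ => Real.exp (D ^ (1 / 3 : ℝ))) Filter.atTop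
      Filter.atTop := Real.tendsto_exp_atTop.comp (tendsto_rpow_atTop (by norm_num))
  filter_upwards [eventually_vinogradov_width k hk hA V₀, eventually_error_le hk hB,
    (tendsto_rpow_atTop (show (0 : ℝ) < 1 / 9 by norm_num)).eventually_ge_atTop 4,
    eventually_mul_rpow_le (show (1 / 9 : ℝ) < 1 / 3 by norm_num) 2,
    hgrow.eventually_ge_atTop (2 * (Real.exp ((10 ^ 9) ^ 8) + 2)), Filter.eventually_ge_atTop 1]
    with D hw herr hQ4 hQ3 hbig hD1 t x z ht1 ht2 hx hxz hz
  have hD0 : 0 < D := by linarith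
  have ht0 : 0 < t := (Real.exp_pos _).trans_le ht1
  obtain ⟨V, w, hV, hV8, hV240, hw0, hw1, hwV, hwD⟩ :=
    hw (Real.log t) ((Real.le_log_iff_exp_le ht0).mpr ht1) ht2
  have herr := herr _ rfl
  set Q := D ^ (1 / 9 : ℝ) with hQ
  have hx1 : 1 ≤ x := by
    refine le_trans ?_ hx
    rw [Real.one_le_exp_iff]
    positivity
  have hx0 : 0 < x := by linarith
  have hz0 : 0 < z := by linarith
  have hT : Real.exp Q * 2 ≤ t := by
    have h2 : (2 : ℝ) ≤ Real.exp Q := by linarith [Real.add_one_le_exp Q]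
    calc Real.exp Q * 2 ≤ Real.exp Q * Real.exp Q := by gcongr
      _ = Real.exp (2 * Q) := by rw [← Real.exp_add]; congr 1; ring
      _ ≤ t := (Real.exp_le_exp.mpr hQ3).trans ht1
  have hV8' : Real.exp (V ^ 8) = 8 * t := by
    rw [hV8, Real.exp_add, Real.exp_log ht0, Real.exp_log (by norm_num)]
    ring
  have hbig' := hbig.trans ht1
  have hpos := Real.exp_pos ((10 ^ 9) ^ 8)
  have hres := hmain V hV w t Q x z hQ4 hw0 hw1 hwV (by linarith)
    (by rw [hV8']; linarith) hx1 hxz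
  refine hres.trans (le_trans ?_ herr)
  have hl2 : Real.log 2 ≤ 1 := by linarith [Real.log_two_lt_d9]
  have hlogz : Real.log z ≤ D + 1 := by
    calc Real.log z ≤ Real.log (2 * Real.exp D) := Real.log_le_log hz0 hz
      _ = Real.log 2 + D := by rw [Real.log_mul (by norm_num) (by positivity), Real.log_exp]
      _ ≤ _ := by linarith
  have hlog2z : Real.log (2 * z) + 1 ≤ D + 3 := by
    rw [Real.log_mul (by norm_num) hz0.ne']
    linarith
  have hlogx : D / k ≤ Real.log x := (Real.le_log_iff_exp_le hx0).mpr hx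
  have hlogx0 : 0 ≤ Real.log x := Real.log_nonneg hx1
  have hlogxz : 0 ≤ Real.log z - Real.log x := sub_nonneg.mpr (Real.log_le_log hx0 hxz)
  have hwx : Real.exp (-(w * Real.log x)) ≤ Real.exp (-(5 * Q)) := by
    apply Real.exp_le_exp.mpr
    have := mul_le_mul_of_nonneg_left hlogx hw0
    linarith
  have hinv : 1 / x ≤ Real.exp (-(D / k)) := by
    rw [Real.exp_neg, ← one_div]
    exact one_div_le_one_div_of_le (Real.exp_pos _) hx
  have hV240' : 0 ≤ V ^ 240 := Even.pow_nonneg (by decide) V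
  gcongr
  linarith

end ZetaSeriesAsymptotics

section PrimeSums

theorem exists_eq_sq_of_isPrimePow {n : ℕ} (h : IsPrimePow n) (hn : ¬n.Prime) :
    ∃ m : ℕ, 2 ≤ m ∧ (m ^ 2 = n ∨ m ^ 2 * m.minFac = n) := by
  obtain ⟨p, j, hp, hj, rfl⟩ := (isPrimePow_nat_iff n).mp h
  have hj1 : j ≠ 1 := by
    rintro rfl
    exact hn (by simpa using hp)
  have hi : j / 2 ≠ 0 := by omega
  refine ⟨p ^ (j / 2), hp.two_le.trans (Nat.le_self_pow hi p), ?_⟩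
  rcases Nat.mod_two_eq_zero_or_one j with h2 | h2
  · left
    rw [← pow_mul]
    congr 1
    omega
  · right
    rw [hp.pow_minFac hi, ← pow_mul, ← pow_succ]
    congr 1
    omega

theorem sum_inv_primePow_not_prime_le {K a : ℕ} (hK : K ^ 3 < a) (c : ℕ) :
    ∑ n ∈ Finset.Ico a c with IsPrimePow n ∧ ¬n.Prime, (n : ℝ)⁻¹ ≤ 4 / (K + 1) := by
  set M := Finset.Ioo K c with hM
  have hsub : (Finset.Ico a c).filter (fun n => IsPrimePow n ∧ ¬n.Prime) ⊆
      M.image (fun m => m ^ 2) ∪ M.image (fun m => m ^ 2 * m.minFac) := by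
    intro n hn
    rw [Finset.mem_filter, Finset.mem_Ico] at hn
    obtain ⟨⟨ha, hc⟩, hpp, hp⟩ := hn
    obtain ⟨m, hm2, hm⟩ := exists_eq_sq_of_isPrimePow hpp hp
    have hmin : m.minFac ≤ m := Nat.minFac_le (by omega)
    have hmin1 : 1 ≤ m.minFac := m.minFac_pos
    have hmm : m ≤ m ^ 2 := Nat.le_self_pow (by norm_num) m
    have h1 : m ^ 2 ≤ m ^ 2 * m.minFac := Nat.le_mul_of_pos_right _ hmin1
    have h2 : m ^ 2 * m.minFac ≤ m ^ 3 := by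
      rw [pow_succ m 2]
      exact Nat.mul_le_mul_left _ hmin
    have hmem : m ∈ M := by
      rw [hM, Finset.mem_Ioo]
      refine ⟨lt_of_pow_lt_pow_left₀ 3 (Nat.zero_le _) ?_, ?_⟩
      · rcases hm with hm | hm <;> omega
      · rcases hm with hm | hm <;> omega
    rw [Finset.mem_union, Finset.mem_image, Finset.mem_image]
    rcases hm with hm | hm
    · exact Or.inl ⟨m, hmem, hm⟩
    · exact Or.inr ⟨m, hmem, hm⟩
  have hnn : ∀ n : ℕ, 0 ≤ (n : ℝ)⁻¹ := fun n => by positivity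
  have hbase : ∑ m ∈ M, ((m : ℝ) ^ 2)⁻¹ ≤ 2 / (K + 1) := sum_Ioo_inv_sq_le K c
  have h1 : ∑ n ∈ M.image (fun m : ℕ => m ^ 2), ((n : ℕ) : ℝ)⁻¹ ≤ 2 / (K + 1) := by
    refine (Finset.sum_image_le_of_nonneg fun u _ => hnn u).trans ?_
    simpa using hbase
  have h2 : ∑ n ∈ M.image (fun m : ℕ => m ^ 2 * m.minFac), ((n : ℕ) : ℝ)⁻¹ ≤ 2 / (K + 1) := by
    refine (Finset.sum_image_le_of_nonneg fun u _ => hnn u).trans (le_trans ?_ hbase)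
    refine Finset.sum_le_sum fun m hm => ?_
    have hm0 : 0 < m := by
      rw [hM, Finset.mem_Ioo] at hm
      omega
    have hm0' : (0 : ℝ) < m := by exact_mod_cast hm0
    have : (1 : ℝ) ≤ m.minFac := by exact_mod_cast m.minFac_pos
    push_cast
    apply inv_anti₀ (by positivity)
    nlinarith [sq_nonneg (m : ℝ)]
  have h3 := Finset.sum_union_inter (s₁ := M.image (fun m => m ^ 2))
    (s₂ := M.image (fun m => m ^ 2 * m.minFac)) (f := fun n : ℕ => ((n : ℕ) : ℝ)⁻¹)
  have h4 : 0 ≤ ∑ n ∈ M.image (fun m : ℕ => m ^ 2) ∩ M.image (fun m : ℕ => m ^ 2 * m.minFac),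
      ((n : ℕ) : ℝ)⁻¹ := Finset.sum_nonneg fun n _ => hnn n
  have h5 := Finset.sum_le_sum_of_subset_of_nonneg hsub
    (f := fun n : ℕ => (n : ℝ)⁻¹) (fun n _ _ => hnn n)
  have e : (4 : ℝ) / (K + 1) = 2 / (K + 1) + 2 / (K + 1) := by ring
  linarith

theorem norm_sum_prime_le {s : ℂ} (hs : s.re = 1) {a c K : ℕ} (ha : 3 ≤ a) (hK : K ^ 3 < a)
    {B : ℝ} (hca : a ≤ c) (hB : ∀ m, a ≤ m → m ≤ c →
      ‖∑ n ∈ Finset.Ico a m, (ArithmeticFunction.vonMangoldt n : ℂ) * (n : ℂ) ^ (-s)‖ ≤ B) :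
    ‖∑ n ∈ Finset.Ico a c, ((if n.Prime then (1 : ℝ) else 0 : ℝ) : ℂ) * (n : ℂ) ^ (-s)‖ ≤
      B + 4 / (K + 1) := by
  set f : ℕ → ℂ := fun n => (ArithmeticFunction.vonMangoldt n : ℂ) * (n : ℂ) ^ (-s) with hf
  have hlog : ∀ n : ℕ, a ≤ n → 1 ≤ Real.log n := by
    intro n hn
    have : (3 : ℝ) ≤ n := by exact_mod_cast ha.trans hn
    rw [Real.le_log_iff_exp_le (by linarith)]
    linarith [Real.exp_one_lt_d9]
  have hsplit : ∀ n ∈ Finset.Ico a c, ((if n.Prime then (1 : ℝ) else 0 : ℝ) : ℂ) * (n : ℂ) ^ (-s) =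
      (((Real.log n)⁻¹ : ℝ) : ℂ) * f n -
        if IsPrimePow n ∧ ¬n.Prime then (((Real.log n)⁻¹ : ℝ) : ℂ) * f n else 0 := by
    intro n hn
    rw [Finset.mem_Ico] at hn
    have hl := hlog n hn.1
    by_cases hp : n.Prime
    · have hne : ((Real.log n : ℝ) : ℂ) ≠ 0 := by
        exact_mod_cast (show Real.log n ≠ 0 by linarith)
      rw [if_pos hp, if_neg (by tauto), hf]
      simp only [ArithmeticFunction.vonMangoldt_apply_prime hp]
      rw [Complex.ofReal_inv, ← mul_assoc, inv_mul_cancel₀ hne]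
      simp
    · rw [if_neg hp]
      by_cases hpp : IsPrimePow n
      · rw [if_pos ⟨hpp, hp⟩]
        simp
      · rw [if_neg (by tauto)]
        simp [hf, ArithmeticFunction.vonMangoldt_eq_zero_iff.mpr hpp]
  rw [Finset.sum_congr rfl hsplit, Finset.sum_sub_distrib]
  refine (norm_sub_le _ _).trans (add_le_add ?_ ?_)
  · rw [Finset.sum_Ico_eq_sum_range]
    have h1 := norm_sum_antitone_mul_le (w := fun i => (Real.log ((a + i : ℕ) : ℝ))⁻¹)
      (fun i => inv_nonneg.mpr (Real.log_natCast_nonneg _))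
      (fun i j hij => by
        have hi := hlog (a + i) (by omega)
        apply inv_anti₀ (by linarith)
        have h0 : (0 : ℝ) < ((a + i : ℕ) : ℝ) := by
          exact_mod_cast (by omega : 0 < a + i)
        apply Real.log_le_log h0
        exact_mod_cast (by omega : a + i ≤ a + j))
      (c := fun i => f (a + i)) (B := B) (n := c - a) (fun m hm => by
        have := hB (a + m) (by omega) (by omega)
        rw [Finset.sum_Ico_eq_sum_range] at this
        rwa [Nat.add_sub_cancel_left] at this)
    refine h1.trans ?_
    have hB0 : 0 ≤ B := (norm_nonneg _).trans (hB a le_rfl hca)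
    have : (Real.log ((a + 0 : ℕ) : ℝ))⁻¹ ≤ 1 := inv_le_one_of_one_le₀ (hlog _ (by omega))
    calc _ ≤ 1 * B := by gcongr
      _ = B := one_mul B
  · rw [← Finset.sum_filter]
    refine (norm_sum_le _ _).trans (le_trans (Finset.sum_le_sum fun n hn => ?_)
      (sum_inv_primePow_not_prime_le hK c))
    rw [Finset.mem_filter, Finset.mem_Ico] at hn
    have hl := hlog n hn.1.1
    have hn0 : 0 < n := by omega
    rw [norm_mul, hf, norm_mul, Complex.norm_natCast_cpow_of_pos hn0, Complex.norm_real,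
      Complex.norm_real, Complex.neg_re, hs, Real.rpow_neg_one, Real.norm_eq_abs,
      Real.norm_eq_abs, abs_of_nonneg (by positivity),
      abs_of_nonneg ArithmeticFunction.vonMangoldt_nonneg, ← mul_assoc]
    have h1 : (Real.log n)⁻¹ * ArithmeticFunction.vonMangoldt n ≤ 1 := by
      rw [inv_mul_le_iff₀ (by linarith), mul_one]
      exact ArithmeticFunction.vonMangoldt_le_log
    calc _ ≤ 1 * (n : ℝ)⁻¹ := by gcongr
      _ = _ := one_mul _

theorem eventually_norm_sum_prime_le {k : ℕ} (hk : 1 ≤ k) {A : ℝ} (hA : 0 < A) :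
    ∀ᶠ D : ℝ in Filter.atTop, ∀ t x z : ℝ, Real.exp (D ^ (1 / 3 : ℝ)) ≤ t →
      Real.log t ≤ A * D * Real.log D → Real.exp (D / k) ≤ x → x ≤ z → z ≤ 2 * Real.exp D →
      ‖∑ n ∈ Finset.Ico ⌈x⌉₊ ⌈z⌉₊, ((if n.Prime then (1 : ℝ) else 0 : ℝ) : ℂ) *
        (n : ℂ) ^ (-(1 + (t : ℂ) * Complex.I))‖ ≤ Real.exp (-(3 * D ^ (1 / 10 : ℝ))) := by
  have hk0 : (0 : ℝ) < k := by exact_mod_cast hk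
  filter_upwards [isZetaSeries_vonMangoldt.eventually_norm_sum_Ico_le hk hA,
    Filter.eventually_ge_atTop (4 * k : ℝ),
    (tendsto_rpow_atTop (show (0 : ℝ) < 1 / 10 by norm_num)).eventually_ge_atTop 4,
    eventually_mul_rpow_le (show (1 / 10 : ℝ) < 1 by norm_num) (15 * k)]
    with D h hDk hD10 hDlin t x z ht1 ht2 hx hxz hz
  rw [Real.rpow_one] at hDlin
  set q := D ^ (1 / 10 : ℝ) with hq
  have hDk4 : 4 ≤ D / k := by rwa [le_div_iff₀ hk0]
  have hDk15 : 15 * q ≤ D / k := by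
    rw [le_div_iff₀ hk0]
    linarith
  have hx5 : 5 ≤ x := by linarith [Real.add_one_le_exp (D / k)]
  have hx0 : 0 < x := by linarith
  set r := x ^ (1 / 3 : ℝ) with hr
  have hr0 : 0 < r := Real.rpow_pos_of_pos hx0 _
  have hr3 : r ^ 3 = x := by
    rw [hr, ← Real.rpow_natCast, ← Real.rpow_mul hx0.le]
    norm_num
  have hK1 : r ≤ (⌈r⌉₊ - 1 : ℕ) + 1 := by
    have h1 := Nat.le_ceil r
    have h2 : 0 < ⌈r⌉₊ := Nat.ceil_pos.mpr hr0
    rw [Nat.cast_sub h2]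
    push_cast
    linarith
  have hK2 : ((⌈r⌉₊ - 1 : ℕ) : ℝ) < r := by
    have h1 := Nat.ceil_lt_add_one hr0.le
    have h2 : 0 < ⌈r⌉₊ := Nat.ceil_pos.mpr hr0
    rw [Nat.cast_sub h2]
    push_cast
    linarith
  have hK3 : (⌈r⌉₊ - 1) ^ 3 < ⌈x⌉₊ := by
    rw [Nat.lt_ceil]
    rw [Nat.cast_pow]
    calc ((⌈r⌉₊ - 1 : ℕ) : ℝ) ^ 3 < r ^ 3 := by gcongr
      _ = x := hr3
  have hx3 : 3 ≤ ⌈x⌉₊ := by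
    have := Nat.le_ceil x
    exact_mod_cast (by linarith : (3 : ℝ) ≤ ⌈x⌉₊)
  have hmain := norm_sum_prime_le (s := 1 + (t : ℂ) * Complex.I) (by simp) (c := ⌈z⌉₊) hx3 hK3
    (B := Real.exp (-(4 * q))) (Nat.ceil_le_ceil hxz) (fun m hm1 hm2 => by
      rcases hm2.eq_or_lt with rfl | hm2
      · exact h t x z ht1 ht2 hx hxz hz
      · have hmz : (m : ℝ) < z := Nat.lt_ceil.mp hm2
        have := h t x m ht1 ht2 hx (Nat.ceil_le.mp hm1) (by linarith)
        rwa [Nat.ceil_natCast] at this)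
  refine hmain.trans ?_
  have h2 : 4 / (((⌈r⌉₊ - 1 : ℕ) : ℝ) + 1) ≤ 4 * Real.exp (-(5 * q)) := by
    have : Real.exp (5 * q) ≤ r := by
      calc Real.exp (5 * q) = Real.exp (15 * q) ^ (1 / 3 : ℝ) := by
            rw [← Real.exp_mul]; congr 1; ring
        _ ≤ r := Real.rpow_le_rpow (Real.exp_pos _).le
            ((Real.exp_le_exp.mpr hDk15).trans hx) (by norm_num)
    rw [Real.exp_neg, ← div_eq_mul_inv]
    gcongr
    exact this.trans hK1
  have h3 : Real.exp (-(4 * q)) = Real.exp (-(3 * q)) * Real.exp (-q) := by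
    rw [← Real.exp_add]; congr 1; ring
  have h4 : Real.exp (-(5 * q)) ≤ Real.exp (-(3 * q)) * Real.exp (-q) := by
    rw [← h3]
    exact Real.exp_le_exp.mpr (by linarith)
  have h5 : Real.exp (-q) ≤ 1 / 5 := by
    rw [Real.exp_neg, ← one_div]
    exact one_div_le_one_div_of_le (by norm_num) (by linarith [Real.add_one_le_exp q])
  have h6 := Real.exp_pos (-(3 * q))
  nlinarith

end PrimeSums

section CoefficientSums

theorem conj_natCast_cpow_one_add (n : ℕ) (t : ℝ) :
    (starRingEnd ℂ) ((n : ℂ) ^ (-(1 + (t : ℂ) * Complex.I))) =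
      (n : ℂ) ^ (-(1 + ((-t : ℝ) : ℂ) * Complex.I)) := by
  have harg : ((n : ℂ)).arg ≠ Real.pi := by
    rw [Complex.natCast_arg]
    exact Real.pi_ne_zero.symm
  have h := Complex.cpow_conj (n : ℂ) (-(1 + (t : ℂ) * Complex.I)) harg
  rw [Complex.conj_natCast] at h
  rw [← h]
  congr 1
  simp

theorem norm_sum_cpow_neg_eq (a : ℕ → ℝ) (s : Finset ℕ) (t : ℝ) :
    ‖∑ n ∈ s, (a n : ℂ) * (n : ℂ) ^ (-(1 + ((-t : ℝ) : ℂ) * Complex.I))‖ =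
      ‖∑ n ∈ s, (a n : ℂ) * (n : ℂ) ^ (-(1 + (t : ℂ) * Complex.I))‖ := by
  rw [← Complex.norm_conj (∑ n ∈ s, (a n : ℂ) * (n : ℂ) ^ (-(1 + (t : ℂ) * Complex.I))), map_sum]
  simp only [map_mul, Complex.conj_ofReal, conj_natCast_cpow_one_add]

theorem eventually_norm_sum_coeff_le {k : ℕ} (hk : 1 ≤ k) {A : ℝ} (hA : 0 < A) {g : ℕ → ℝ}
    (hg : g = (fun n => ((ArithmeticFunction.moebius n : ℤ) : ℝ)) ∨
      g = (fun n => if n.Prime then 1 else 0) ∨ g = (fun _ => 1) ∨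
      g = fun n : ℕ => Real.log n) :
    ∀ᶠ D : ℝ in Filter.atTop, ∀ t x z : ℝ, Real.exp (D ^ (1 / 3 : ℝ)) ≤ |t| →
      Real.log |t| ≤ A * D * Real.log D → Real.exp (D / k) ≤ x → x ≤ z → z ≤ 2 * Real.exp D →
      ‖∑ n ∈ Finset.Ico ⌈x⌉₊ ⌈z⌉₊, (g n : ℂ) * (n : ℂ) ^ (-(1 + (t : ℂ) * Complex.I))‖ ≤
        Real.exp (-(3 * D ^ (1 / 10 : ℝ))) := by
  have hpos : ∀ᶠ D : ℝ in Filter.atTop, ∀ t x z : ℝ, Real.exp (D ^ (1 / 3 : ℝ)) ≤ t →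
      Real.log t ≤ A * D * Real.log D → Real.exp (D / k) ≤ x → x ≤ z → z ≤ 2 * Real.exp D →
      ‖∑ n ∈ Finset.Ico ⌈x⌉₊ ⌈z⌉₊, (g n : ℂ) * (n : ℂ) ^ (-(1 + (t : ℂ) * Complex.I))‖ ≤
        Real.exp (-(3 * D ^ (1 / 10 : ℝ))) := by
    have haux : ∀ F : ℂ → ℂ, IsZetaSeries g F → ∀ᶠ D : ℝ in Filter.atTop, ∀ t x z : ℝ,
        Real.exp (D ^ (1 / 3 : ℝ)) ≤ t → Real.log t ≤ A * D * Real.log D →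
        Real.exp (D / k) ≤ x → x ≤ z → z ≤ 2 * Real.exp D →
        ‖∑ n ∈ Finset.Ico ⌈x⌉₊ ⌈z⌉₊, (g n : ℂ) * (n : ℂ) ^ (-(1 + (t : ℂ) * Complex.I))‖ ≤
          Real.exp (-(3 * D ^ (1 / 10 : ℝ))) := by
      intro F H
      filter_upwards [H.eventually_norm_sum_Ico_le hk hA, Filter.eventually_ge_atTop 0]
        with D h hD t x z h1 h2 h3 h4 h5
      refine (h t x z h1 h2 h3 h4 h5).trans (Real.exp_le_exp.mpr ?_)
      have := Real.rpow_nonneg hD (1 / 10)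
      linarith
    rcases hg with rfl | rfl | rfl | rfl
    · exact haux _ isZetaSeries_moebius
    · exact eventually_norm_sum_prime_le hk hA
    · exact haux _ isZetaSeries_one
    · exact haux _ isZetaSeries_log
  filter_upwards [hpos] with D h t x z h1 h2 h3 h4 h5
  rcases abs_cases t with ⟨ht, -⟩ | ⟨ht, -⟩
  · rw [ht] at h1 h2
    exact h t x z h1 h2 h3 h4 h5
  · rw [ht] at h1 h2
    rw [← norm_sum_cpow_neg_eq]
    exact h (-t) x z h1 h2 h3 h4 h5

theorem sum_log_add_one_div_le (M : ℕ) :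
    ∑ a ∈ Finset.Icc 1 M, (Real.log a + 1) / a ≤ (Real.log M + 1) ^ 2 := by
  have h1 : ∑ a ∈ Finset.Icc 1 M, (Real.log a + 1) / a ≤
      ∑ a ∈ Finset.Icc 1 M, (Real.log M + 1) * (a : ℝ)⁻¹ := by
    refine Finset.sum_le_sum fun a ha => ?_
    rw [Finset.mem_Icc] at ha
    have ha0 : (0 : ℝ) < a := by exact_mod_cast ha.1
    rw [div_eq_mul_inv]
    gcongr
    exact ha.2
  have h2 := harmonic_le_one_add_log M
  rw [harmonic_eq_sum_Icc] at h2
  push_cast at h2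
  rw [← Finset.mul_sum] at h1
  have h3 := Real.log_natCast_nonneg M
  nlinarith

end CoefficientSums

section TupleSums

theorem sum_piFinset_eq_sum_insertNth {m : ℕ} (i : Fin (m + 1)) (I : Finset ℕ)
    (F : (Fin (m + 1) → ℕ) → ℂ) :
    ∑ n ∈ Fintype.piFinset (fun _ : Fin (m + 1) => I), F n =
      ∑ r ∈ Fintype.piFinset (fun _ : Fin m => I), ∑ a ∈ I,
        F (i.insertNth (α := fun _ => ℕ) a r) := by
  rw [← Finset.sum_product']
  refine Finset.sum_nbij' (fun n => (i.removeNth n, n i))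
    (fun p => i.insertNth (α := fun _ => ℕ) p.2 p.1) ?_ ?_ ?_ ?_ ?_
  · intro n hn
    rw [Fintype.mem_piFinset] at hn
    rw [Finset.mem_product, Fintype.mem_piFinset]
    exact ⟨fun j => hn _, hn _⟩
  · intro p hp
    rw [Finset.mem_product, Fintype.mem_piFinset] at hp
    rw [Fintype.mem_piFinset]
    intro j
    rcases eq_or_ne j i with rfl | hj
    · simpa using hp.2
    · obtain ⟨j', rfl⟩ := Fin.exists_succAbove_eq hj
      simpa using hp.1 j'
  · intro n _
    exact Fin.insertNth_self_removeNth i n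
  · intro p _
    simp
  · intro n _
    rw [Fin.insertNth_self_removeNth]

/-- `i` is the first index at which the tuple `n` takes a value `≥ y`. -/
def IsFirstLarge {m : ℕ} (y : ℝ) (i : Fin (m + 1)) (n : Fin (m + 1) → ℕ) : Prop :=
  y ≤ n i ∧ ∀ j : Fin m, i.succAbove j < i → (n (i.succAbove j) : ℝ) < y

theorem sum_isFirstLarge {m : ℕ} {y N : ℝ} (hyN : y ^ (m + 1) = N)
    {n : Fin (m + 1) → ℕ} (hn : ∀ i, 1 ≤ n i) (hN : N ≤ ∏ i, (n i : ℝ)) (X : ℂ) :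
    ∑ i, (if IsFirstLarge y i n then X else 0) = X := by
  have hex : ∃ i, y ≤ n i := by
    by_contra h
    push Not at h
    have := Finset.prod_lt_prod_of_nonempty (s := Finset.univ) (f := fun i => (n i : ℝ))
      (g := fun _ => y) (fun i _ => by exact_mod_cast hn i) (fun i _ => h i)
      Finset.univ_nonempty
    rw [Finset.prod_const, Finset.card_univ, Fintype.card_fin, hyN] at this
    linarith
  obtain ⟨i, hi, hmin⟩ := WellFounded.has_min (wellFounded_lt (α := Fin (m + 1)))
    {i | y ≤ n i} hex
  have hfirst : IsFirstLarge y i n := ⟨hi, fun j hj => by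
    by_contra h
    exact hmin _ (not_lt.mp h) hj⟩
  rw [Finset.sum_eq_single i, if_pos hfirst]
  · intro b _ hb
    rw [if_neg]
    rintro ⟨hb1, hb2⟩
    rcases lt_or_gt_of_ne hb with h | h
    · exact hmin b hb1 h
    · obtain ⟨j, hj⟩ := Fin.exists_succAbove_eq hb.symm
      have := hb2 j (by rw [hj]; exact h)
      rw [hj] at this
      exact absurd hi (not_le.mpr this)
  · intro h
    exact absurd (Finset.mem_univ i) h

theorem norm_sum_tuple_le {m : ℕ} {f : Fin (m + 1) → ℕ → ℂ} {c : ℕ → ℝ} {N y E : ℝ}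
    (hN : 1 ≤ N) (hy : 1 ≤ y) (hyN : y ^ (m + 1) = N) (hE : 0 ≤ E)
    (hf : ∀ i a, ‖f i a‖ ≤ c a)
    (hsum : ∀ i x z, y ≤ x → x ≤ z → z ≤ 2 * N → ‖∑ a ∈ Finset.Ico ⌈x⌉₊ ⌈z⌉₊, f i a‖ ≤ E) :
    ‖∑ n ∈ Fintype.piFinset fun _ : Fin (m + 1) => Finset.Icc 1 ⌊2 * N⌋₊,
      if N ≤ ∏ i, (n i : ℝ) ∧ (∏ i, (n i : ℝ)) < 2 * N then ∏ i, f i (n i) else 0‖ ≤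
      (m + 1) * ((∑ a ∈ Finset.Icc 1 ⌊2 * N⌋₊, c a) ^ m * E) := by
  set I := Finset.Icc 1 ⌊2 * N⌋₊ with hI
  set X : (Fin (m + 1) → ℕ) → ℂ := fun n =>
    if N ≤ ∏ i, (n i : ℝ) ∧ (∏ i, (n i : ℝ)) < 2 * N then ∏ i, f i (n i) else 0 with hX
  have hsplit : ∑ n ∈ Fintype.piFinset (fun _ : Fin (m + 1) => I), X n =
      ∑ i, ∑ n ∈ Fintype.piFinset (fun _ : Fin (m + 1) => I),
        if IsFirstLarge y i n then X n else 0 := by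
    rw [Finset.sum_comm]
    refine Finset.sum_congr rfl fun n hn => ?_
    rw [Fintype.mem_piFinset] at hn
    by_cases hc : N ≤ ∏ i, (n i : ℝ) ∧ (∏ i, (n i : ℝ)) < 2 * N
    · exact (sum_isFirstLarge hyN (fun i => (Finset.mem_Icc.mp (hn i)).1) hc.1 _).symm
    · simp [hX, hc]
  change ‖∑ n ∈ Fintype.piFinset (fun _ : Fin (m + 1) => I), X n‖ ≤ _
  rw [hsplit]
  have hone : ∀ i : Fin (m + 1), ‖∑ n ∈ Fintype.piFinset (fun _ : Fin (m + 1) => I),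
      if IsFirstLarge y i n then X n else 0‖ ≤ (∑ a ∈ I, c a) ^ m * E := by
    intro i
    rw [sum_piFinset_eq_sum_insertNth i]
    have hpow : (∑ a ∈ I, c a) ^ m =
        ∑ r ∈ Fintype.piFinset (fun _ : Fin m => I), ∏ j, c (r j) := by
      rw [Finset.sum_prod_piFinset I fun _ => c]
      simp
    rw [hpow, Finset.sum_mul]
    refine (norm_sum_le _ _).trans (Finset.sum_le_sum fun r hr => ?_)
    rw [Fintype.mem_piFinset] at hr
    have hr1 : ∀ j, 1 ≤ (r j : ℝ) := fun j => by
      exact_mod_cast (Finset.mem_Icc.mp (hr j)).1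
    set R : ℝ := ∏ j, (r j : ℝ) with hR
    have hR1 : 1 ≤ R := by
      rw [hR, ← Finset.prod_const_one (s := (Finset.univ : Finset (Fin m)))]
      exact Finset.prod_le_prod (fun _ _ => zero_le_one) fun j _ => hr1 j
    have hR0 : 0 < R := by linarith
    have hc0 : ∀ a, 0 ≤ c a := fun a => (norm_nonneg _).trans (hf i a)
    have hprod0 : 0 ≤ ∏ j, c (r j) := Finset.prod_nonneg fun j _ => hc0 _
    by_cases hQ : ∀ j : Fin m, i.succAbove j < i → (r j : ℝ) < y
    swap
    · have hz : ∀ a ∈ I, (if IsFirstLarge y i (i.insertNth (α := fun _ => ℕ) a r) then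
          X (i.insertNth (α := fun _ => ℕ) a r) else 0) = 0 := by
        intro a _
        rw [if_neg]
        rintro ⟨-, h⟩
        exact hQ fun j hj => by simpa using h j hj
      rw [Finset.sum_eq_zero hz, norm_zero]
      positivity
    set x := max (N / R) y with hx
    set z := 2 * N / R with hz
    have hterm : ∀ a : ℕ, (if IsFirstLarge y i (i.insertNth (α := fun _ => ℕ) a r) then
        X (i.insertNth (α := fun _ => ℕ) a r) else 0) =
        if a ∈ Finset.Ico ⌈x⌉₊ ⌈z⌉₊ then f i a * ∏ j, f (i.succAbove j) (r j) else 0 := by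
      intro a
      have e1 : ∏ j, ((i.insertNth (α := fun _ => ℕ) a r j : ℕ) : ℝ) = a * R := by
        rw [Fin.prod_univ_succAbove _ i]
        simp [hR]
      have e2 : ∏ j, f j (i.insertNth (α := fun _ => ℕ) a r j) =
          f i a * ∏ j, f (i.succAbove j) (r j) := by
        rw [Fin.prod_univ_succAbove _ i]
        simp
      have e3 : IsFirstLarge y i (i.insertNth (α := fun _ => ℕ) a r) ↔ y ≤ a := by
        unfold IsFirstLarge
        simp only [Fin.insertNth_apply_same, Fin.insertNth_apply_succAbove]
        exact ⟨fun h => h.1, fun h => ⟨h, hQ⟩⟩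
      have e4 : a ∈ Finset.Ico ⌈x⌉₊ ⌈z⌉₊ ↔ y ≤ a ∧ N ≤ a * R ∧ a * R < 2 * N := by
        rw [Finset.mem_Ico, Nat.ceil_le, Nat.lt_ceil, hx, hz, max_le_iff, div_le_iff₀ hR0,
          lt_div_iff₀ hR0]
        tauto
      simp only [hX, e1, e2, e3, e4]
      split_ifs <;> tauto
    simp only [hterm]
    have hsub : I.filter (fun a => a ∈ Finset.Ico ⌈x⌉₊ ⌈z⌉₊) = Finset.Ico ⌈x⌉₊ ⌈z⌉₊ := by
      rw [Finset.filter_mem_eq_inter, Finset.inter_eq_right]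
      intro a ha
      rw [Finset.mem_Ico, Nat.ceil_le, Nat.lt_ceil] at ha
      rw [hI, Finset.mem_Icc]
      have h1 : (1 : ℝ) ≤ a := hy.trans ((le_max_right _ _).trans ha.1)
      have h2 : z ≤ 2 * N := div_le_self (by linarith) hR1
      exact ⟨by exact_mod_cast h1, Nat.le_floor (ha.2.le.trans h2)⟩
    rw [← Finset.sum_filter, hsub, ← Finset.sum_mul, norm_mul, mul_comm]
    have hprod : ‖∏ j, f (i.succAbove j) (r j)‖ ≤ ∏ j, c (r j) := by
      rw [norm_prod]
      exact Finset.prod_le_prod (fun j _ => norm_nonneg _) fun j _ => hf _ _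
    have hE' : ‖∑ a ∈ Finset.Ico ⌈x⌉₊ ⌈z⌉₊, f i a‖ ≤ E := by
      rcases le_or_gt x z with hxz | hxz
      · exact hsum i x z (le_max_right _ _) hxz (div_le_self (by linarith) hR1)
      · rw [Finset.Ico_eq_empty_of_le (Nat.ceil_le_ceil hxz.le)]
        simpa using hE
    gcongr
  calc _ ≤ ∑ i : Fin (m + 1), ‖_‖ := norm_sum_le _ _
    _ ≤ ∑ _i : Fin (m + 1), (∑ a ∈ I, c a) ^ m * E := Finset.sum_le_sum fun i _ => hone i
    _ = _ := by simp

end TupleSums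

section TuplePolynomials

theorem natCast_prod_cpow {ι : Type*} (s : Finset ι) (n : ι → ℕ) (z : ℂ) :
    ((∏ i ∈ s, n i : ℕ) : ℂ) ^ z = ∏ i ∈ s, (n i : ℂ) ^ z := by
  induction s using Finset.induction_on with
  | empty => simp
  | insert a s ha ih =>
    rw [Finset.prod_insert ha, Finset.prod_insert ha, Nat.cast_mul,
      Complex.natCast_mul_natCast_cpow, ih]

theorem tuplePoly_eq (k : ℕ) (g : Fin k → ℕ → ℝ) (N t : ℝ) :
    tuplePoly k g N t = ∑ n ∈ Fintype.piFinset fun _ : Fin k => Finset.Icc 1 ⌊2 * N⌋₊,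
      if N ≤ ∏ i, (n i : ℝ) ∧ (∏ i, (n i : ℝ)) < 2 * N then
        ∏ i, ((g i (n i) : ℂ) * (n i : ℂ) ^ (-(1 + (t : ℂ) * Complex.I))) else 0 := by
  unfold tuplePoly
  simp only [natCast_prod_cpow, Finset.prod_mul_distrib]

theorem abs_coeff_le {g : ℕ → ℝ}
    (hg : g = (fun n => ((ArithmeticFunction.moebius n : ℤ) : ℝ)) ∨
      g = (fun n => if n.Prime then 1 else 0) ∨ g = (fun _ => 1) ∨
      g = fun n : ℕ => Real.log n) (a : ℕ) : |g a| ≤ Real.log a + 1 := by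
  have h0 := Real.log_natCast_nonneg a
  rcases hg with rfl | rfl | rfl | rfl
  · exact isZetaSeries_moebius.abs_le a
  · dsimp only
    split_ifs <;> simp <;> linarith
  · exact isZetaSeries_one.abs_le a
  · exact isZetaSeries_log.abs_le a

theorem norm_coeff_mul_cpow_le {g : ℕ → ℝ} {a : ℕ} (hg : |g a| ≤ Real.log a + 1) (t : ℝ) :
    ‖(g a : ℂ) * (a : ℂ) ^ (-(1 + (t : ℂ) * Complex.I))‖ ≤ (Real.log a + 1) / a := by
  have hre : (-(1 + (t : ℂ) * Complex.I)).re = -1 := by simp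
  rcases Nat.eq_zero_or_pos a with rfl | ha
  · have hne : -(1 + (t : ℂ) * Complex.I) ≠ 0 := fun h => by
      rw [h] at hre
      norm_num at hre
    simp only [Nat.cast_zero, Complex.zero_cpow hne]
    simp
  · rw [norm_mul, Complex.norm_natCast_cpow_of_pos ha, hre, Complex.norm_real, Real.norm_eq_abs,
      Real.rpow_neg_one, div_eq_mul_inv]
    gcongr

theorem eventually_mul_sq_pow_le_exp (m : ℕ) :
    ∀ᶠ D : ℝ in Filter.atTop, (m + 1) * ((D + 3) ^ 2) ^ m ≤ Real.exp (2 * D ^ (1 / 10 : ℝ)) := by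
  filter_upwards [(tendsto_rpow_atTop (show (0 : ℝ) < 1 / 10 by norm_num)).eventually
    (eventually_mul_pow_le_exp (20 * m) (b := 2) (C := (m + 1) * 16 ^ m) (by norm_num)
      (by positivity)), Filter.eventually_ge_atTop 1] with D h hD
  have hD0 : 0 < D := by linarith
  refine le_trans ?_ h
  have e : (D ^ (1 / 10 : ℝ)) ^ (20 * m) = (D ^ 2) ^ m := by
    rw [pow_mul, ← Real.rpow_natCast (D ^ (1 / 10 : ℝ)) 20, ← Real.rpow_mul hD0.le]
    norm_num
  rw [e, mul_assoc, ← mul_pow]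
  gcongr
  nlinarith

end TuplePolynomials

/-- Lemma 17: a pointwise bound, coming from Vinogradov's zero-free region, for
Dirichlet polynomials whose coefficients are built from the Möbius function, the
indicator of the primes, the constant one function, or the logarithm. -/
theorem pointwise_bound_from_zero_free_region (k : ℕ) (hk : 1 ≤ k) (A : ℝ) (hA : 0 < A)
    (g : Fin k → ℕ → ℝ)
    (hg : ∀ i, g i = (fun n => ((ArithmeticFunction.moebius n : ℤ) : ℝ)) ∨
        g i = (fun n => if n.Prime then 1 else 0) ∨
        g i = (fun _ => 1) ∨
        g i = fun n : ℕ => Real.log n) :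
    ∃ N₀ : ℝ, ∀ N : ℝ, N₀ ≤ N → ∀ t : ℝ,
      Real.exp (Real.log N ^ ((1 : ℝ) / 3)) ≤ |t| → |t| ≤ N ^ (A * Real.log (Real.log N)) →
      ‖tuplePoly k g N t‖ ≤ Real.exp (-Real.log N ^ ((1 : ℝ) / 10)) := by
  obtain ⟨m, rfl⟩ : ∃ m, k = m + 1 := ⟨k - 1, by omega⟩
  have hall : ∀ᶠ D : ℝ in Filter.atTop, ∀ i : Fin (m + 1), ∀ t x z : ℝ,
      Real.exp (D ^ (1 / 3 : ℝ)) ≤ |t| → Real.log |t| ≤ A * D * Real.log D →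
      Real.exp (D / ((m + 1 : ℕ) : ℝ)) ≤ x → x ≤ z → z ≤ 2 * Real.exp D →
      ‖∑ n ∈ Finset.Ico ⌈x⌉₊ ⌈z⌉₊, (g i n : ℂ) * (n : ℂ) ^ (-(1 + (t : ℂ) * Complex.I))‖ ≤
        Real.exp (-(3 * D ^ (1 / 10 : ℝ))) :=
    Filter.eventually_all.mpr fun i => eventually_norm_sum_coeff_le hk hA (hg i)
  have hev : ∀ᶠ N : ℝ in Filter.atTop, ∀ t : ℝ,
      Real.exp (Real.log N ^ ((1 : ℝ) / 3)) ≤ |t| → |t| ≤ N ^ (A * Real.log (Real.log N)) →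
      ‖tuplePoly (m + 1) g N t‖ ≤ Real.exp (-Real.log N ^ ((1 : ℝ) / 10)) := by
    filter_upwards [Real.tendsto_log_atTop.eventually hall,
      Real.tendsto_log_atTop.eventually (eventually_mul_sq_pow_le_exp m),
      Filter.eventually_ge_atTop 1] with N h hfin hN t ht1 ht2
    have hN0 : 0 < N := by linarith
    have hD0 : 0 ≤ Real.log N := Real.log_nonneg hN
    have ht0 : 0 < |t| := (Real.exp_pos _).trans_le ht1
    have hlogt : Real.log |t| ≤ A * Real.log N * Real.log (Real.log N) := by
      refine (Real.log_le_log ht0 ht2).trans (le_of_eq ?_)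
      rw [Real.log_rpow hN0]
      ring
    set D := Real.log N with hD
    have hexpD : Real.exp D = N := Real.exp_log hN0
    have hy : 1 ≤ Real.exp (D / ((m + 1 : ℕ) : ℝ)) := Real.one_le_exp (by positivity)
    have hyN : Real.exp (D / ((m + 1 : ℕ) : ℝ)) ^ (m + 1) = N := by
      rw [← Real.exp_nat_mul, mul_div_cancel₀ _ (by positivity), hexpD]
    rw [tuplePoly_eq]
    refine (norm_sum_tuple_le (c := fun a => (Real.log a + 1) / a) hN hy hyN
      (Real.exp_pos (-(3 * D ^ (1 / 10 : ℝ)))).le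
      (fun i a => norm_coeff_mul_cpow_le (abs_coeff_le (hg i) a) t)
      (fun i x z hx hxz hz => h i t x z ht1 hlogt hx hxz (by rwa [hexpD]))).trans ?_
    have hM : Real.log (⌊2 * N⌋₊ : ℝ) ≤ D + 1 := by
      have h1 : (1 : ℝ) ≤ ⌊2 * N⌋₊ := by
        exact_mod_cast Nat.le_floor (by push_cast; linarith)
      have h2 := Real.log_le_log (by linarith) (Nat.floor_le (show 0 ≤ 2 * N by linarith))
      rw [Real.log_mul (by norm_num) hN0.ne'] at h2
      linarith [Real.log_two_lt_d9]
    have hS : ∑ a ∈ Finset.Icc 1 ⌊2 * N⌋₊, (Real.log a + 1) / a ≤ (D + 3) ^ 2 := by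
      refine (sum_log_add_one_div_le _).trans ?_
      have := Real.log_natCast_nonneg ⌊2 * N⌋₊
      exact pow_le_pow_left₀ (by linarith) (by linarith) 2
    have hS0 : 0 ≤ ∑ a ∈ Finset.Icc 1 ⌊2 * N⌋₊, (Real.log a + 1) / a :=
      Finset.sum_nonneg fun a _ => by
        have := Real.log_natCast_nonneg a
        positivity
    calc ((m : ℝ) + 1) * ((∑ a ∈ Finset.Icc 1 ⌊2 * N⌋₊, (Real.log a + 1) / a) ^ m *
          Real.exp (-(3 * D ^ (1 / 10 : ℝ)))) ≤
          (m + 1) * (((D + 3) ^ 2) ^ m * Real.exp (-(3 * D ^ (1 / 10 : ℝ)))) := by gcongr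
      _ = ((m + 1) * ((D + 3) ^ 2) ^ m) * Real.exp (-(3 * D ^ (1 / 10 : ℝ))) := by ring
      _ ≤ Real.exp (2 * D ^ (1 / 10 : ℝ)) * Real.exp (-(3 * D ^ (1 / 10 : ℝ))) := by gcongr
      _ = Real.exp (-D ^ ((1 : ℝ) / 10)) := by
        rw [← Real.exp_add]
        congr 1
        ring
  obtain ⟨N₀, hN₀⟩ := Filter.eventually_atTop.mp hev
  exact ⟨N₀, fun N hN => hN₀ N hN⟩
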